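/- For every positive integer n with n ≡ 0, 1, or 3 (mod 5) and n ∉ {5, 8}, one has N̄(0,5,n) > N̄(2,5,n). -/

import Mathlib

/-- An overpartition of `n`: a partition of `n` together with a chosen subset of its
distinct part sizes (the overlined parts). -/
def Overpartition (n : ℕ) : Type :=
  {P : n.Partition × Finset ℕ // P.2 ⊆ P.1.parts.toFinset}

/-- The Dyson rank of an overpartition: largest part minus number of parts. -/
def Overpartition.rank {n : ℕ} (P : Overpartition n) : ℤ :=
  (P.1.1.parts.sup : ℤ) - (P.1.1.parts.card : ℤ)

/-- `nbarRank m n` is the number of overpartitions of `n` with rank `m`. -/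
noncomputable def nbarRank (m : ℤ) (n : ℕ) : ℕ :=
  Nat.card {P : Overpartition n // P.rank = m}

/-- `nbar a c n` is the number of overpartitions of `n` with rank congruent to `a` mod `c`. -/
noncomputable def nbar (a : ℤ) (c : ℕ) (n : ℕ) : ℕ :=
  Nat.card {P : Overpartition n // P.rank ≡ a [ZMOD (c : ℤ)]}

/-- `pbar n` is the number of overpartitions of `n`. -/
noncomputable def pbar (n : ℕ) : ℕ := Nat.card (Overpartition n)

open Filter Topology


lemma gsum_k {r : ℝ} (h0 : 0 < r) (h1 : r < 1) {z : ℝ} (hz : 0 < z) (k : ℕ) :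
    Summable fun n : ℤ => |(n:ℝ)|^k * (r^(n*n) * z^n) := by
  have hl : Real.log r < 0 := Real.log_neg h0 h1
  have hpi := Real.pi_pos
  have hT : 0 < -Real.log r / Real.pi := by apply div_pos <;> linarith
  refine (summable_pow_mul_jacobiTheta₂_term_bound (|Real.log z|/(2*Real.pi)) hT k).of_norm_bounded ?_
  intro n
  have e1 : r^(n*n) = Real.exp (Real.log r * (n:ℝ)^2) := by
    rw [← Real.rpow_intCast, Real.rpow_def_of_pos h0]; push_cast; ring_nf
  have e2 : z^n = Real.exp (Real.log z * (n:ℝ)) := by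
    rw [← Real.rpow_intCast, Real.rpow_def_of_pos hz]
  rw [e1, e2, ← Real.exp_add, Real.norm_eq_abs, abs_mul, abs_pow, abs_abs, Real.abs_exp]
  push_cast
  gcongr
  have : Real.log z * n ≤ |Real.log z| * |(n:ℝ)| := by rw [← abs_mul]; exact le_abs_self _
  have e : -Real.pi * (-Real.log r / Real.pi * (n:ℝ)^2 - 2 * (|Real.log z|/(2*Real.pi)) * |(n:ℝ)|)
      = Real.log r * (n:ℝ)^2 + |Real.log z| * |(n:ℝ)| := by field_simp; ring
  rw [e]; linarith

lemma gsum {r : ℝ} (h0 : 0 < r) (h1 : r < 1) {z : ℝ} (hz : 0 < z) :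
    Summable fun n : ℤ => r^(n*n) * z^n := by
  simpa using gsum_k h0 h1 hz 0

/-- general gaussian summability with signs -/
lemma gsq {r : ℝ} (h0 : 0 < r) (h1 : r < 1) (z : ℝ) (hz : z ≠ 0) (A B C : ℤ) (hA : 0 < A) :
    Summable fun n : ℤ => r^(A*(n*n)+B*n+C) * z^n := by
  have hr : r^A < 1 := zpow_lt_one₀ h0 h1 hA
  have := (gsum (zpow_pos h0 A) hr (z := r^B*|z|) (by positivity)).mul_left (r^C)
  refine this.of_norm_bounded ?_
  intro n
  rw [norm_mul, norm_zpow, norm_zpow, Real.norm_eq_abs, Real.norm_eq_abs, abs_of_pos h0,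
    zpow_add₀ h0.ne', zpow_add₀ h0.ne', mul_zpow, ← zpow_mul, ← zpow_mul]
  apply le_of_eq; ring

def shearEquiv : ℤ × ℤ ≃ ℤ × ℤ where
  toFun p := (p.2, p.1 - p.2)
  invFun p := (p.1 + p.2, p.1)
  left_inv p := by ext <;> simp
  right_inv p := by ext <;> simp

lemma conv_hasSum {f g : ℤ → ℝ} {F G : ℝ} (hf : HasSum f F) (hg : HasSum g G) :
    (∀ k, Summable fun j => f j * g (k - j)) ∧
    HasSum (fun k => ∑' j, f j * g (k - j)) (F * G) := by
  have h1 := summable_mul_of_summable_norm hf.summable.norm hg.summable.norm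
  have h2 := hf.mul hg h1
  have h3 : HasSum (fun p : ℤ × ℤ => f p.2 * g (p.1 - p.2)) (F * G) :=
    (shearEquiv.hasSum_iff (f := fun p : ℤ × ℤ => f p.1 * g p.2)).2 h2
  have h4 : ∀ k, Summable fun j => f j * g (k - j) := fun k => h3.summable.prod_factor k
  exact ⟨h4, h3.prod_fiberwise fun k => (h4 k).hasSum⟩

/-- Laurent series product -/
lemma convz {V g : ℤ → ℝ} {z F G : ℝ} (hz : z ≠ 0) (hV : HasSum (fun j => V j * z^j) F)
    (hg : HasSum (fun j => g j * z^j) G) :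
    (∀ k, Summable fun j => V j * g (k - j)) ∧
    HasSum (fun k => (∑' j, V j * g (k - j)) * z^k) (F * G) := by
  obtain ⟨h1, h2⟩ := conv_hasSum hV hg
  have e : ∀ k j, V j * z^j * (g (k-j) * z^(k-j)) = V j * g (k-j) * z^k := by
    intro k j
    rw [zpow_sub₀ hz]; field_simp
  simp only [e] at h1 h2
  refine ⟨fun k => ?_, ?_⟩
  · exact (summable_mul_right_iff (zpow_ne_zero k hz)).1 (h1 k)
  · simpa only [tsum_mul_right] using h2

lemma tsum_shift (f : ℤ → ℝ) (c : ℤ) : ∑' j, f (j + c) = ∑' j, f j :=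
  (Equiv.addRight c).tsum_eq f

lemma summable_shift {f : ℤ → ℝ} (c : ℤ) (h : Summable f) : Summable fun j => f (j + c) :=
  (Equiv.addRight c).summable_iff.2 h

lemma hasSum_shift {f : ℤ → ℝ} {a : ℝ} (c : ℤ) (h : HasSum f a) : HasSum (fun j => f (j + c)) a :=
  (Equiv.addRight c).hasSum_iff.2 h

lemma hasSum_refl {f : ℤ → ℝ} {a : ℝ} (c : ℤ) (h : HasSum f a) : HasSum (fun j => f (c - j)) a :=
  (Equiv.subLeft c).hasSum_iff.2 h

lemma HasSum.cg {ι : Type*} {f g : ι → ℝ} {a b : ℝ} (h : HasSum f a) (e : ∀ n, g n = f n)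
    (e2 : b = a) : HasSum g b := by
  rw [e2, show g = f from funext e]; exact h


noncomputable def Pq (z q : ℝ) : ℝ := ∏' k : ℕ, (1 - z * q^k)

lemma Pq_sum {q : ℝ} (h0 : 0 < q) (h1 : q < 1) (z : ℝ) : Summable fun k : ℕ => ‖-(z * q^k)‖ := by
  have := ((summable_geometric_of_lt_one h0.le h1).mul_left z).norm
  simpa using this

lemma Pq_mult {q : ℝ} (h0 : 0 < q) (h1 : q < 1) (z : ℝ) :
    Multipliable fun k : ℕ => (1 - z * q^k) := by
  simpa only [sub_eq_add_neg] using multipliable_one_add_of_summable (Pq_sum h0 h1 z)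

lemma Pq_ne {q : ℝ} (h0 : 0 < q) (h1 : q < 1) {z : ℝ} (h : ∀ k : ℕ, z * q^k ≠ 1) :
    Pq z q ≠ 0 := by
  unfold Pq
  simp only [sub_eq_add_neg]
  apply tprod_one_add_ne_zero_of_summable _ (Pq_sum h0 h1 z)
  intro k hk
  exact h k (by linarith)

lemma Pq_tendsto {q : ℝ} (h0 : 0 < q) (h1 : q < 1) (z : ℝ) :
    Tendsto (fun N => ∏ k ∈ Finset.range N, (1 - z * q^k)) atTop (𝓝 (Pq z q)) :=
  (Pq_mult h0 h1 z).hasProd.tendsto_prod_nat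

lemma Pq_pos {q : ℝ} (h0 : 0 < q) (h1 : q < 1) {z : ℝ} (h : z < 1) :
    0 < Pq z q := by
  have hk : ∀ k : ℕ, z * q^k < 1 := by
    intro k
    have h2 : q^k ≤ 1 := pow_le_one₀ h0.le h1.le
    have h3 : 0 < q^k := by positivity
    by_cases hz : 0 ≤ z
    · nlinarith
    · nlinarith
  have hne := Pq_ne h0 h1 (fun k => (hk k).ne)
  have : 0 ≤ Pq z q := by
    apply ge_of_tendsto' (Pq_tendsto h0 h1 z)
    intro N
    apply Finset.prod_nonneg
    intro k _
    linarith [hk k]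
  exact lt_of_le_of_ne this hne.symm

/-- continuity in z -/
lemma Pq_cont {q : ℝ} (h0 : 0 < q) (h1 : q < 1) (z : ℝ) {ι : Type*} {l : Filter ι} {f : ι → ℝ}
    (hf : Tendsto f l (𝓝 z)) : Tendsto (fun i => Pq (f i) q) l (𝓝 (Pq z q)) := by
  unfold Pq
  simp only [sub_eq_add_neg]
  have hb : Summable fun k : ℕ => (|z|+1) * q^k :=
    (summable_geometric_of_lt_one h0.le h1).mul_left _
  apply tendsto_tprod_one_add_of_dominated_convergence hb
  · intro k
    exact (hf.mul_const _).neg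
  · have : ∀ᶠ i in l, |f i| < |z| + 1 := hf.abs.eventually_lt_const (by linarith)
    filter_upwards [this] with i hi k
    rw [norm_neg, norm_mul, Real.norm_eq_abs, Real.norm_eq_abs, abs_of_pos (pow_pos h0 k)]
    gcongr

lemma Pq_succ {q : ℝ} (h0 : 0 < q) (h1 : q < 1) (z : ℝ) : Pq z q = (1 - z) * Pq (z*q) q := by
  unfold Pq
  have hm : Multipliable fun k : ℕ => (1 - z * q^(k+1)) := by
    refine (Pq_mult h0 h1 (z*q)).congr fun k => ?_
    rw [pow_succ']; ring
  have e := tprod_eq_zero_mul' (f := fun k : ℕ => 1 - z * q^k) hm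
  rw [e]
  simp only [pow_zero, mul_one, pow_succ']
  congr 2; ext k; ring

lemma Pq_neg_mul {q : ℝ} (h0 : 0 < q) (h1 : q < 1) (z : ℝ) :
    Pq z q * Pq (-z) q = Pq (z^2) (q^2) := by
  unfold Pq
  rw [← Multipliable.tprod_mul (Pq_mult h0 h1 z) (Pq_mult h0 h1 (-z))]
  congr 1; ext k
  rw [← pow_mul, mul_comm 2 k, pow_mul]; ring

lemma Pq_split {q : ℝ} (h0 : 0 < q) (h1 : q < 1) (z : ℝ) :
    Pq z q = Pq z (q^2) * Pq (z*q) (q^2) := by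
  have h2 : q^2 < 1 := by nlinarith
  unfold Pq
  rw [← tprod_even_mul_odd (f := fun k : ℕ => 1 - z * q^k)]
  · congr 2
    · ext k; rw [pow_mul]
    · ext k; rw [pow_succ, pow_mul]; ring
  · refine (Pq_mult (by positivity) h2 z).congr fun k => ?_
    rw [pow_mul]
  · refine (Pq_mult (by positivity) h2 (z*q)).congr fun k => ?_
    rw [pow_succ q (2*k), pow_mul]; ring

/-! ### Jacobi triple product -/

noncomputable def thc (r : ℝ) (n : ℤ) : ℝ := (-1)^n * r^(n*n-n)
noncomputable def th (r z : ℝ) : ℝ := ∑' n : ℤ, thc r n * z^n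

lemma thc_zero (r : ℝ) : thc r 0 = 1 := by simp [thc]

lemma thc_succ {r : ℝ} (hr : r ≠ 0) (n : ℤ) : thc r (n+1) = -(r^2)^n * thc r n := by
  unfold thc
  have : (n+1)*(n+1)-(n+1) = (n*n-n) + 2*n := by ring
  rw [this, zpow_add₀ hr, zpow_mul, zpow_add_one₀ (by norm_num)]
  rw [show r^(2:ℤ) = r^2 by norm_cast]; ring

lemma thc_abs {r : ℝ} (hr : 0 < r) (n : ℤ) : |thc r n| = r^(n*n-n) := by
  simp [thc, abs_mul, abs_zpow, abs_of_pos hr]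

lemma thc_neg (r : ℝ) (n : ℤ) : thc r (1-n) = - thc r n := by
  unfold thc
  rw [zpow_sub₀ (by norm_num)]
  have : (1-n)*(1-n)-(1-n) = n*n-n := by ring
  rw [this, div_eq_mul_inv, ← inv_zpow]; norm_num

lemma thc_summable {r : ℝ} (h0 : 0 < r) (h1 : r < 1) {z : ℝ} (hz : z ≠ 0) :
    Summable fun n : ℤ => thc r n * z^n := by
  have := gsq h0 h1 (-z) (neg_ne_zero.2 hz) 1 (-1) 0 (by norm_num)
  refine this.congr fun n => ?_
  unfold thc
  rw [neg_eq_neg_one_mul z, mul_zpow]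
  have : 1*(n*n)+(-1)*n+0 = n*n-n := by ring
  rw [this]; ring

lemma th_hasSum {r : ℝ} (h0 : 0 < r) (h1 : r < 1) {z : ℝ} (hz : z ≠ 0) :
    HasSum (fun n : ℤ => thc r n * z^n) (th r z) := (thc_summable h0 h1 hz).hasSum

noncomputable def eq' (q : ℝ) (N : ℕ) : ℝ := ∏ k ∈ Finset.range N, (1 - q * q^k)

noncomputable def ie (q : ℝ) (m : ℤ) : ℝ := if 0 ≤ m then (eq' q m.toNat)⁻¹ else 0

lemma eq'_pos {q : ℝ} (h0 : 0 < q) (h1 : q < 1) (N : ℕ) : 0 < eq' q N := by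
  apply Finset.prod_pos
  intro k _
  have : q^k ≤ 1 := pow_le_one₀ h0.le h1.le
  nlinarith

lemma eq'_succ (q : ℝ) (N : ℕ) : eq' q (N+1) = eq' q N * (1 - q^(N+1)) := by
  rw [eq', Finset.prod_range_succ, pow_succ', eq']

lemma eq'_le (q : ℝ) (h0 : 0 < q) (h1 : q < 1) (N : ℕ) : eq' q N ≤ 1 := by
  induction N with
  | zero => simp [eq']
  | succ n ih =>
    rw [eq'_succ]
    have := eq'_pos h0 h1 n
    have : 0 < q^(n+1) := by positivity
    nlinarith

lemma eq'_ge (q : ℝ) (h0 : 0 < q) (h1 : q < 1) (N : ℕ) : Pq q q ≤ eq' q N := by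
  have hanti : Antitone (eq' q) := by
    apply antitone_nat_of_succ_le
    intro n
    rw [eq'_succ]
    have := eq'_pos h0 h1 n
    have : 0 < q^(n+1) := by positivity
    nlinarith
  exact hanti.le_of_tendsto (Pq_tendsto h0 h1 q) N

lemma ie_rec {q : ℝ} (h0 : 0 < q) (h1 : q < 1) (m : ℤ) : ie q (m-1) = (1 - q^m) * ie q m := by
  unfold ie
  rcases lt_trichotomy m 0 with h | h | h
  · rw [if_neg (by omega), if_neg (by omega)]; ring
  · subst h; simp
  · obtain ⟨k, rfl⟩ : ∃ k : ℕ, m = k + 1 := ⟨(m-1).toNat, by omega⟩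
    rw [if_pos (by omega), if_pos (by omega)]
    have e1 : ((k:ℤ)+1-1).toNat = k := by omega
    have e2 : ((k:ℤ)+1).toNat = k+1 := by omega
    rw [e1, e2, eq'_succ]
    have := (eq'_pos h0 h1 k).ne'
    have h3 : q^(k+1) < 1 := pow_lt_one₀ h0.le h1 (by omega)
    have : 1 - q^(k+1) ≠ 0 := by linarith
    have e3 : q^((k:ℤ)+1) = q^(k+1) := by norm_cast
    rw [e3]
    field_simp

lemma ie_bound {q : ℝ} (h0 : 0 < q) (h1 : q < 1) (m : ℤ) : |ie q m| ≤ (Pq q q)⁻¹ := by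
  have hp := Pq_pos h0 h1 h1
  unfold ie
  split_ifs
  · rw [abs_of_pos (inv_pos.2 (eq'_pos h0 h1 _))]
    exact inv_anti₀ hp (eq'_ge q h0 h1 _)
  · rw [abs_zero]; positivity

noncomputable def jc (r : ℝ) (N : ℕ) (n : ℤ) : ℝ :=
  thc r n * (eq' (r^2) (2*N) * ie (r^2) (N+n) * ie (r^2) (N-n))

lemma jc_rec {r : ℝ} (h0 : 0 < r) (h1 : r < 1) (N : ℕ) (n : ℤ) :
    jc r (N+1) n = jc r N n * (1 + (r^2)^(2*N+1)) - (r^2)^N * jc r N (n-1)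
      - (r^2)^(N+1) * jc r N (n+1) := by
  have q0 : 0 < r^2 := by positivity
  have q1 : r^2 < 1 := by nlinarith
  have t1 := thc_succ h0.ne' n
  have t2 := thc_succ h0.ne' (n-1)
  rw [sub_add_cancel] at t2
  unfold jc
  generalize r^2 = q at *
  have a1 := ie_rec q0 q1 (N+1+n)
  have a2 := ie_rec q0 q1 (N+1-n)
  have a3 := ie_rec q0 q1 (N+n)
  have a4 := ie_rec q0 q1 (N-n)
  have b1 : (N:ℤ)+1+n-1 = N+n := by ring
  have b2 : (N:ℤ)+1-n-1 = N-n := by ring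
  rw [b1] at a1
  rw [b2] at a2
  have c1 : (N:ℤ) + (n-1) = N+n-1 := by ring
  have c2 : (N:ℤ) - (n-1) = N+1-n := by ring
  have c3 : (N:ℤ) + (n+1) = N+1+n := by ring
  have c4 : (N:ℤ) - (n+1) = N-n-1 := by ring
  have e0 : eq' q (2*(N+1)) = eq' q (2*N) * (1-q^(2*N+1)) * (1-q^(2*N+2)) := by
    rw [show 2*(N+1) = 2*N+1+1 by ring, eq'_succ, eq'_succ]
  rw [c1, c2, c3, c4, a3, a4, a1, a2, t1, e0]
  push_cast
  have hu : q^n ≠ 0 := (zpow_pos q0 n).ne'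
  have t3 : thc r (n-1) = - (q^n)⁻¹ * q * thc r n := by
    rw [t2, zpow_sub_one₀ q0.ne']; field_simp
  rw [t3]
  have d1 : q^((N:ℤ)+1+n) = q^N * q * q^n := by
    rw [zpow_add₀ q0.ne', zpow_add_one₀ q0.ne', zpow_natCast]
  have d2 : q^((N:ℤ)+1-n) = q^N * q * (q^n)⁻¹ := by
    rw [zpow_sub₀ q0.ne', zpow_add_one₀ q0.ne', zpow_natCast]; ring
  have d3 : q^((N:ℤ)+n) = q^N * q^n := by
    rw [zpow_add₀ q0.ne', zpow_natCast]
  have d4 : q^((N:ℤ)-n) = q^N * (q^n)⁻¹ := by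
    rw [zpow_sub₀ q0.ne', zpow_natCast]; ring
  rw [d1, d2, d3, d4]
  have d5 : q^(2*N+1) = (q^N)^2*q := by ring
  have d6 : q^(2*N+2) = (q^N)^2*q^2 := by ring
  rw [d5, d6, pow_succ q N]
  generalize q^N = a
  generalize q^n = u at *
  field_simp
  ring

lemma jc_hasSum {r : ℝ} (h0 : 0 < r) (h1 : r < 1) {z : ℝ} (hz : z ≠ 0) (N : ℕ) :
    HasSum (fun n : ℤ => jc r N n * z^n)
      ((∏ k ∈ Finset.range N, (1 - z * (r^2)^k)) * ∏ k ∈ Finset.range N, (1 - (r^2)/z * (r^2)^k)) := by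
  induction N with
  | zero =>
    have : ∀ n : ℤ, n ≠ 0 → jc r 0 n * z^n = 0 := by
      intro n hn
      unfold jc ie
      rcases lt_or_gt_of_ne hn with h | h
      · rw [if_neg (by push_cast; omega)]; ring
      · rw [if_neg (c := 0 ≤ ((0:ℕ):ℤ) - n) (by push_cast; omega)]; ring
    have h2 := hasSum_single 0 this
    simpa [jc, thc_zero, ie, eq'] using h2
  | succ N ih =>
    have s1 := (hasSum_shift (-1) ih).mul_left z
    have s2 := (hasSum_shift 1 ih).mul_left z⁻¹
    have s := ((ih.mul_right (1 + (r^2)^(2*N+1))).sub (s1.mul_left ((r^2)^N))).sub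
      (s2.mul_left ((r^2)^(N+1)))
    refine s.cg (fun n => ?_) ?_
    · rw [jc_rec h0 h1, zpow_add₀ hz n (-1), zpow_add₀ hz n 1, zpow_neg_one, zpow_one,
        ← sub_eq_add_neg]
      field_simp
    · rw [Finset.prod_range_succ, Finset.prod_range_succ]
      field_simp
      ring

theorem jtp {r : ℝ} (h0 : 0 < r) (h1 : r < 1) {z : ℝ} (hz : z ≠ 0) :
    th r z = Pq z (r^2) * Pq (r^2/z) (r^2) * Pq (r^2) (r^2) := by
  have q0 : 0 < r^2 := by positivity
  have q1 : r^2 < 1 := by nlinarith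
  set E := Pq (r^2) (r^2) with hE
  have hEp : 0 < E := Pq_pos q0 q1 q1
  have hlim : Tendsto (eq' (r^2)) atTop (𝓝 E) := Pq_tendsto q0 q1 _
  have L1 := (Pq_tendsto q0 q1 z).mul (Pq_tendsto q0 q1 (r^2/z))
  have L2 : Tendsto (fun N : ℕ => ∑' n : ℤ, jc r N n * z^n) atTop
      (𝓝 (∑' n : ℤ, thc r n * z^n * E⁻¹)) := by
    apply tendsto_tsum_of_dominated_convergence
      (bound := fun n => |thc r n * z^n| * (E⁻¹ * E⁻¹))
    · exact (thc_summable h0 h1 hz).norm.mul_right _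
    · intro n
      have i1 : Tendsto (fun N : ℕ => ie (r^2) (N+n)) atTop (𝓝 E⁻¹) := by
        have t : Tendsto (fun N : ℕ => ((N:ℤ)+n).toNat) atTop atTop := by
          rw [tendsto_atTop]; intro b
          filter_upwards [eventually_ge_atTop (b + n.natAbs)] with N hN
          omega
        refine ((hlim.comp t).inv₀ hEp.ne').congr' ?_
        filter_upwards [eventually_ge_atTop n.natAbs] with N hN
        rw [ie, if_pos (by omega)]; rfl
      have i2 : Tendsto (fun N : ℕ => ie (r^2) (N-n)) atTop (𝓝 E⁻¹) := by
        have t : Tendsto (fun N : ℕ => ((N:ℤ)-n).toNat) atTop atTop := by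
          rw [tendsto_atTop]; intro b
          filter_upwards [eventually_ge_atTop (b + n.natAbs)] with N hN
          omega
        refine ((hlim.comp t).inv₀ hEp.ne').congr' ?_
        filter_upwards [eventually_ge_atTop n.natAbs] with N hN
        rw [ie, if_pos (by omega)]; rfl
      have i3 : Tendsto (fun N : ℕ => eq' (r^2) (2*N)) atTop (𝓝 E) :=
        hlim.comp (tendsto_id.const_mul_atTop' (by norm_num))
      have := (((i3.mul i1).mul i2).const_mul (thc r n)).mul_const (z^n)
      have e : thc r n * z^n * E⁻¹ = thc r n * (E * E⁻¹ * E⁻¹) * z^n := by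
        rw [mul_inv_cancel₀ hEp.ne']; ring
      rw [e]; exact this
    · refine Eventually.of_forall fun N n => ?_
      unfold jc
      rw [Real.norm_eq_abs]
      have e : thc r n * (eq' (r^2) (2*N) * ie (r^2) (N+n) * ie (r^2) (N-n)) * z^n
        = (thc r n * z^n) * (eq' (r^2) (2*N) * (ie (r^2) (N+n) * ie (r^2) (N-n))) := by ring
      rw [e, abs_mul]
      gcongr
      rw [abs_mul, abs_mul]
      have b1 := ie_bound q0 q1 (N+n)
      have b2 := ie_bound q0 q1 (N-n)
      have b3 : |eq' (r^2) (2*N)| ≤ 1 := by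
        rw [abs_of_pos (eq'_pos q0 q1 _)]; exact eq'_le _ q0 q1 _
      calc _ ≤ 1 * (E⁻¹ * E⁻¹) := by gcongr
        _ = _ := one_mul _
  have L3 : Tendsto (fun N : ℕ => ∑' n : ℤ, jc r N n * z^n) atTop
      (𝓝 (Pq z (r^2) * Pq (r^2/z) (r^2))) := L1.congr fun N => ((jc_hasSum h0 h1 hz N).tsum_eq).symm
  have := tendsto_nhds_unique L3 L2
  rw [tsum_mul_right] at this
  rw [this, th]
  field_simp


/-- bilateral geometric bound -/
lemma bisum_bound {c : ℤ → ℝ} {M q x : ℝ} (q0 : 0 < q) (hx0 : q < x) (hx1 : x < 1)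
    (h1 : ∀ k, 0 ≤ k → |c k| ≤ M) (h2 : ∀ k, k ≤ 0 → |c k| ≤ M * q^(-k)) :
    Summable fun k : ℤ => c k * x^k := by
  have x0 : 0 < x := q0.trans hx0
  apply Summable.of_nat_of_neg
  · refine ((summable_geometric_of_lt_one x0.le hx1).mul_left M).of_norm_bounded fun n => ?_
    rw [norm_mul, Real.norm_eq_abs, Real.norm_eq_abs, zpow_natCast, abs_of_pos (pow_pos x0 n)]
    gcongr
    exact h1 n (by omega)
  · have hs : q/x < 1 := (div_lt_one x0).2 hx0
    refine ((summable_geometric_of_lt_one (by positivity) hs).mul_left M).of_norm_bounded fun n => ?_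
    rw [norm_mul, Real.norm_eq_abs, Real.norm_eq_abs, abs_of_pos (zpow_pos x0 _)]
    have := h2 (-n) (by omega)
    rw [neg_neg, zpow_natCast] at this
    calc |c (-n)| * x^(-(n:ℤ)) ≤ M * q^n * x^(-(n:ℤ)) := by gcongr
      _ = M * (q/x)^n := by rw [zpow_neg, zpow_natCast, div_pow]; ring

lemma Pq_one {q : ℝ} (h0 : 0 < q) (h1 : q < 1) : Pq 1 q = 0 := by
  rw [Pq_succ h0 h1]; ring

lemma th_q {r : ℝ} (h0 : 0 < r) (h1 : r < 1) : th r (r^2) = 0 := by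
  have q0 : 0 < r^2 := by positivity
  have q1 : r^2 < 1 := by nlinarith
  rw [jtp h0 h1 q0.ne', div_self q0.ne', Pq_one q0 q1]; ring

lemma th_one {r : ℝ} (h0 : 0 < r) (h1 : r < 1) : th r 1 = 0 := by
  have q0 : 0 < r^2 := by positivity
  have q1 : r^2 < 1 := by nlinarith
  rw [jtp h0 h1 one_ne_zero, Pq_one q0 q1]; ring

noncomputable def kc (q b : ℝ) (k : ℤ) : ℝ := (1 - b * q^k)⁻¹

lemma kron_aux {r : ℝ} (h0 : 0 < r) (h1 : r < 1) {b : ℝ} (hb0 : b ≠ 0)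
    (hb : ∀ k : ℤ, b * (r^2)^k ≠ 1) {M : ℝ} (hM1 : ∀ k, |kc (r^2) b k| ≤ M)
    (hM2 : ∀ k, |kc (r^2) b k| ≤ M * (r^2)^(-k)) {x : ℝ} (hx0 : r^2 < x) (hx1 : x < 1) :
    th r x * ∑' k : ℤ, kc (r^2) b k * x^k = (∑' j, thc r j * kc (r^2) b (0-j)) * th r (b*x) := by
  have q0 : 0 < r^2 := by positivity
  have x0 : 0 < x := q0.trans hx0
  have hs := bisum_bound q0 hx0 hx1 (fun k _ => hM1 k) (fun k _ => hM2 k)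
  obtain ⟨s1, s2⟩ := convz x0.ne' (th_hasSum h0 h1 x0.ne') hs.hasSum
  set h : ℤ → ℝ := fun k => ∑' j, thc r j * kc (r^2) b (k - j) with hh
  have hrec : ∀ k, h (k+1) = -(b * (r^2)^k) * h k := by
    intro k
    have e1 : h (k+1) = ∑' j, thc r (j+1) * kc (r^2) b (k-j) := by
      rw [hh]; simp only
      rw [← tsum_shift _ 1]
      congr 1; ext j; congr 2; ring
    have e2 : ∀ j, thc r (j+1) * kc (r^2) b (k-j) =
        -(b * (r^2)^k) * (thc r j * kc (r^2) b (k-j)) - thc r j * (r^2)^j := by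
      intro j
      rw [thc_succ h0.ne', kc]
      have hy := hb (k-j)
      rw [zpow_sub₀ q0.ne'] at hy ⊢
      have hu : (r^2)^j ≠ 0 := (zpow_pos q0 j).ne'
      generalize (r^2)^j = u at *
      generalize (r^2)^k = w at *
      have h3 : 1 - b * (w/u) ≠ 0 := fun h => hy (by linarith)
      have h4 : u - b * w ≠ 0 := by
        intro h; apply h3; field_simp; linarith
      field_simp
      ring
    rw [e1]
    simp only [e2]
    rw [((s1 k).mul_left _).tsum_sub (thc_summable h0 h1 q0.ne'), tsum_mul_left]
    have := th_q h0 h1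
    rw [th] at this
    rw [this, sub_zero]
  have hcl : ∀ k, h k = h 0 * (thc r k * b^k) := by
    intro k
    induction k with
    | zero => simp [thc_zero]
    | succ n ih =>
      rw [hrec, ih, thc_succ h0.ne', zpow_add_one₀ hb0]; ring
    | pred n ih =>
      have r1 := hrec (-n-1)
      have r2 := thc_succ h0.ne' (-n-1)
      rw [sub_add_cancel] at r1 r2
      have hne : -(b * (r^2)^(-(n:ℤ)-1)) ≠ 0 := neg_ne_zero.2 (mul_ne_zero hb0 (zpow_pos q0 _).ne')
      apply mul_left_cancel₀ hne
      rw [← r1, ih, r2, zpow_sub_one₀ hb0]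
      field_simp
  have s3 : HasSum (fun k => h k * x^k) (h 0 * th r (b*x)) := by
    refine ((th_hasSum h0 h1 (mul_ne_zero hb0 x0.ne')).mul_left (h 0)).cg (fun k => ?_) rfl
    rw [hcl k, mul_zpow]; ring
  exact s2.unique s3

lemma th_cont {r : ℝ} (h0 : 0 < r) (h1 : r < 1) {z : ℝ} (hz : z ≠ 0) {ι : Type*} {l : Filter ι}
    {f : ι → ℝ} (hf : Tendsto f l (𝓝 z)) : Tendsto (fun i => th r (f i)) l (𝓝 (th r z)) := by
  have q0 : 0 < r^2 := by positivity
  have q1 : r^2 < 1 := by nlinarith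
  rw [jtp h0 h1 hz]
  have : Tendsto (fun i => Pq (f i) (r^2) * Pq (r^2 / f i) (r^2) * Pq (r^2) (r^2)) l
      (𝓝 (Pq z (r^2) * Pq (r^2/z) (r^2) * Pq (r^2) (r^2))) :=
    ((Pq_cont q0 q1 z hf).mul (Pq_cont q0 q1 _ (tendsto_const_nhds.div hf hz))).mul_const _
  refine this.congr' ?_
  filter_upwards [hf.eventually_ne hz] with i hi
  rw [jtp h0 h1 hi]

theorem kron {r : ℝ} (h0 : 0 < r) (h1 : r < 1) {b : ℝ} (hb0 : b ≠ 0)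
    (hb : ∀ k : ℤ, b * (r^2)^k ≠ 1) {M : ℝ} (hM1 : ∀ k, |kc (r^2) b k| ≤ M)
    (hM2 : ∀ k, |kc (r^2) b k| ≤ M * (r^2)^(-k)) {x : ℝ} (hx0 : r^2 < x) (hx1 : x < 1) :
    th r b * th r x * ∑' k : ℤ, kc (r^2) b k * x^k = Pq (r^2) (r^2)^3 * th r (b*x) := by
  have q0 : 0 < r^2 := by positivity
  have q1 : r^2 < 1 := by nlinarith
  set C := ∑' j, thc r j * kc (r^2) b (0-j) with hC
  have M0 : 0 ≤ M := (abs_nonneg _).trans (hM1 0)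
  have key : C * th r b = Pq (r^2) (r^2)^3 := by
    have hw : Tendsto (fun x : ℝ => x) (𝓝[<] 1) (𝓝 1) := tendsto_id.mono_left nhdsWithin_le_nhds
    have hev : ∀ᶠ x : ℝ in 𝓝[<] 1, r < x ∧ x < 1 :=
      (eventually_nhdsWithin_of_eventually_nhds (eventually_gt_nhds h1)).and
        (eventually_mem_nhdsWithin)
    have hrr : r^2 < r := by nlinarith
    have L1 : Tendsto (fun x : ℝ => C * th r (b*x)) (𝓝[<] 1) (𝓝 (C * th r b)) := by
      apply Tendsto.const_mul
      apply th_cont h0 h1 hb0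
      simpa using hw.const_mul b
    have L2 : Tendsto (fun x : ℝ => Pq (x * r^2) (r^2) * Pq (r^2/x) (r^2) * Pq (r^2) (r^2))
        (𝓝[<] 1) (𝓝 (Pq (r^2) (r^2) * Pq (r^2) (r^2) * Pq (r^2) (r^2))) := by
      refine ((Pq_cont q0 q1 _ ?_).mul (Pq_cont q0 q1 _ ?_)).mul_const _
      · simpa using hw.mul_const (r^2)
      · have h9 := (tendsto_const_nhds (x := r^2)).div hw one_ne_zero
        rw [div_one] at h9
        exact h9
    set c : ℤ → ℝ := fun k => kc (r^2) b k - (if 0 ≤ k then 1 else 0) with hc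
    set M' := (|b|+1) * M with hM'
    have hcb1 : ∀ k, 0 ≤ k → |c k| ≤ M' * (r^2)^k := by
      intro k hk
      rw [hc]; simp only [if_pos hk]
      have e : kc (r^2) b k - 1 = b * (r^2)^k * kc (r^2) b k := by
        rw [kc]
        have : 1 - b * (r^2)^k ≠ 0 := fun h => hb k (by linarith)
        field_simp
        ring
      rw [e, abs_mul, abs_mul, abs_of_pos (zpow_pos q0 k)]
      have := hM1 k
      have h3 := zpow_pos q0 k
      calc |b| * (r^2)^k * |kc (r^2) b k| ≤ |b| * (r^2)^k * M := by gcongr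
        _ ≤ M' * (r^2)^k := by rw [hM']; nlinarith [mul_nonneg M0 h3.le]
    have hcb2 : ∀ k, k < 0 → |c k| ≤ M' * (r^2)^(-k) := by
      intro k hk
      rw [hc]; simp only [if_neg (not_le.2 hk), sub_zero]
      refine (hM2 k).trans ?_
      have h3 := zpow_pos q0 (-k)
      rw [hM']; nlinarith [mul_nonneg (mul_nonneg M0 h3.le) (abs_nonneg b)]
    have hM'0 : 0 ≤ M' := by positivity
    set bd : ℤ → ℝ := fun k => M' * r^(|k|) with hbd
    have bds : Summable bd := by
      apply Summable.mul_left
      apply Summable.of_nat_of_neg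
      · simpa using summable_geometric_of_lt_one h0.le h1
      · simpa using summable_geometric_of_lt_one h0.le h1
    have hbx : ∀ x, r < x → x < 1 → ∀ k, ‖c k * x^k‖ ≤ bd k := by
      intro x hx0 hx1 k
      have x0 : 0 < x := h0.trans hx0
      rw [norm_mul, Real.norm_eq_abs, Real.norm_eq_abs, abs_of_pos (zpow_pos x0 k)]
      rcases le_or_gt 0 k with hk | hk
      · rw [hbd]; simp only
        rw [abs_of_nonneg hk]
        obtain ⟨n, rfl⟩ := Int.eq_ofNat_of_zero_le hk
        have := hcb1 n hk
        rw [zpow_natCast] at this ⊢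
        rw [zpow_natCast]
        have h5 : (r^2)^n ≤ r^n := by gcongr
        have h6 : x^n ≤ 1 := pow_le_one₀ x0.le hx1.le
        calc |c n| * x^n ≤ M' * r^n * 1 := by
              gcongr
              exact this.trans (by gcongr)
          _ = _ := mul_one _
      · rw [hbd]; simp only
        rw [abs_of_neg hk]
        obtain ⟨n, hn⟩ := Int.eq_ofNat_of_zero_le (a := -k) (by omega)
        obtain rfl : k = -n := by omega
        have := hcb2 (-n) hk
        simp only [neg_neg, zpow_natCast] at this ⊢
        rw [zpow_neg, zpow_natCast]
        calc |c (-n)| * (x^n)⁻¹ ≤ M' * (r^2)^n * (r^n)⁻¹ := by gcongr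
          _ = M' * r^n := by field_simp; ring
    have hF : ∀ x, r < x → x < 1 → (1-x) * ∑' k : ℤ, kc (r^2) b k * x^k
        = 1 + (1-x) * ∑' k : ℤ, c k * x^k := by
      intro x hx0 hx1
      have x0 : 0 < x := h0.trans hx0
      have s1 : Summable fun k => c k * x^k := bds.of_norm_bounded (hbx x hx0 hx1)
      have s2 : HasSum (fun k : ℤ => (if 0 ≤ k then (1:ℝ) else 0) * x^k) (1-x)⁻¹ := by
        have g := hasSum_geometric_of_lt_one x0.le hx1
        have := (Function.Injective.hasSum_iff (f := fun k : ℤ => (if 0 ≤ k then (1:ℝ) else 0) * x^k)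
          (g := fun n : ℕ => (n:ℤ)) Nat.cast_injective (a := (1-x)⁻¹) (by
            intro k hk
            have : ¬ 0 ≤ k := by
              intro h
              exact hk ⟨k.toNat, by simp [h]⟩
            simp [this])).1
        apply this
        refine g.cg (fun n => ?_) rfl
        simp
      have s3 := (s1.hasSum.add s2).cg (g := fun k : ℤ => kc (r^2) b k * x^k)
        (fun k => by rw [hc]; simp only; ring) rfl
      rw [s3.tsum_eq]
      have : 1 - x ≠ 0 := by linarith
      field_simp
      ring
    have L3 : Tendsto (fun x : ℝ => (1-x) * ∑' k : ℤ, kc (r^2) b k * x^k) (𝓝[<] 1) (𝓝 1) := by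
      have L4 : Tendsto (fun x : ℝ => (1-x) * ∑' k : ℤ, c k * x^k) (𝓝[<] 1) (𝓝 0) := by
        have b0 : Tendsto (fun x : ℝ => (1-x) * ∑' k, bd k) (𝓝[<] 1) (𝓝 0) := by
          have := (hw.const_sub 1).mul_const (∑' k, bd k)
          simpa using this
        apply squeeze_zero_norm' _ b0
        filter_upwards [hev] with x hx
        rw [norm_mul, Real.norm_eq_abs, abs_of_pos (by linarith)]
        have : 0 ≤ 1 - x := by linarith
        gcongr
        exact tsum_of_norm_bounded bds.hasSum (hbx x hx.1 hx.2)
      have := L4.const_add 1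
      rw [add_zero] at this
      refine this.congr' ?_
      filter_upwards [hev] with x hx
      rw [hF x hx.1 hx.2]
    have L5 := L2.mul L3
    have := tendsto_nhds_unique (L5.congr' (f₂ := fun x : ℝ => C * th r (b*x)) ?_) L1
    · rw [← this]; ring
    · filter_upwards [hev] with x hx
      have x0 : 0 < x := h0.trans hx.1
      have := kron_aux h0 h1 hb0 hb hM1 hM2 (hrr.trans hx.1) hx.2
      rw [← hC] at this
      rw [← this, jtp h0 h1 x0.ne', Pq_succ q0 q1 x]
      ring
  have := kron_aux h0 h1 hb0 hb hM1 hM2 hx0 hx1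
  rw [← hC] at this
  rw [mul_assoc, this, ← key]; ring


lemma tsum_mod (m : ℕ) [NeZero m] {f : ℤ → ℝ} (hf : Summable f) :
    (∀ c : ℤ, Summable fun j : ℤ => f (m * j + c)) ∧
    ∑' n, f n = ∑ i : Fin m, ∑' j : ℤ, f (m * j + (i:ℕ)) := by
  have hm : (m:ℤ) ≠ 0 := by exact_mod_cast NeZero.ne m
  refine ⟨fun c => hf.comp_injective (i := fun j : ℤ => m * j + c) ?_, ?_⟩
  · intro a b hab
    have : (m:ℤ) * a = m * b := by simpa using hab
    exact mul_left_cancel₀ hm this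
  · rw [← (Int.divModEquiv m).symm.tsum_eq f]
    have hs : Summable fun p : ℤ × Fin m => f ((Int.divModEquiv m).symm p) :=
      (Int.divModEquiv m).symm.summable_iff.2 hf
    have hs' : Summable fun p : Fin m × ℤ => f ((Int.divModEquiv m).symm (p.2, p.1)) :=
      (Equiv.prodComm _ _).summable_iff.2 hs
    rw [← (Equiv.prodComm (Fin m) ℤ).tsum_eq]
    change ∑' p : Fin m × ℤ, f ((Int.divModEquiv m).symm (p.2, p.1)) = _
    rw [hs'.tsum_prod, tsum_fintype]
    congr 1; ext i; congr 1; ext j; congr 1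
    simp [Int.divModEquiv]; ring

/-- Laurent coefficients of `th r (z s) * th r (z / s)` -/
noncomputable def Vc (r s : ℝ) (k : ℤ) : ℝ := ∑' i : ℤ, thc r i * thc r (k-i) * s^(2*i-k)

lemma Vc_hasSum {r : ℝ} (h0 : 0 < r) (h1 : r < 1) {s z : ℝ} (hs : s ≠ 0) (hz : z ≠ 0) :
    (∀ k, Summable fun i => thc r i * thc r (k-i) * s^(2*i-k)) ∧
    HasSum (fun k => Vc r s k * z^k) (th r (z*s) * th r (z/s)) := by
  have a1 := th_hasSum h0 h1 (mul_ne_zero hz hs)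
  have a2 := th_hasSum h0 h1 (div_ne_zero hz hs)
  have b1 : HasSum (fun n => (thc r n * s^n) * z^n) (th r (z*s)) :=
    a1.cg (fun n => by rw [mul_zpow]; ring) rfl
  have b2 : HasSum (fun n => (thc r n * s^(-n)) * z^n) (th r (z/s)) :=
    a2.cg (fun n => by rw [div_zpow, zpow_neg]; field_simp) rfl
  obtain ⟨c1, c2⟩ := convz hz b1 b2
  have e : ∀ k j : ℤ, thc r j * s^j * (thc r (k-j) * s^(-(k-j))) =
      thc r j * thc r (k-j) * s^(2*j-k) := by
    intro k j
    rw [show 2*j-k = j + -(k-j) by ring, zpow_add₀ hs]; ring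
  simp only [e] at c1 c2
  exact ⟨c1, c2⟩

lemma Vc_rec {r : ℝ} (h0 : 0 < r) (s : ℝ) (k : ℤ) :
    Vc r s (k+2) = (r^2)^k * Vc r s k := by
  have q0 : 0 < r^2 := by positivity
  rw [Vc, Vc, ← tsum_shift _ 1, ← tsum_mul_left]
  congr 1; ext i
  have e1 : k + 2 - (i+1) = (k - i) + 1 := by ring
  have e2 : 2*(i+1) - (k+2) = 2*i-k := by ring
  rw [e1, e2, thc_succ h0.ne', thc_succ h0.ne', zpow_sub₀ q0.ne']
  have hu : (r^2)^i ≠ 0 := (zpow_pos q0 i).ne'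
  field_simp

lemma Vc_symm (r s : ℝ) (k : ℤ) : Vc r s (2-k) = Vc r s⁻¹ k := by
  rw [Vc, Vc, ← (Equiv.subLeft (1:ℤ)).tsum_eq]
  congr 1; ext i
  simp only [Equiv.subLeft_apply]
  have e1 : 2 - k - (1 - i) = 1 - (k - i) := by ring
  rw [e1, thc_neg, thc_neg, inv_zpow', show 2*(1-i)-(2-k) = -(2*i-k) by ring]; ring

lemma Vc_even {r : ℝ} (h0 : 0 < r) (s : ℝ) (J : ℤ) : Vc r s (2*J) = r^(2*(J*J-J)) * Vc r s 0 := by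
  have q0 : 0 < r^2 := by positivity
  induction J with
  | zero => simp
  | succ n ih =>
    rw [show 2*((n:ℤ)+1) = 2*n+2 by ring, Vc_rec h0, ih, ← zpow_natCast, ← zpow_mul, ← mul_assoc,
      ← zpow_add₀ h0.ne']
    congr 2; push_cast; ring
  | pred n ih =>
    have := Vc_rec h0 s (2*(-n-1))
    rw [show 2*(-(n:ℤ)-1)+2 = 2*(-n) by ring, ih] at this
    apply mul_left_cancel₀ (zpow_pos q0 (2*(-(n:ℤ)-1))).ne'
    rw [← this, ← zpow_natCast, ← zpow_mul, ← mul_assoc, ← zpow_add₀ h0.ne']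
    congr 2; push_cast; ring

lemma Vc_odd {r : ℝ} (h0 : 0 < r) (s : ℝ) (J : ℤ) : Vc r s (2*J+1) = r^(2*(J*J)) * Vc r s 1 := by
  have q0 : 0 < r^2 := by positivity
  induction J with
  | zero => simp
  | succ n ih =>
    rw [show 2*((n:ℤ)+1)+1 = 2*n+1+2 by ring, Vc_rec h0, ih, ← zpow_natCast, ← zpow_mul, ← mul_assoc,
      ← zpow_add₀ h0.ne']
    congr 2; push_cast; ring
  | pred n ih =>
    have := Vc_rec h0 s (2*(-n-1)+1)
    rw [show 2*(-(n:ℤ)-1)+1+2 = 2*(-n)+1 by ring, ih] at this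
    apply mul_left_cancel₀ (zpow_pos q0 (2*(-(n:ℤ)-1)+1)).ne'
    rw [← this, ← zpow_natCast, ← zpow_mul, ← mul_assoc (r^_), ← zpow_add₀ h0.ne']
    congr 2; push_cast; ring

lemma Vc0_eq {r : ℝ} (h0 : 0 < r) (s : ℝ) : Vc r s 0 = ∑' j : ℤ, r^(2*(j*j)) * s^(2*j) := by
  rw [Vc]; congr 1; ext i
  rw [thc, thc, show 2*i-0 = 2*i by ring, show 0 - i = -i by ring]
  have : ((-1:ℝ))^i * (-1)^(-i) = 1 := by rw [← zpow_add₀ (by norm_num)]; simp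
  have e : r^(2*(i*i)) = r^(i*i-i) * r^(-i*-i - -i) := by
    rw [← zpow_add₀ h0.ne']; congr 1; ring
  rw [e]; linear_combination r^(i*i-i) * r^(-i*-i - -i) * s^(2*i) * this

lemma Vc1_eq {r : ℝ} (h0 : 0 < r) (s : ℝ) :
    Vc r s 1 = -∑' j : ℤ, r^(2*(j*j-j)) * s^(2*j-1) := by
  rw [Vc, ← tsum_neg]; congr 1; ext i
  rw [thc_neg, thc]
  have : ((-1:ℝ))^i * (-1)^i = 1 := by rw [← mul_zpow]; simp
  have e : r^(2*(i*i-i)) = r^(i*i-i) * r^(i*i-i) := by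
    rw [← zpow_add₀ h0.ne']; congr 1; ring
  rw [e]; linear_combination -r^(i*i-i) * r^(i*i-i) * s^(2*i-1) * this

lemma th_prod {r : ℝ} (h0 : 0 < r) (h1 : r < 1) {s z : ℝ} (hs : s ≠ 0) (hz : z ≠ 0) :
    th r (z*s) * th r (z/s) = z * (Vc r s 1 * Vc r z 0 - Vc r s 0 * Vc r z 1) := by
  have h := (Vc_hasSum h0 h1 hs hz).2
  have h2 := (tsum_mod 2 h.summable).2
  rw [h.tsum_eq, Fin.sum_univ_two] at h2
  rw [h2, Vc0_eq h0 z, Vc1_eq h0 z, mul_sub, mul_neg, mul_neg, sub_neg_eq_add,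
    ← tsum_mul_left, ← tsum_mul_left, ← tsum_mul_left, ← tsum_mul_left, add_comm]
  congr 1
  · congr 1; ext j
    simp only [Nat.cast_ofNat, Fin.val_one, Nat.cast_one]
    rw [Vc_odd h0, zpow_add_one₀ hz]; ring
  · congr 1; ext j
    simp only [Nat.cast_ofNat, Fin.val_zero, Nat.cast_zero, add_zero]
    rw [Vc_even h0, zpow_sub_one₀ hz]; field_simp

lemma plucker {r : ℝ} (h0 : 0 < r) (h1 : r < 1) {x y z w : ℝ} (hx : x ≠ 0) (hy : y ≠ 0)
    (hz : z ≠ 0) (hw : w ≠ 0) :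
    y * (th r (x*y) * th r (x/y)) * (th r (z*w) * th r (z/w))
    - z * (th r (x*z) * th r (x/z)) * (th r (y*w) * th r (y/w))
    + z * (th r (x*w) * th r (x/w)) * (th r (y*z) * th r (y/z)) = 0 := by
  rw [th_prod h0 h1 hy hx, th_prod h0 h1 hw hz, th_prod h0 h1 hz hx, th_prod h0 h1 hw hy,
    th_prod h0 h1 hw hx, th_prod h0 h1 hz hy]
  ring

lemma th_inv_symm {r : ℝ} (h0 : 0 < r) (h1 : r < 1) {z : ℝ} (hz : z ≠ 0) :
    th r (r^2/z) = th r z := by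
  have q0 : 0 < r^2 := by positivity
  rw [jtp h0 h1 hz, jtp h0 h1 (div_ne_zero q0.ne' hz)]
  have : r^2/(r^2/z) = z := by field_simp
  rw [this]; ring

lemma th_inv {r : ℝ} (h0 : 0 < r) (h1 : r < 1) {z : ℝ} (hz : z ≠ 0) :
    th r z⁻¹ = - z⁻¹ * th r z := by
  rw [th, th, ← tsum_mul_left, ← (Equiv.subLeft (1:ℤ)).tsum_eq]
  congr 1; ext i
  simp only [Equiv.subLeft_apply]
  rw [thc_neg, inv_zpow', neg_sub, zpow_sub_one₀ hz]; ring

/-! ### the five thetas -/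

noncomputable def tt (Q : ℝ) (k : ℕ) : ℝ := th (Q^5) (Q^k)

lemma Q5_lt {Q : ℝ} (h0 : 0 < Q) (h1 : Q < 1) : Q^5 < 1 := pow_lt_one₀ h0.le h1 (by norm_num)

lemma tt_symm {Q : ℝ} (h0 : 0 < Q) (h1 : Q < 1) (k l : ℕ) (h : k + l = 10) : tt Q k = tt Q l := by
  unfold tt
  rw [← th_inv_symm (pow_pos h0 5) (Q5_lt h0 h1) (pow_pos h0 k).ne']
  congr 1
  rw [div_eq_iff (pow_pos h0 k).ne', ← pow_add, ← pow_mul]; congr 1; omega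

lemma tt_zero {Q : ℝ} (h0 : 0 < Q) (h1 : Q < 1) : tt Q 0 = 0 := by
  unfold tt; rw [pow_zero]; exact th_one (pow_pos h0 5) (Q5_lt h0 h1)

/-- Plücker at powers of Q -/
lemma tt_plucker {Q : ℝ} (h0 : 0 < Q) (h1 : Q < 1) (i j k l : ℕ) (hij : j ≤ i) (hjk : k ≤ j) (hkl : l ≤ k) :
    Q^j * (tt Q (i+j) * tt Q (i-j)) * (tt Q (k+l) * tt Q (k-l))
    - Q^k * (tt Q (i+k) * tt Q (i-k)) * (tt Q (j+l) * tt Q (j-l))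
    + Q^k * (tt Q (i+l) * tt Q (i-l)) * (tt Q (j+k) * tt Q (j-k)) = 0 := by
  have := plucker (pow_pos h0 5) (Q5_lt h0 h1) (pow_pos h0 i).ne' (pow_pos h0 j).ne'
    (pow_pos h0 k).ne' (pow_pos h0 l).ne'
  have d : ∀ a b : ℕ, b ≤ a → Q^a/Q^b = Q^(a-b) := fun a b hab => by
    rw [pow_sub₀ _ h0.ne' hab]; rfl
  rw [d i j hij, d k l hkl, d i k (hjk.trans hij), d j l (hkl.trans hjk),
    d i l (hkl.trans (hjk.trans hij)), d j k hjk] at this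
  simp only [← pow_add] at this
  exact this

lemma tt_r1 {Q : ℝ} (h0 : 0 < Q) (h1 : Q < 1) : Q * tt Q 1^3 * tt Q 5 - tt Q 2^3 * tt Q 4 + tt Q 1 * tt Q 3^3 = 0 := by
  have := tt_plucker h0 h1 3 2 1 0 (by norm_num) (by norm_num) (by norm_num)
  norm_num at this
  apply mul_left_cancel₀ h0.ne'
  linear_combination this

lemma tt_r2 {Q : ℝ} (h0 : 0 < Q) (h1 : Q < 1) : Q * tt Q 1^2 * tt Q 2 * tt Q 4 - tt Q 2^2 * tt Q 3 * tt Q 5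
    + tt Q 1 * tt Q 3 * tt Q 4^2 = 0 := by
  have := tt_plucker h0 h1 4 2 1 0 (by norm_num) (by norm_num) (by norm_num)
  norm_num at this
  rw [tt_symm h0 h1 6 4 (by norm_num)] at this
  apply mul_left_cancel₀ h0.ne'
  linear_combination this

lemma tt_r3 {Q : ℝ} (h0 : 0 < Q) (h1 : Q < 1) : Q * tt Q 1^2 * tt Q 3^2 - tt Q 2^2 * tt Q 4^2
    + tt Q 1 * tt Q 3 * tt Q 5^2 = 0 := by
  have := tt_plucker h0 h1 5 2 1 0 (by norm_num) (by norm_num) (by norm_num)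
  norm_num at this
  rw [tt_symm h0 h1 6 4 (by norm_num), tt_symm h0 h1 7 3 (by norm_num)] at this
  apply mul_left_cancel₀ h0.ne'
  linear_combination this

lemma tt_WA {Q : ℝ} (h0 : 0 < Q) (h1 : Q < 1) : Q * tt Q 1 * tt Q 2^2 * tt Q 3 - tt Q 2 * tt Q 3^2 * tt Q 4
    + tt Q 1 * tt Q 4^2 * tt Q 5 = 0 := by
  have := tt_plucker h0 h1 4 3 2 0 (by norm_num) (by norm_num) (by norm_num)
  norm_num at this
  rw [tt_symm h0 h1 6 4 (by norm_num), tt_symm h0 h1 7 3 (by norm_num)] at this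
  apply mul_left_cancel₀ (pow_pos h0 2).ne'
  linear_combination this



lemma kcm_pos {q : ℝ} (q0 : 0 < q) (k : ℤ) : 0 < kc q (-1) k := by
  have := zpow_pos q0 k
  unfold kc; apply inv_pos.2; linarith

lemma kcm_b1 {q : ℝ} (q0 : 0 < q) (k : ℤ) : |kc q (-1) k| ≤ 1 := by
  rw [abs_of_pos (kcm_pos q0 k)]
  have := zpow_pos q0 k
  unfold kc; apply inv_le_one_of_one_le₀; linarith

lemma kcm_b2 {q : ℝ} (q0 : 0 < q) (k : ℤ) : |kc q (-1) k| ≤ 1 * q^(-k) := by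
  rw [abs_of_pos (kcm_pos q0 k), one_mul, zpow_neg]
  have := zpow_pos q0 k
  unfold kc; apply inv_anti₀ this; linarith

noncomputable def KK (q z : ℝ) : ℝ := ∑' k : ℤ, kc q (-1) k * z^k

lemma KK_hasSum {q z : ℝ} (q0 : 0 < q) (h0 : q < z) (h1 : z < 1) :
    HasSum (fun k => kc q (-1) k * z^k) (KK q z) :=
  (bisum_bound q0 h0 h1 (fun k _ => kcm_b1 q0 k) (fun k _ => kcm_b2 q0 k)).hasSum

lemma kc1_zero (q : ℝ) : kc q 1 0 = 0 := by simp [kc]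

lemma kc1_neg {q : ℝ} (q0 : 0 < q) (q1 : q < 1) (k : ℤ) : kc q 1 (-k) = - q^k * kc q 1 k := by
  rcases eq_or_ne k 0 with rfl | hk
  · simp [kc]
  unfold kc
  have h1 : q^k ≠ 1 := by
    intro h
    exact hk ((zpow_eq_one_iff_right₀ q0.le q1.ne).1 h)
  have h2 := (zpow_pos q0 k).ne'
  have h3 : 1 - q^k ≠ 0 := fun h => h1 (by linarith)
  have h4 : q^k - 1 ≠ 0 := fun h => h1 (by linarith)
  rw [zpow_neg, one_mul, one_mul]
  have : 1 - (q^k)⁻¹ = (q^k - 1) / q^k := by field_simp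
  rw [this, inv_div]
  field_simp
  ring

lemma kc1_b1 {q : ℝ} (q0 : 0 < q) (q1 : q < 1) (k : ℤ) (hk : 0 ≤ k) : |kc q 1 k| ≤ (1-q)⁻¹ := by
  rcases hk.eq_or_lt with rfl | hk
  · rw [kc1_zero, abs_zero]; apply inv_nonneg.2; linarith
  obtain ⟨n, rfl⟩ : ∃ n : ℕ, k = (n+1 : ℕ) := ⟨(k-1).toNat, by omega⟩
  unfold kc
  rw [zpow_natCast, one_mul]
  have : q^(n+1) ≤ q := by
    rw [pow_succ]
    have := pow_le_one₀ q0.le q1.le (n := n)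
    nlinarith
  rw [abs_of_pos (inv_pos.2 (by linarith))]
  apply inv_anti₀ <;> linarith

lemma kc1_b2 {q : ℝ} (q0 : 0 < q) (q1 : q < 1) (k : ℤ) (hk : k ≤ 0) :
    |kc q 1 k| ≤ (1-q)⁻¹ * q^(-k) := by
  have h := kc1_neg q0 q1 (-k)
  rw [neg_neg] at h
  rw [h, abs_mul, abs_neg, abs_of_pos (zpow_pos q0 _), mul_comm]
  have := kc1_b1 q0 q1 (-k) (by omega)
  have := zpow_pos q0 (-k)
  gcongr

noncomputable def LL (q z : ℝ) : ℝ := ∑' k : ℤ, kc q 1 k * z^k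

lemma LL_hasSum {q z : ℝ} (q0 : 0 < q) (h0 : q < z) (h1 : z < 1) :
    HasSum (fun k => kc q 1 k * z^k) (LL q z) :=
  (bisum_bound q0 h0 h1 (fun k hk => kc1_b1 q0 (h0.trans h1) k hk)
    (fun k hk => kc1_b2 q0 (h0.trans h1) k hk)).hasSum

noncomputable def TT (Q : ℝ) : ℝ := Pq (Q^10) (Q^10)
noncomputable def hh (Q : ℝ) : ℝ := Pq (Q^5) (Q^10)

lemma pw_lt {Q : ℝ} (h0 : 0 < Q) (h1 : Q < 1) {n : ℕ} (hn : n ≠ 0) : Q^n < 1 :=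
  pow_lt_one₀ h0.le h1 hn

lemma TT_pos {Q : ℝ} (h0 : 0 < Q) (h1 : Q < 1) : 0 < TT Q :=
  Pq_pos (pow_pos h0 10) (pw_lt h0 h1 (by norm_num)) (pw_lt h0 h1 (by norm_num))

lemma hh_pos {Q : ℝ} (h0 : 0 < Q) (h1 : Q < 1) : 0 < hh Q :=
  Pq_pos (pow_pos h0 10) (pw_lt h0 h1 (by norm_num)) (pw_lt h0 h1 (by norm_num))

lemma tt_prod {Q : ℝ} (h0 : 0 < Q) (h1 : Q < 1) (k : ℕ) (hk : k ≤ 10) :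
    tt Q k = Pq (Q^k) (Q^10) * Pq (Q^(10-k)) (Q^10) * TT Q := by
  unfold tt TT
  rw [jtp (pow_pos h0 5) (Q5_lt h0 h1) (pow_pos h0 k).ne', ← pow_mul]
  congr 3
  rw [pow_sub₀ _ h0.ne' hk]; rfl

lemma tt_pos {Q : ℝ} (h0 : 0 < Q) (h1 : Q < 1) (k : ℕ) (hk : k ≠ 0) (hk' : k < 10) :
    0 < tt Q k := by
  rw [tt_prod h0 h1 k hk'.le]
  have q0 := pow_pos h0 10
  have q1 := pw_lt h0 h1 (n := 10) (by norm_num)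
  exact mul_pos (mul_pos (Pq_pos q0 q1 (pw_lt h0 h1 hk)) (Pq_pos q0 q1 (pw_lt h0 h1 (by omega))))
    (TT_pos h0 h1)

lemma tt5_eq {Q : ℝ} (h0 : 0 < Q) (h1 : Q < 1) : tt Q 5 = hh Q^2 * TT Q := by
  rw [tt_prod h0 h1 5 (by norm_num)]; unfold hh; ring

lemma Pqq {Q : ℝ} (h0 : 0 < Q) (h1 : Q < 1) : Pq (Q^5) (Q^5) = hh Q * TT Q := by
  rw [Pq_split (pow_pos h0 5) (Q5_lt h0 h1)]; unfold hh TT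
  rw [← pow_mul, ← pow_add]

lemma Pq_mq {Q : ℝ} (h0 : 0 < Q) (h1 : Q < 1) : hh Q * Pq (-Q^5) (Q^5) = 1 := by
  have := Pq_neg_mul (pow_pos h0 5) (Q5_lt h0 h1) (Q^5)
  rw [Pqq h0 h1, ← pow_mul] at this
  change _ = TT Q at this
  have hT := (TT_pos h0 h1).ne'
  apply mul_left_cancel₀ hT
  linear_combination this

lemma KK_val {Q : ℝ} (h0 : 0 < Q) (h1 : Q < 1) (j : ℕ) (hj : 0 < j) (hj5 : j < 5) :
    th (√(Q^5)) (Q^j) * TT Q = tt Q j * tt Q (5-j) * hh Q ∧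
    2 * (tt Q j * tt Q (5-j))^2 * KK (Q^5) (Q^j) = tt Q (2*j) * tt Q 5^2 * TT Q^3 := by
  have q0 := pow_pos h0 5
  have q1 := Q5_lt h0 h1
  set r := √(Q^5) with hr
  have r2 : r^2 = Q^5 := Real.sq_sqrt q0.le
  have r0 : 0 < r := Real.sqrt_pos.2 q0
  have r1 : r < 1 := by nlinarith
  have hz := pow_pos h0 j
  have e10 : (Q^5)^2 = Q^10 := by ring
  have ediv : Q^5/Q^j = Q^(5-j) := by rw [pow_sub₀ _ h0.ne' hj5.le]; rfl
  have X1 : th r (Q^j) = Pq (Q^j) (Q^5) * Pq (Q^(5-j)) (Q^5) * (hh Q * TT Q) := by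
    rw [jtp r0 r1 hz.ne', r2, Pqq h0 h1, ediv]
  have X2 : th r (-Q^j) = Pq (-Q^j) (Q^5) * Pq (-Q^(5-j)) (Q^5) * (hh Q * TT Q) := by
    rw [jtp r0 r1 (neg_ne_zero.2 hz.ne'), r2, Pqq h0 h1, div_neg, ediv]
  have Y1 : th r (Q^j) * TT Q = tt Q j * tt Q (5-j) * hh Q := by
    rw [X1, tt_prod h0 h1 j (by omega), tt_prod h0 h1 (5-j) (by omega), Pq_split q0 q1 (Q^j),
      Pq_split q0 q1 (Q^(5-j)), e10, ← pow_add, ← pow_add,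
      show 10-(5-j) = j+5 by omega, show 5-j+5 = 10-j by omega]
    ring
  have Y2 : th r (Q^j) * th r (-Q^j) = tt Q (2*j) * hh Q^2 * TT Q := by
    rw [X1, X2, tt_prod h0 h1 (2*j) (by omega)]
    have a1 := Pq_neg_mul q0 q1 (Q^j)
    have a2 := Pq_neg_mul q0 q1 (Q^(5-j))
    rw [e10, ← pow_mul] at a1 a2
    rw [show j*2 = 2*j by ring] at a1
    rw [show (5-j)*2 = 10-2*j by omega] at a2
    rw [← a1, ← a2]; ring
  have Y3 : th r (-1) = 2 * Pq (-Q^5) (Q^5)^2 * (hh Q * TT Q) := by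
    rw [jtp r0 r1 (by norm_num), r2, Pqq h0 h1, Pq_succ q0 q1 (-1), div_neg, div_one]
    ring_nf
  have kr := kron r0 r1 (b := -1) (by norm_num) (M := 1)
    (by intro k; have := zpow_pos (pow_pos r0 2) k; linarith)
    (fun k => kcm_b1 (pow_pos r0 2) k) (fun k => kcm_b2 (pow_pos r0 2) k) (x := Q^j)
    (by rw [r2]; exact pow_lt_pow_right_of_lt_one₀ h0 h1 hj5) (pw_lt h0 h1 hj.ne')
  rw [r2, Pqq h0 h1, neg_one_mul, Y3] at kr
  change _ * KK (Q^5) (Q^j) = _ at kr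
  refine ⟨Y1, ?_⟩
  have hm := Pq_mq h0 h1
  have hT := (TT_pos h0 h1).ne'
  have hhn := (hh_pos h0 h1).ne'
  generalize Pq (-Q^5) (Q^5) = m at *
  rw [tt5_eq h0 h1]
  have Z : 2 * th r (Q^j) * KK (Q^5) (Q^j) = hh Q^4 * TT Q^2 * th r (-Q^j) := by
    apply mul_left_cancel₀ (mul_ne_zero hhn hT)
    linear_combination hh Q^2 * kr - 2 * hh Q * TT Q * th r (Q^j) * KK (Q^5) (Q^j) * (hh Q * m + 1) * hm
  apply mul_left_cancel₀ (pow_ne_zero 2 hhn)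
  have : (hh Q)^2 * (2 * (tt Q j * tt Q (5-j))^2 * KK (Q^5) (Q^j)) =
      TT Q^2 * th r (Q^j) * (2 * th r (Q^j) * KK (Q^5) (Q^j)) := by
    linear_combination (-2 * KK (Q^5) (Q^j)) * (tt Q j * tt Q (5-j) * hh Q + th r (Q^j) * TT Q) * Y1
  rw [this, Z]
  linear_combination hh Q^4 * TT Q^4 * Y2

lemma Omega {Q : ℝ} (h0 : 0 < Q) (h1 : Q < 1) :
    tt Q 5 * tt Q 4 * ∑' k : ℤ, kc (Q^10) (Q^5) k * (Q^4)^k = TT Q^3 * tt Q 1 ∧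
    Summable (fun k : ℤ => kc (Q^10) (Q^5) k * (Q^4)^k) := by
  have q0 := pow_pos h0 5
  have q1 := Q5_lt h0 h1
  have e : (Q^5)^2 = Q^10 := by ring
  have hk : ∀ k : ℤ, kc ((Q^5)^2) (Q^5) k = kc (Q^5) 1 (2*k+1) := by
    intro k
    unfold kc
    rw [zpow_add_one₀ q0.ne', zpow_mul, one_mul, mul_comm]; norm_cast
  have b1 : ∀ k, |kc ((Q^5)^2) (Q^5) k| ≤ (1-Q^5)⁻¹ * (Q^5)⁻¹ := by
    intro k
    rw [hk]
    have hp : 0 < (1-Q^5)⁻¹ := inv_pos.2 (by linarith)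
    have hq : 1 ≤ (Q^5)⁻¹ := (one_le_inv₀ q0).2 q1.le
    rcases le_or_gt 0 (2*k+1) with h | h
    · refine (kc1_b1 q0 q1 _ h).trans ?_
      nlinarith
    · refine (kc1_b2 q0 q1 _ h.le).trans ?_
      gcongr
      refine le_trans ?_ hq
      exact zpow_le_one₀ q0 q1.le (by omega)
  have b2 : ∀ k, |kc ((Q^5)^2) (Q^5) k| ≤ (1-Q^5)⁻¹ * (Q^5)⁻¹ * ((Q^5)^2)^(-k) := by
    intro k
    have hp : 0 < (1-Q^5)⁻¹ := inv_pos.2 (by linarith)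
    have h5 : (Q^5)⁻¹ * ((Q^5)^2)^(-k) = (Q^5)^(-(2*k+1)) := by
      rw [← zpow_neg_one, ← zpow_natCast (Q^5) 2, ← zpow_mul, ← zpow_add₀ q0.ne']
      congr 1; push_cast; ring
    rw [mul_assoc, h5, hk]
    rcases le_or_gt 0 (2*k+1) with h | h
    · refine (kc1_b1 q0 q1 _ h).trans ?_
      have : 1 ≤ (Q^5)^(-(2*k+1)) := by
        rw [zpow_neg]
        exact (one_le_inv₀ (zpow_pos q0 _)).2 (zpow_le_one₀ q0 q1.le h)
      nlinarith
    · exact kc1_b2 q0 q1 _ h.le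
  have hlt : (Q^5)^2 < Q^4 := by
    rw [e]; exact pow_lt_pow_right_of_lt_one₀ h0 h1 (by norm_num)
  have hne : ∀ k : ℤ, Q^5 * ((Q^5)^2)^k ≠ 1 := by
    intro k h
    have h2 : (Q^5)^(2*k+1) = 1 := by
      rw [zpow_add_one₀ q0.ne', zpow_mul, ← h, mul_comm]; norm_cast
    have := (zpow_eq_one_iff_right₀ q0.le q1.ne).1 h2
    omega
  have kr := kron q0 q1 (b := Q^5) q0.ne' hne b1 b2 hlt (pw_lt h0 h1 (by norm_num))
  have sm := bisum_bound (pow_pos q0 2) hlt (pw_lt h0 h1 (by norm_num)) (fun k _ => b1 k) (fun k _ => b2 k)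
  rw [e] at kr sm
  rw [← pow_add] at kr
  refine ⟨?_, sm⟩
  rw [← tt_symm h0 h1 9 1 (by norm_num)]
  exact kr

lemma kc_dbl {q : ℝ} (q0 : 0 < q) (q1 : q < 1) (k : ℤ) (hk : k ≠ 0) :
    kc q (-1) k - kc q 1 k = - 2 * (q^k * kc (q^2) 1 k) := by
  have h1 : q^k ≠ 1 := by
    intro h
    exact hk ((zpow_eq_one_iff_right₀ q0.le q1.ne).1 h)
  have h2 := zpow_pos q0 k
  unfold kc
  have : (q^2)^k = q^k * q^k := by rw [← mul_zpow]; ring_nf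
  rw [this]
  have h3 : 1 - q^k ≠ 0 := fun h => h1 (by linarith)
  have h4 : 1 + q^k ≠ 0 := by linarith
  have h5 : 1 - q^k*q^k ≠ 0 := by
    have : 1 - q^k*q^k = (1-q^k)*(1+q^k) := by ring
    rw [this]; exact mul_ne_zero h3 h4
  have e1 : 1 - -1 * q^k = 1 + q^k := by ring
  rw [e1, one_mul, one_mul]
  generalize q^k = x at *
  rw [show 1 - x*x = (1-x)*(1+x) by ring, mul_inv]
  field_simp
  ring

theorem lambert {Q : ℝ} (h0 : 0 < Q) (h1 : Q < 1) :
    (2 * KK (Q^5) Q - 1 - 2 * LL (Q^5) Q - 4 * LL (Q^5) (Q^2)) * (tt Q 4 * tt Q 5)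
      = - 4 * Q^2 * tt Q 1 * TT Q^3 := by
  have q0 := pow_pos h0 5
  have q1 := Q5_lt h0 h1
  have w0 := pow_pos h0 10
  have e10 : (Q^5)^2 = Q^10 := by ring
  obtain ⟨O1, O2⟩ := Omega h0 h1
  set Om := ∑' k : ℤ, kc (Q^10) (Q^5) k * (Q^4)^k with hOm
  have lt : ∀ a b : ℕ, a < b → Q^b < Q^a := fun a b h => pow_lt_pow_right_of_lt_one₀ h0 h1 h
  have lt1 : Q^5 < Q := by simpa using lt 1 5 (by norm_num)
  have s6 := LL_hasSum w0 (lt 6 10 (by norm_num)) (pw_lt h0 h1 (n := 6) (by norm_num))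
  have s4 := LL_hasSum w0 (lt 4 10 (by norm_num)) (pw_lt h0 h1 (n := 4) (by norm_num))
  have R : LL (Q^10) (Q^6) = - LL (Q^10) (Q^4) := by
    have := hasSum_refl 0 s4
    refine s6.unique (this.neg.cg (fun k => ?_) rfl)
    rw [zero_sub, kc1_neg w0 (pw_lt h0 h1 (by norm_num)), zpow_neg]
    have : (Q^10)^k = (Q^6)^k * (Q^4)^k := by rw [← mul_zpow]; ring_nf
    rw [this]
    have := (zpow_pos (pow_pos h0 4) k).ne'
    field_simp
  have A : 2 * KK (Q^5) Q - 1 - 2 * LL (Q^5) Q = -4 * LL (Q^10) (Q^6) := by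
    have a1 := KK_hasSum q0 lt1 h1
    have a2 := LL_hasSum q0 lt1 h1
    have a3 := ((a1.sub a2).sub (hasSum_ite_eq (0:ℤ) (1/2:ℝ)))
    have a4 := a3.unique ((s6.mul_left (-2)).cg (fun k => ?_) rfl)
    · linarith
    · split_ifs with hk
      · subst hk; simp [kc]; norm_num
      · rw [← sub_mul, kc_dbl q0 q1 k hk, e10]
        have : (Q^6)^k = (Q^5)^k * Q^k := by rw [← mul_zpow]; ring_nf
        rw [this]; ring
  have B : LL (Q^5) (Q^2) = LL (Q^10) (Q^4) + Q^2 * Om := by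
    have a1 := LL_hasSum q0 (lt 2 5 (by norm_num)) (pw_lt h0 h1 (n := 2) (by norm_num))
    have a2 := (tsum_mod 2 a1.summable).2
    rw [a1.tsum_eq, Fin.sum_univ_two] at a2
    rw [a2]
    congr 1
    · unfold LL
      congr 1; ext j
      simp only [Nat.cast_ofNat, Fin.val_zero, Nat.cast_zero, add_zero]
      unfold kc
      rw [zpow_mul, zpow_mul, ← e10]
      norm_cast
      ring_nf
    · rw [hOm, ← tsum_mul_left]
      congr 1; ext j
      simp only [Nat.cast_ofNat, Fin.val_one, Nat.cast_one]
      unfold kc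
      rw [zpow_add_one₀ q0.ne', zpow_add_one₀ (pow_pos h0 2).ne', zpow_mul, zpow_mul, ← e10]
      norm_cast
      ring_nf
  rw [A, B, R]
  linear_combination -4 * Q^2 * O1


noncomputable def sg (n k : ℤ) : ℝ := (if 0 ≤ n then 1 else 0) - (if k < 0 then 1 else 0)

lemma geoZ {y ρ : ℝ} (y0 : 0 < y) (r1 : ρ < 1) (n : ℤ)
    (h1 : 0 ≤ n → y ≤ ρ) (h2 : n < 0 → y⁻¹ ≤ ρ) :
    HasSum (fun k : ℤ => sg n k * y^k) (1 - y)⁻¹ := by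
  rcases lt_or_ge n 0 with hn | hn
  · have hy : y⁻¹ < 1 := (h2 hn).trans_lt r1
    have a : HasSum (fun k : ℕ => sg n (k:ℤ) * y^(k:ℤ)) 0 := by
      refine hasSum_zero.cg (fun k => ?_) rfl
      simp [sg, not_le.2 hn]
    have b : HasSum (fun k : ℕ => sg n (-((k:ℤ)+1)) * y^(-((k:ℤ)+1))) (-y⁻¹ * (1-y⁻¹)⁻¹) := by
      refine ((hasSum_geometric_of_lt_one (inv_pos.2 y0).le hy).mul_left (-y⁻¹)).cg (fun k => ?_) rfl
      have : -((k:ℤ)+1) < 0 := by omega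
      have e : y^(-((k:ℤ)+1)) = y⁻¹ * y⁻¹^k := by
        rw [zpow_neg, zpow_add_one₀ y0.ne', zpow_natCast, mul_inv, inv_pow, mul_comm]
      rw [e, sg, if_neg (not_le.2 hn), if_pos this]; ring
    refine (HasSum.of_nat_of_neg_add_one (f := fun k : ℤ => sg n k * y^k) a b).cg (fun k => rfl) ?_
    have : 1 < y := (inv_lt_one₀ y0).1 hy
    have h3 : 1 - y ≠ 0 := by linarith
    have h4 : y - 1 ≠ 0 := by linarith
    rw [zero_add, show 1 - y⁻¹ = (y-1)*y⁻¹ by field_simp, mul_inv, inv_inv,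
      show 1 - y = -(y-1) by ring, inv_neg]
    field_simp
  · have hy : y < 1 := (h1 hn).trans_lt r1
    have a : HasSum (fun k : ℕ => sg n (k:ℤ) * y^(k:ℤ)) (1-y)⁻¹ := by
      refine (hasSum_geometric_of_lt_one y0.le hy).cg (fun k => ?_) rfl
      have : ¬ ((k:ℤ) < 0) := by omega
      rw [sg, if_pos hn, if_neg this, zpow_natCast]; ring
    have b : HasSum (fun k : ℕ => sg n (-((k:ℤ)+1)) * y^(-((k:ℤ)+1))) 0 := by
      refine hasSum_zero.cg (fun k => ?_) rfl
      have : -((k:ℤ)+1) < 0 := by omega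
      rw [sg, if_pos hn, if_pos this]; ring
    exact (HasSum.of_nat_of_neg_add_one (f := fun k : ℤ => sg n k * y^k) a b).cg (fun k => rfl) (by ring)

lemma absZ {ρ : ℝ} (r0 : 0 < ρ) (r1 : ρ < 1) : Summable fun k : ℤ => ρ^|k| := by
  apply Summable.of_nat_of_neg
  · simpa using summable_geometric_of_lt_one r0.le r1
  · simpa using summable_geometric_of_lt_one r0.le r1

lemma sg_bound {y ρ : ℝ} (y0 : 0 < y) (n k : ℤ)
    (h1 : 0 ≤ n → y ≤ ρ) (h2 : n < 0 → y⁻¹ ≤ ρ) : |sg n k * y^k| ≤ ρ^|k| := by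
  have hr : 0 < ρ := by
    rcases lt_or_ge n 0 with hn | hn
    · exact (inv_pos.2 y0).trans_le (h2 hn)
    · exact y0.trans_le (h1 hn)
  have hp := zpow_pos hr |k|
  rcases lt_or_ge n 0 with hn | hn <;> rcases lt_or_ge k 0 with hk | hk
  · simp only [sg, not_le.2 hn, hk, if_true, if_false]
    rw [abs_mul, abs_of_pos (zpow_pos y0 k), abs_of_neg hk]
    obtain ⟨m, rfl⟩ : ∃ m : ℕ, k = -(m:ℤ) := ⟨(-k).toNat, by omega⟩
    rw [neg_neg, zpow_neg, zpow_natCast, zpow_natCast, ← inv_pow]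
    norm_num
    exact (inv_pow y m) ▸ pow_le_pow_left₀ (inv_pos.2 y0).le (h2 hn) m
  · simp [sg, not_le.2 hn, not_lt.2 hk]; exact hp.le
  · simp [sg, hn, hk]; exact hp.le
  · simp only [sg, hn, not_lt.2 hk, if_true, if_false]
    obtain ⟨m, rfl⟩ : ∃ m : ℕ, k = (m:ℤ) := ⟨k.toNat, by omega⟩
    rw [sub_zero, one_mul, abs_of_pos (zpow_pos y0 _), abs_of_nonneg hk, zpow_natCast, zpow_natCast]
    exact pow_le_pow_left₀ y0.le (h1 hn) m

lemma dbl {a : ℤ → ℝ} {q x ρ : ℝ} (ha : Summable a) (q0 : 0 < q) (x0 : 0 < x) (r0 : 0 < ρ) (r1 : ρ < 1)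
    (H : ∀ n, a n ≠ 0 → (0 ≤ n → x * q^n ≤ ρ) ∧ (n < 0 → (x * q^n)⁻¹ ≤ ρ)) :
    (∀ k, Summable fun n => a n * (sg n k * (x * q^n)^k)) ∧
    HasSum (fun k => ∑' n, a n * (sg n k * (x * q^n)^k)) (∑' n, a n * kc q x n) := by
  have hb : ∀ p : ℤ × ℤ, ‖a p.1 * (sg p.1 p.2 * (x * q^p.1)^p.2)‖ ≤ |a p.1| * ρ^|p.2| := by
    rintro ⟨n, k⟩
    simp only
    rw [norm_mul, Real.norm_eq_abs, Real.norm_eq_abs]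
    by_cases hn : a n = 0
    · simp [hn]
    · have := sg_bound (mul_pos x0 (zpow_pos q0 n)) n k (H n hn).1 (H n hn).2
      gcongr
  have hS : Summable fun p : ℤ × ℤ => a p.1 * (sg p.1 p.2 * (x * q^p.1)^p.2) := by
    refine Summable.of_norm_bounded ?_ hb
    have := summable_mul_of_summable_norm ha.norm.norm (absZ r0 r1).norm
    refine this.congr (fun p => ?_)
    simp
  have rows : ∀ n, HasSum (fun k => a n * (sg n k * (x * q^n)^k)) (a n * kc q x n) := by
    intro n
    by_cases hn : a n = 0
    · simp only [hn, zero_mul]; exact hasSum_zero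
    · exact (geoZ (mul_pos x0 (zpow_pos q0 n)) r1 n (H n hn).1 (H n hn).2).mul_left _
  have t1 : HasSum (fun n => a n * kc q x n) _ := hS.hasSum.prod_fiberwise rows
  have hS' := (Equiv.prodComm ℤ ℤ).summable_iff.2 hS
  have hs' := (Equiv.prodComm ℤ ℤ).hasSum_iff.2 hS.hasSum
  have cols : ∀ k, Summable fun n => a n * (sg n k * (x * q^n)^k) := fun k => hS'.prod_factor k
  refine ⟨cols, ?_⟩
  rw [t1.tsum_eq]
  exact hs'.prod_fiberwise fun k => (cols k).hasSum

/-- the basic Appell sum; with `z*t = 1` the term `n = 0` is absent. -/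
noncomputable def ga (q t : ℝ) (n : ℤ) : ℝ := (-1)^n * q^(n*n+n) * t^(2*n)
noncomputable def GG (q t z : ℝ) : ℝ := ∑' n : ℤ, ga q t n * kc q (z*t) n
noncomputable def sn (q t : ℝ) (n k : ℤ) : ℝ := (-1)^n * q^(n*n+n+n*k) * t^(2*n+k)
noncomputable def gam (q t : ℝ) (k : ℤ) : ℝ := ∑' n, sg n k * sn q t n k

lemma ga_sum {q t : ℝ} (q0 : 0 < q) (q1 : q < 1) (t0 : 0 < t) : Summable (ga q t) := by
  have := gsq q0 q1 (-(t^2)) (by have := pow_pos t0 2; linarith) 1 1 0 one_pos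
  refine this.congr fun n => ?_
  unfold ga
  rw [neg_pow_zpow t n]
  ring_nf
where
  neg_pow_zpow (t : ℝ) (n : ℤ) : (-(t^2))^n = (-1)^n * t^(2*n) := by
    rw [← neg_one_mul, mul_zpow, zpow_mul]; norm_cast

lemma sn_eq {q t z : ℝ} (q0 : 0 < q) (t0 : 0 < t) (n k : ℤ) :
    ga q t n * (sg n k * ((z*t) * q^n)^k) = sg n k * sn q t n k * z^k := by
  unfold ga sn
  rw [mul_zpow, mul_zpow, ← zpow_mul, zpow_add₀ q0.ne' _ (n*k), zpow_add₀ t0.ne']; ring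

lemma sn_sum {q t : ℝ} (q0 : 0 < q) (q1 : q < 1) (t0 : 0 < t) (k : ℤ) :
    Summable (fun n => sn q t n k) := by
  have := (gsq q0 q1 (-(t^2)) (by have := pow_pos t0 2; linarith) 1 (1+k) 0 one_pos).mul_right (t^k)
  refine this.congr fun n => ?_
  unfold sn
  rw [ga_sum.neg_pow_zpow t n, zpow_add₀ t0.ne']
  ring_nf

lemma sg_abs (n k : ℤ) : |sg n k| ≤ 1 := by
  unfold sg; split_ifs <;> norm_num

lemma sgsn_sum {q t : ℝ} (q0 : 0 < q) (q1 : q < 1) (t0 : 0 < t) (k : ℤ) :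
    Summable (fun n => sg n k * sn q t n k) := by
  refine (sn_sum q0 q1 t0 k).norm.of_norm_bounded fun n => ?_
  rw [norm_mul]
  exact mul_le_of_le_one_left (norm_nonneg _) (sg_abs n k)

lemma gam_hasSum {q t z : ℝ} (q0 : 0 < q) (t0 : 0 < t) (z0 : 0 < z) (h1 : q < z*t) (h2 : z*t < 1) :
    HasSum (fun k => gam q t k * z^k) (GG q t z) := by
  have x0 := mul_pos z0 t0
  have := (dbl (ga_sum q0 (h1.trans h2) t0) q0 x0 (ρ := max (z*t) (q/(z*t)))
    (lt_max_of_lt_left x0) (max_lt h2 ((div_lt_one x0).2 h1)) (fun n _ => ⟨fun hn => ?_, fun hn => ?_⟩)).2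
  · refine this.cg (fun k => ?_) rfl
    unfold gam
    rw [← tsum_mul_right]
    congr 1; ext n
    rw [sn_eq q0 t0]
  · refine le_trans ?_ (le_max_left _ _)
    have : q^n ≤ 1 := zpow_le_one₀ q0 (h1.trans h2).le hn
    exact mul_le_of_le_one_right x0.le this
  · refine le_trans ?_ (le_max_right _ _)
    rw [mul_inv, ← zpow_neg, mul_comm, div_eq_mul_inv]
    gcongr
    have : q^(-n) ≤ q^(1:ℤ) := zpow_le_zpow_right_of_le_one₀ q0 (h1.trans h2).le (by omega)
    simpa using this

/-- regular version -/
lemma gam_reg {q t : ℝ} (q0 : 0 < q) (q1 : q < 1) (t0 : 0 < t) :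
    HasSum (fun k => (gam q t k - (if 0 ≤ k then t^k else 0)) * t⁻¹^k) (GG q t t⁻¹) := by
  have e : t⁻¹ * t = 1 := inv_mul_cancel₀ t0.ne'
  have hs : Summable fun n => if n = 0 then 0 else ga q t n := by
    refine (ga_sum q0 q1 t0).norm.of_norm_bounded fun n => ?_
    split_ifs <;> simp
  have := (dbl hs q0 (x := t⁻¹*t) (by rw [e]; norm_num) (ρ := q) q0 q1
    (fun n hn => ⟨fun h => ?_, fun h => ?_⟩)).2
  · refine this.cg (fun k => ?_) ?_
    · have a1 := (sgsn_sum q0 q1 t0 k).hasSum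
      have a2 := (hasSum_ite_eq (0:ℤ) (sg 0 k * sn q t 0 k))
      have a3 := ((a1.sub a2).mul_right (t⁻¹^k)).tsum_eq
      rw [show sg 0 k * sn q t 0 k = if 0 ≤ k then t^k else 0 by
        unfold sg sn; by_cases hk : 0 ≤ k
        · simp [hk, not_lt.2 hk]
        · simp [hk, not_le.1 hk]] at a3
      unfold gam
      rw [← a3]
      congr 1; ext n
      by_cases hn : n = 0
      · subst hn
        simp only [if_true, zero_mul]
        unfold sg sn; by_cases hk : 0 ≤ k
        · simp [hk, not_lt.2 hk]
        · simp [hk, not_le.1 hk]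
      · simp only [hn, if_false, sub_zero]
        rw [sn_eq q0 t0]
    · unfold GG
      congr 1; ext n
      by_cases hn : n = 0
      · subst hn; simp [kc, e]
      · simp [hn]
  · have hn0 : n ≠ 0 := by rintro rfl; simp at hn
    rw [e, one_mul]
    have : q^n ≤ q^(1:ℤ) := zpow_le_zpow_right_of_le_one₀ q0 q1.le (by omega)
    simpa using this
  · rw [e, one_mul, ← zpow_neg]
    have : q^(-n) ≤ q^(1:ℤ) := zpow_le_zpow_right_of_le_one₀ q0 q1.le (by omega)
    simpa using this

noncomputable def AA (q t : ℝ) : ℝ := (t^2)⁻¹ * th q (t^2)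
noncomputable def BB (q t : ℝ) : ℝ := t⁻¹ * th q (q*t^2)

lemma AA_eq {q t : ℝ} (t0 : 0 < t) : ∑' n, sn q t n (-2) = AA q t := by
  unfold AA th
  rw [← tsum_mul_left]
  congr 1; ext n
  unfold sn thc
  rw [show n*n+n+n*(-2) = n*n-n by ring, zpow_add₀ t0.ne', zpow_mul,
    show t^(-2:ℤ) = (t^2)⁻¹ by rw [zpow_neg]; norm_cast, show t^(2:ℤ) = t^2 by norm_cast]
  ring

lemma BB_eq {q t : ℝ} (q0 : 0 < q) (t0 : 0 < t) : ∑' n, sn q t n (-1) = BB q t := by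
  unfold BB th
  rw [← tsum_mul_left]
  congr 1; ext n
  unfold sn thc
  rw [show n*n+n+n*(-1) = (n*n-n)+n by ring, zpow_add₀ t0.ne', zpow_mul, zpow_add₀ q0.ne', mul_zpow,
    zpow_neg_one, show t^(2:ℤ) = t^2 by norm_cast]
  ring

lemma gam_rec {q t : ℝ} (q0 : 0 < q) (q1 : q < 1) (t0 : 0 < t) (k : ℤ) :
    q^k * gam q t k + gam q t (k-2) = t^(k-2) - (if k = 0 then AA q t else 0)
      - (if k = 1 then BB q t else 0) := by
  have a1 := (sgsn_sum q0 q1 t0 k).hasSum.mul_left (q^k)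
  have a2 := hasSum_shift 1 (sgsn_sum q0 q1 t0 (k-2)).hasSum
  have a3 := hasSum_shift 1 (sn_sum q0 q1 t0 (k-2)).hasSum
  have b1 := hasSum_ite_eq (-1:ℤ) (sn q t 0 (k-2))
  have b2 := b1.sub (a3.mul_left (if k = 0 ∨ k = 1 then 1 else 0))
  have key := (a1.add a2).unique (b2.cg (fun n => ?_) rfl)
  · unfold gam
    rw [key]
    have : sn q t 0 (k-2) = t^(k-2) := by simp [sn]
    rw [this]
    by_cases h0 : k = 0
    · subst h0; simp [← AA_eq t0]
    · by_cases h1 : k = 1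
      · subst h1; simp [← BB_eq q0 t0]
      · simp [h0, h1]
  · have e : q^k * sn q t n k = - sn q t (n+1) (k-2) := by
      unfold sn
      rw [show (n+1)*(n+1)+(n+1)+(n+1)*(k-2) = k + (n*n+n+n*k) by ring,
        zpow_add₀ q0.ne' k, zpow_add_one₀ (by norm_num), show 2*(n+1)+(k-2) = 2*n+k by ring]
      ring
    rw [show q^k * (sg n k * sn q t n k) = sg n k * (q^k * sn q t n k) by ring, e]
    have e2 : sg (n+1) (k-2) - sg n k = (if n = -1 then 1 else 0) - (if k = 0 ∨ k = 1 then 1 else 0) := by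
      unfold sg
      split_ifs <;> first | omega | norm_num
    by_cases hn : n = -1
    · subst hn
      simp only [if_true] at e2 ⊢
      rw [show (-1:ℤ)+1 = 0 by norm_num] at e2 ⊢
      linear_combination e2 * sn q t 0 (k-2)
    · simp only [hn, if_false] at e2 ⊢
      linear_combination e2 * sn q t (n+1) (k-2)

noncomputable def Vf (V : ℤ → ℝ) (z : ℝ) : ℝ := ∑' j, V j * z^j
noncomputable def NN1 (q : ℝ) (V : ℤ → ℝ) (z : ℝ) : ℝ := ∑' k, V (k+1) * z^k * kc q (-1) k
noncomputable def NN2 (q : ℝ) (V : ℤ → ℝ) (z : ℝ) : ℝ := ∑' k, V (k+2) * z^k * kc q (-1) k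

lemma NN_sum {q : ℝ} (q0 : 0 < q) {V : ℤ → ℝ} (hs : ∀ z : ℝ, z ≠ 0 → Summable fun j => V j * z^j)
    (c : ℤ) {z : ℝ} (z0 : 0 < z) : Summable fun k => V (k+c) * z^k * kc q (-1) k := by
  have := ((summable_shift c (hs z z0.ne')).mul_right (z^(-c))).norm
  refine this.of_norm_bounded fun k => ?_
  rw [norm_mul]
  have e : V (k+c) * z^(k+c) * z^(-c) = V (k+c) * z^k := by
    rw [mul_assoc, ← zpow_add₀ z0.ne']; simp
  rw [e]
  exact mul_le_of_le_one_right (norm_nonneg _) (kcm_b1 q0 k)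

/-- convolution coefficient identity -/
lemma hconv {q t : ℝ} (q0 : 0 < q) (q1 : q < 1) (t0 : 0 < t) {V : ℤ → ℝ}
    (hr : ∀ j, V (j+2) = q^j * V j) (hs : ∀ z : ℝ, z ≠ 0 → Summable fun j => V j * z^j)
    (hc : ∀ k, Summable fun j => V j * gam q t (k-j)) (k : ℤ) :
    (∑' j, V j * gam q t (k-j)) =
      (t^k * Vf V t⁻¹ - AA q t * V (k+2) - BB q t * V (k+1)) * kc q (-1) k := by
  have a1 := (hc k).hasSum.mul_left (q^k)
  have a2 := hasSum_shift 2 (hc k).hasSum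
  have a3 := hasSum_shift 2 (hs t⁻¹ (inv_pos.2 t0).ne').hasSum
  have b1 := hasSum_ite_eq k (V (k+2) * AA q t)
  have b2 := hasSum_ite_eq (k-1) (V (k+1) * BB q t)
  have b3 := ((a3.mul_left (t^k)).sub b1).sub b2
  have key := (a1.add a2).unique (b3.cg (fun j => ?_) rfl)
  · have hk : 1 - -1 * q^k ≠ 0 := by have := zpow_pos q0 k; linarith
    unfold kc Vf
    rw [eq_mul_inv_iff_mul_eq₀ hk]
    linear_combination key
  · have e1 : q^k * (V j * gam q t (k-j)) = V (j+2) * (q^(k-j) * gam q t (k-j)) := by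
      rw [hr, show q^k = q^j * q^(k-j) by rw [← zpow_add₀ q0.ne']; ring_nf]; ring
    rw [e1, ← mul_add, show k - (j+2) = (k-j)-2 by ring, gam_rec q0 q1 t0]
    have e2 : t^k * (V (j+2) * t⁻¹^(j+2)) = V (j+2) * t^(k-j-2) := by
      rw [inv_zpow, ← zpow_neg, show k-j-2 = k + -(j+2) by ring, zpow_add₀ t0.ne' k]; ring
    rw [e2]
    by_cases h1 : j = k
    · have h3 : ¬ (j = k - 1) := by omega
      rw [if_pos h1, if_neg h3, if_pos (by omega), if_neg (by omega), h1]; ring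
    · by_cases h2 : j = k - 1
      · rw [if_neg h1, if_pos h2, if_neg (by omega), if_pos (by omega), h2,
          show k - 1 + 2 = k + 1 by ring]; ring
      · have h3 : ¬ (k - j = 0) := by omega
        have h4 : ¬ (k - j = 1) := by omega
        simp [h1, h2, h3, h4]

theorem single {q t z : ℝ} (q0 : 0 < q) (t0 : 0 < t) (z0 : 0 < z) (h1 : q < z*t) (h2 : z*t < 1)
    {V : ℤ → ℝ} (hr : ∀ j, V (j+2) = q^j * V j) (hs : ∀ z : ℝ, z ≠ 0 → Summable fun j => V j * z^j) :
    Vf V z * GG q t z = Vf V t⁻¹ * KK q (z*t) - AA q t * NN2 q V z - BB q t * NN1 q V z := by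
  obtain ⟨hc, hh⟩ := convz z0.ne' (hs z z0.ne').hasSum (gam_hasSum q0 t0 z0 h1 h2)
  refine hh.unique (HasSum.cg (((KK_hasSum q0 h1 h2).mul_left (Vf V t⁻¹)).sub
    ((NN_sum q0 hs 2 z0).hasSum.mul_left (AA q t)) |>.sub
    ((NN_sum q0 hs 1 z0).hasSum.mul_left (BB q t))) (fun k => ?_) rfl)
  rw [hconv q0 (h1.trans h2) t0 hr hs hc, mul_zpow]
  ring


/-- `ω(j,k) = 1/(1+q^k) - [k ≥ j]` -/
noncomputable def om (q : ℝ) (j k : ℤ) : ℝ := kc q (-1) k - (if j ≤ k then 1 else 0)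

lemma kcm_neg {q : ℝ} (q0 : 0 < q) (k : ℤ) : kc q (-1) (-k) = 1 - kc q (-1) k := by
  unfold kc
  have := zpow_pos q0 k
  rw [zpow_neg]
  have h1 : 1 - -1 * q^k ≠ 0 := by linarith
  have h2 : 1 - -1 * (q^k)⁻¹ = (1 - -1 * q^k) * (q^k)⁻¹ := by field_simp; ring
  rw [h2, mul_inv, inv_inv]
  generalize q^k = x at *
  have h3 : 1 + x ≠ 0 := by linarith
  rw [show 1 - -1*x = 1 + x by ring]
  field_simp
  ring

lemma om_bound {q : ℝ} (q0 : 0 < q) (q1 : q < 1) (j k : ℤ) :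
    |om q j k| ≤ q^(-|j|) * q^|k| := by
  have hp := kcm_pos q0 k
  have hb := kcm_b1 q0 k
  rw [abs_of_pos hp] at hb
  have mono : ∀ a b : ℤ, b ≤ a → q^a ≤ q^b := fun a b h => zpow_le_zpow_right_of_le_one₀ q0 q1.le h
  rw [← zpow_add₀ q0.ne']
  unfold om
  split_ifs with h
  · have e : kc q (-1) k - 1 = - kc q (-1) (-k) := by rw [kcm_neg q0]; ring
    rw [e, abs_neg]
    have h2 := kcm_b2 q0 (-k)
    have h3 := kcm_b1 q0 (-k)
    rw [one_mul, neg_neg] at h2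
    rcases le_or_gt 0 k with hk | hk
    · exact h2.trans (mono _ _ (by rw [abs_of_nonneg hk]; have := abs_nonneg j; omega))
    · refine h3.trans ?_
      rw [← zpow_zero q]
      exact mono _ _ (by rw [abs_of_neg hk, abs_of_neg (h.trans_lt hk)]; omega)
  · rw [sub_zero]
    have h2 := kcm_b2 q0 k
    have h3 := kcm_b1 q0 k
    rw [one_mul] at h2
    rcases le_or_gt 0 k with hk | hk
    · refine h3.trans ?_
      rw [← zpow_zero q]
      exact mono _ _ (by rw [abs_of_nonneg hk, abs_of_nonneg (hk.trans (not_le.1 h).le)]; omega)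
    · exact h2.trans (mono _ _ (by rw [abs_of_neg hk]; have := abs_nonneg j; omega))

lemma om_sum {q : ℝ} (q0 : 0 < q) (q1 : q < 1) (j : ℤ) : Summable (om q j) := by
  refine ((absZ q0 q1).mul_left (q^(-|j|))).of_norm_bounded fun k => om_bound q0 q1 j k

lemma om_tsum {q : ℝ} (q0 : 0 < q) (q1 : q < 1) (j : ℤ) : ∑' k, om q j k = j - 1/2 := by
  have base : ∑' k, om q 0 k = -1/2 := by
    have h := (om_sum q0 q1 0).hasSum
    have h2 := hasSum_refl 0 h
    have h3 := h.neg.sub (hasSum_ite_eq (0:ℤ) (1:ℝ))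
    have := h2.unique (h3.cg (fun k => ?_) rfl)
    · linarith
    · unfold om
      rw [zero_sub, kcm_neg q0]
      split_ifs <;> first | omega | ring
  have step : ∀ j : ℤ, ∑' k, om q (j+1) k = ∑' k, om q j k + 1 := by
    intro j
    have h := ((om_sum q0 q1 j).hasSum.add (hasSum_ite_eq j (1:ℝ)))
    refine (h.cg (fun k => ?_) rfl).tsum_eq
    unfold om
    split_ifs <;> first | omega | ring
  induction j using Int.induction_on with
  | zero => rw [base]; push_cast; ring
  | succ i ih => rw [step, ih]; push_cast; ring
  | pred i ih =>
    have := step (-(i:ℤ) - 1)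
    rw [show -(i:ℤ) - 1 + 1 = -i by ring, ih] at this
    push_cast at this ⊢; linarith

lemma V_w_sum {q : ℝ} (q0 : 0 < q) (q1 : q < 1) {V : ℤ → ℝ}
    (hs : ∀ z : ℝ, z ≠ 0 → Summable fun j => V j * z^j) {z : ℝ} (z0 : 0 < z) :
    Summable fun j => V j * z^j * q^(-|j|) := by
  have a := (hs (z*q) (mul_pos z0 q0).ne').norm
  have b := (hs (z*q⁻¹) (mul_pos z0 (inv_pos.2 q0)).ne').norm
  refine (a.add b).of_norm_bounded fun j => ?_
  rcases le_or_gt 0 j with h | h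
  · rw [abs_of_nonneg h, zpow_neg, ← inv_zpow, mul_assoc, ← mul_zpow]
    linarith [norm_nonneg (V j * (z*q)^j)]
  · rw [abs_of_neg h, neg_neg, mul_assoc, ← mul_zpow]
    linarith [norm_nonneg (V j * (z*q⁻¹)^j)]

lemma dbl_om {q : ℝ} (q0 : 0 < q) (q1 : q < 1) {V : ℤ → ℝ}
    (hs : ∀ z : ℝ, z ≠ 0 → Summable fun j => V j * z^j) {z : ℝ} (z0 : 0 < z) :
    Summable (fun j : ℤ => V j * z^j * (j - 1/2)) ∧
    (∀ k, Summable fun j => V j * z^j * om q j k) ∧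
    HasSum (fun k => ∑' j, V j * z^j * om q j k) (∑' j : ℤ, V j * z^j * (j - 1/2)) := by
  have hS : Summable fun p : ℤ × ℤ => V p.1 * z^p.1 * om q p.1 p.2 := by
    have := summable_mul_of_summable_norm (V_w_sum q0 q1 hs z0).norm (absZ q0 q1).norm
    refine this.norm.of_norm_bounded ?_
    rintro ⟨j, k⟩
    simp only
    rw [norm_mul, show V j * z^j * q^(-|j|) * q^|k| = (V j * z^j) * (q^(-|j|) * q^|k|) by ring,
      norm_mul (V j * z^j) (q^(-|j|) * q^|k|)]
    exact mul_le_mul_of_nonneg_left ((om_bound q0 q1 j k).trans (le_abs_self _)) (norm_nonneg _)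
  have rows : ∀ j, HasSum (fun k => V j * z^j * om q j k) (V j * z^j * (j-1/2)) := by
    intro j
    rw [← om_tsum q0 q1 j]
    exact (om_sum q0 q1 j).hasSum.mul_left _
  have t1 : HasSum (fun j : ℤ => V j * z^j * (j-1/2)) _ := hS.hasSum.prod_fiberwise rows
  have hS' := (Equiv.prodComm ℤ ℤ).summable_iff.2 hS
  have hs' := (Equiv.prodComm ℤ ℤ).hasSum_iff.2 hS.hasSum
  have cols : ∀ k, Summable fun j => V j * z^j * om q j k := fun k => hS'.prod_factor k
  refine ⟨t1.summable, cols, ?_⟩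
  rw [t1.tsum_eq]
  exact hs'.prod_fiberwise fun k => (cols k).hasSum

lemma gam_conv_sum {q t : ℝ} (q0 : 0 < q) (q1 : q < 1) (t0 : 0 < t) {V : ℤ → ℝ}
    (hs : ∀ z : ℝ, z ≠ 0 → Summable fun j => V j * z^j) (k : ℤ) :
    Summable fun j => V j * gam q t (k-j) := by
  have z0 : 0 < √q / t := div_pos (Real.sqrt_pos.2 q0) t0
  have e : √q / t * t = √q := by field_simp
  have h1 : q < √q := by
    apply Real.lt_sqrt_of_sq_lt; nlinarith
  have h2 : √q < 1 := by rw [Real.sqrt_lt' one_pos]; simpa using q1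
  exact (convz z0.ne' (hs _ z0.ne').hasSum (gam_hasSum q0 t0 z0 (by rw [e]; exact h1) (by rw [e]; exact h2))).1 k

/-- regularised single lemma -/
theorem single_reg {q t : ℝ} (q0 : 0 < q) (q1 : q < 1) (t0 : 0 < t) {V : ℤ → ℝ}
    (hr : ∀ j, V (j+2) = q^j * V j) (hs : ∀ z : ℝ, z ≠ 0 → Summable fun j => V j * z^j) :
    Vf V t⁻¹ * GG q t t⁻¹ = ∑' j : ℤ, V j * t⁻¹^j * (j - 1/2) - AA q t * NN2 q V t⁻¹
      - BB q t * NN1 q V t⁻¹ := by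
  have z0 := inv_pos.2 t0
  obtain ⟨hc, hh⟩ := convz z0.ne' (hs t⁻¹ z0.ne').hasSum (gam_reg q0 q1 t0)
  obtain ⟨d1, d2, d3⟩ := dbl_om q0 q1 hs z0
  refine hh.unique (HasSum.cg (d3.sub
    ((NN_sum q0 hs 2 z0).hasSum.mul_left (AA q t)) |>.sub
    ((NN_sum q0 hs 1 z0).hasSum.mul_left (BB q t))) (fun k => ?_) rfl)
  have hg := gam_conv_sum q0 q1 t0 hs k
  have g1 := hg.hasSum
  rw [hconv q0 q1 t0 hr hs (gam_conv_sum q0 q1 t0 hs)] at g1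
  have g2 := ((d2 k).hasSum.sub ((hs t⁻¹ z0.ne').hasSum.mul_right (kc q (-1) k))).mul_right (t^k)
  have key := (g1.add g2).tsum_eq
  have e : ∀ j, V j * gam q t (k-j) + (V j * t⁻¹^j * om q j k - V j * t⁻¹^j * kc q (-1) k) * t^k
      = V j * (gam q t (k-j) - if 0 ≤ k - j then t^(k-j) else 0) := by
    intro j
    unfold om
    have e2 : t⁻¹^j * t^k = t^(k-j) := by rw [zpow_sub₀ t0.ne', inv_zpow]; field_simp
    by_cases h : j ≤ k
    · have h' : 0 ≤ k - j := by omega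
      rw [if_pos h, if_pos h', ← e2]; ring
    · have h' : ¬ 0 ≤ k - j := by omega
      rw [if_neg h, if_neg h']; ring
  rw [← tsum_congr e, key]
  have e3 : t^k * t⁻¹^k = 1 := by rw [← mul_zpow, mul_inv_cancel₀ t0.ne', one_zpow]
  unfold Vf
  linear_combination (∑' j, V j * t⁻¹^j * om q j k) * e3

/-- logarithmic derivative -/
theorem logder {q : ℝ} (q0 : 0 < q) (q1 : q < 1) {V : ℤ → ℝ}
    (hr : ∀ j, V (j+2) = q^j * V j) (hs : ∀ z : ℝ, z ≠ 0 → Summable fun j => V j * z^j)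
    (hsym : ∀ j, V (2-j) = V j) (hV1 : Vf V 1 = 0) {z : ℝ} (hz0 : q < z) (hz1 : z < 1) :
    ∑' j : ℤ, V j * z^j * j = -2 * (LL q z * Vf V z) := by
  have z0 := q0.trans hz0
  obtain ⟨hc, hh⟩ := convz z0.ne' (LL_hasSum q0 hz0 hz1) (hs z z0.ne').hasSum
  set h : ℤ → ℝ := fun j => ∑' k, kc q 1 k * V (j-k) with hdef
  have hq : ∀ k, q^k * kc q 1 k = kc q 1 k - 1 + (if k = 0 then 1 else 0) := by
    intro k
    by_cases hk : k = 0
    · subst hk; simp [kc]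
    · have h1 : q^k ≠ 1 := by
        intro h
        exact hk ((zpow_eq_one_iff_right₀ q0.le q1.ne).1 h)
      have h3 : 1 - 1 * q^k ≠ 0 := fun h => h1 (by linarith)
      rw [if_neg hk]
      unfold kc
      field_simp
      ring
  have hs1 : ∀ j, HasSum (fun k => V (j - k)) 0 := by
    intro j
    have := (hs 1 one_ne_zero).hasSum
    change HasSum _ (Vf V 1) at this
    rw [hV1] at this
    exact (hasSum_refl j this).cg (fun k => by simp) rfl
  have A : ∀ j, HasSum (fun k => q^k * kc q 1 k * V (j-k)) (h j + V j) := by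
    intro j
    have := ((hc j).hasSum.sub (hs1 j)).add (hasSum_ite_eq (0:ℤ) (V j))
    refine this.cg (fun k => ?_) (by simp [hdef])
    rw [hq]
    by_cases hk : k = 0
    · subst hk; simp
    · simp [hk]; ring
  have R : ∀ j, h (j+2) + V (j+2) = q^j * h j := by
    intro j
    refine (A (j+2)).unique (((hc j).hasSum.mul_left (q^j)).cg (fun k => ?_) rfl)
    rw [show j + 2 - k = (j-k) + 2 by ring, hr, show q^j = q^(j-k)*q^k by rw [← zpow_add₀ q0.ne']; ring_nf]
    ring
  have S : ∀ j, h (2-j) = - (h j + V j) := by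
    intro j
    have := hasSum_refl 0 (hc (2-j)).hasSum
    refine this.unique ((A j).neg.cg (fun k => ?_) rfl)
    rw [zero_sub, kc1_neg q0 q1, show 2 - j - -k = 2 - (j-k) by ring, hsym]; ring
  have E : ∀ j, h j + j * V j / 2 = 0 ∧ h (j+1) + ((j+1:ℤ):ℝ) * V (j+1) / 2 = 0 := by
    have e2 : ∀ j : ℤ, h (j+2) + ((j+2:ℤ):ℝ) * V (j+2) / 2 = q^j * (h j + j * V j / 2) := by
      intro j
      have := R j
      have h3 := hr j
      push_cast
      linear_combination this + j/2 * h3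
    intro j
    induction j using Int.induction_on with
    | zero =>
      have s0 := S 0
      have r0 := R 0
      have s1 := S 1
      have v2 := hsym 0
      norm_num at s0 r0 s1 v2 ⊢
      constructor <;> linarith
    | succ i ih =>
      refine ⟨ih.2, ?_⟩
      have := e2 i
      rw [ih.1, mul_zero] at this
      rw [show (i:ℤ)+1+1 = i+2 by ring]; exact this
    | pred i ih =>
      rw [show -(i:ℤ) - 1 + 1 = -i by ring]
      refine ⟨?_, ih.1⟩
      have := e2 (-(i:ℤ)-1)
      rw [show -(i:ℤ)-1+2 = -i + 1 by ring, ih.2] at this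
      rcases mul_eq_zero.1 this.symm with h | h
      · exact absurd h (zpow_pos q0 _).ne'
      · exact h
  have := hh.mul_left (-2)
  refine Eq.trans ?_ this.tsum_eq
  congr 1; ext j
  have := (E j).1
  simp only [hdef] at this
  linear_combination 2 * z^j * this


lemma KK_symm {q z : ℝ} (q0 : 0 < q) : KK q (q/z) = KK q z := by
  unfold KK
  rw [← (Equiv.neg ℤ).tsum_eq (fun k => kc q (-1) k * z^k)]
  congr 1; ext k
  simp only [Equiv.neg_apply]
  have e : kc q (-1) (-k) = q^k * kc q (-1) k := by
    rw [kcm_neg q0]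
    unfold kc
    have := zpow_pos q0 k
    have h1 : 1 + q^k ≠ 0 := by linarith
    rw [show 1 - -1 * q^k = 1 + q^k by ring]
    field_simp
    ring
  rw [e, div_zpow, zpow_neg]
  ring

lemma sqrt_lt_one' {q : ℝ} (q1 : q < 1) : √q < 1 := by
  rw [Real.sqrt_lt' one_pos]; simpa using q1

lemma Vf_val {q : ℝ} (q0 : 0 < q) (q1 : q < 1) {s z : ℝ} (hs : s ≠ 0) (hz : z ≠ 0) :
    Vf (Vc (√q) s) z = th (√q) (z*s) * th (√q) (z/s) :=
  (Vc_hasSum (Real.sqrt_pos.2 q0) (sqrt_lt_one' q1) hs hz).2.tsum_eq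

lemma Vs_sum {q : ℝ} (q0 : 0 < q) (q1 : q < 1) {s : ℝ} (hs : s ≠ 0) :
    ∀ z : ℝ, z ≠ 0 → Summable fun j => Vc (√q) s j * z^j := fun z hz =>
  (Vc_hasSum (Real.sqrt_pos.2 q0) (sqrt_lt_one' q1) hs hz).2.summable

lemma Vs_rec {q : ℝ} (q0 : 0 < q) (s : ℝ) (j : ℤ) : Vc (√q) s (j+2) = q^j * Vc (√q) s j := by
  have := Vc_rec (Real.sqrt_pos.2 q0) s j
  rwa [Real.sq_sqrt q0.le] at this

lemma AA_inv {q t : ℝ} (q0 : 0 < q) (q1 : q < 1) (t0 : 0 < t) : AA q t⁻¹ = - (t^2 * AA q t) := by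
  unfold AA
  rw [inv_pow, th_inv q0 q1 (pow_pos t0 2).ne']
  field_simp

lemma BB_inv {q t : ℝ} (q0 : 0 < q) (q1 : q < 1) (t0 : 0 < t) : BB q t⁻¹ = t^2 * BB q t := by
  unfold BB
  have : q * t⁻¹^2 = q^2 / (q * t^2) := by field_simp
  rw [this, th_inv_symm q0 q1 (by positivity)]
  field_simp

/-- the case t = 1 -/
lemma fval {q z : ℝ} (q0 : 0 < q) (h1 : q < z) (h2 : z < 1) {V : ℤ → ℝ}
    (hr : ∀ j, V (j+2) = q^j * V j) (hs : ∀ z : ℝ, z ≠ 0 → Summable fun j => V j * z^j) :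
    th q q * NN1 q V z = Vf V 1 * KK q z - Vf V z * GG q 1 z := by
  have := single q0 one_pos (q0.trans h1) (by rwa [mul_one]) (by rwa [mul_one]) hr hs
  have a : AA q 1 = 0 := by unfold AA; rw [one_pow, th_one q0 (h1.trans h2)]; ring
  have b : BB q 1 = th q q := by unfold BB; norm_num
  rw [a, b, inv_one, mul_one] at this
  linarith

noncomputable def YY (q t : ℝ) : ℝ := GG q t⁻¹ t + t^2 * GG q t t

theorem YY_val {q t : ℝ} (q0 : 0 < q) (h1 : q < t) (h2 : t < 1) (h3 : q < t*t)
    (hp : th q q ≠ 0) (hth : th (√q) t ≠ 0) :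
    th q q * YY q t = 2 * t * th q (q*t^2) * GG q 1 t
      + th q q * (-2 * LL q t + KK q (t*t) - 1/2) := by
  have t0 := q0.trans h1
  have q1 := h1.trans h2
  have r0 := Real.sqrt_pos.2 q0
  have r1 := sqrt_lt_one' q1
  set V := Vc (√q) 1 with hV
  have hr : ∀ j, V (j+2) = q^j * V j := Vs_rec q0 1
  have hs := Vs_sum q0 q1 (one_ne_zero (α := ℝ))
  rw [← hV] at hs
  have vt : ∀ z : ℝ, z ≠ 0 → Vf V z = th (√q) z ^2 := by
    intro z hz
    rw [hV, Vf_val q0 q1 one_ne_zero hz, mul_one, div_one]; ring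
  have v1 : Vf V 1 = 0 := by rw [vt 1 one_ne_zero, th_one r0 r1]; ring
  have vi : t^2 * Vf V t⁻¹ = Vf V t := by
    rw [vt _ (inv_pos.2 t0).ne', vt _ t0.ne', th_inv r0 r1 t0.ne']
    field_simp
  have a1 := fval q0 h1 h2 hr hs
  have a2 := single q0 t0 t0 h3 (by nlinarith) hr hs
  have a3 := single_reg q0 q1 (inv_pos.2 t0) hr hs
  rw [inv_inv] at a3
  have a4 := logder q0 q1 hr hs (fun j => by rw [hV, Vc_symm, inv_one]) v1 h1 h2
  have a5 : ∑' j : ℤ, V j * t^j * (j - 1/2) = ∑' j : ℤ, V j * t^j * j - 1/2 * Vf V t := by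
    have s1 := (dbl_om q0 q1 hs t0).1
    have s2 := (hs t t0.ne').mul_right (1/2)
    have := s1.tsum_add s2
    have e : ∀ j : ℤ, V j * t^j * (j-1/2) + V j * t^j * (1/2) = V j * t^j * j := fun j => by ring
    rw [tsum_congr e, tsum_mul_right] at this
    unfold Vf
    linarith
  rw [a5, a4, AA_inv q0 q1 t0, BB_inv q0 q1 t0] at a3
  rw [v1] at a1
  have hb : t^2 * BB q t = t * th q (q*t^2) := by unfold BB; field_simp
  have hne : Vf V t ≠ 0 := by rw [vt t t0.ne']; exact pow_ne_zero 2 hth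
  apply mul_left_cancel₀ hne
  unfold YY
  linear_combination th q q * a3 + th q q * t^2 * a2 - 2 * t^2 * BB q t * a1
    + th q q * KK q (t*t) * vi + 2 * Vf V t * GG q 1 t * hb


lemma thr_pos {Q : ℝ} (h0 : 0 < Q) (h1 : Q < 1) (j : ℕ) (hj : 0 < j) (hj5 : j < 5) :
    0 < th (√(Q^5)) (Q^j) := by
  have a := (KK_val h0 h1 j hj hj5).1
  have t := TT_pos h0 h1
  have b1 := tt_pos h0 h1 j (by omega) (by omega)
  have b2 := tt_pos h0 h1 (5-j) (by omega) (by omega)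
  have b3 := hh_pos h0 h1
  have : 0 < th (√(Q^5)) (Q^j) * TT Q := by rw [a]; positivity
  exact (pos_iff_pos_of_mul_pos this).2 t

lemma thr_symm {Q : ℝ} (h0 : 0 < Q) (h1 : Q < 1) (j k : ℕ) (h : j + k = 5) :
    th (√(Q^5)) (Q^j) = th (√(Q^5)) (Q^k) := by
  have q0 := pow_pos h0 5
  rw [← th_inv_symm (Real.sqrt_pos.2 q0) (sqrt_lt_one' (Q5_lt h0 h1)) (pow_pos h0 k).ne',
    Real.sq_sqrt q0.le]
  congr 1
  rw [eq_div_iff (pow_pos h0 k).ne', ← pow_add, h]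

theorem S2_val {Q : ℝ} (h0 : 0 < Q) (h1 : Q < 1) :
    tt Q 5 * th (√(Q^5)) (Q^2) * (GG (Q^5) Q⁻¹ (Q^2) + Q^2 * GG (Q^5) Q (Q^2))
     = 2 * Q * tt Q 3 * th (√(Q^5)) (Q^2) * GG (Q^5) 1 (Q^2)
      + 2 * tt Q 3 * th (√(Q^5)) Q * KK (Q^5) (Q^2) := by
  have q0 := pow_pos h0 5
  have q1 := Q5_lt h0 h1
  have r0 := Real.sqrt_pos.2 q0
  have r1 := sqrt_lt_one' q1
  have lt : ∀ a b : ℕ, a < b → Q^b < Q^a := fun a b h => pow_lt_pow_right_of_lt_one₀ h0 h1 h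
  have p2 := thr_symm h0 h1 3 2 (by norm_num)
  have t1 := thr_pos h0 h1 1 (by norm_num) (by norm_num)
  have t2 := thr_pos h0 h1 2 (by norm_num) (by norm_num)
  rw [pow_one] at t1
  set V := Vc (√(Q^5)) Q with hV
  have hr : ∀ j, V (j+2) = (Q^5)^j * V j := Vs_rec q0 Q
  have hs := Vs_sum q0 q1 h0.ne'
  rw [← hV] at hs
  have vv : ∀ z : ℝ, z ≠ 0 → Vf V z = _ := fun z hz => Vf_val q0 q1 h0.ne' hz
  have hi : Q⁻¹ ≠ 0 := inv_ne_zero h0.ne'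
  have v1 : Q * Vf V 1 = - th (√(Q^5)) Q^2 := by
    rw [vv 1 one_ne_zero, one_mul, one_div, th_inv r0 r1 h0.ne']; field_simp
  have v2 : Vf V (Q^2) = th (√(Q^5)) Q * th (√(Q^5)) (Q^2) := by
    rw [vv _ (pow_pos h0 2).ne', ← pow_succ, p2, show Q^2/Q = Q by field_simp]; ring
  have v3 : Vf V Q = 0 := by
    rw [vv _ h0.ne', div_self h0.ne', th_one r0 r1]; ring
  have v4 : Vf V Q⁻¹ = 0 := by
    rw [vv _ hi, inv_mul_cancel₀ h0.ne', th_one r0 r1]; ring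
  have e1 : Q^2 * Q⁻¹ = Q := by field_simp
  have e2 : Q^2 * Q = Q^3 := by ring
  have a1 := fval q0 (lt 2 5 (by norm_num)) (pw_lt h0 h1 (n := 2) (by norm_num)) hr hs
  have a2 := single q0 h0 (pow_pos h0 2) (by rw [e2]; exact lt 3 5 (by norm_num))
    (by rw [e2]; exact pw_lt h0 h1 (by norm_num)) hr hs
  have a3 := single q0 (inv_pos.2 h0) (pow_pos h0 2)
    (by rw [e1]; simpa using lt 1 5 (by norm_num)) (by rw [e1]; exact h1) hr hs
  rw [inv_inv, v3, AA_inv q0 q1 h0, BB_inv q0 q1 h0] at a3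
  rw [v4] at a2
  have hb : Q * BB (Q^5) Q = tt Q 3 := by
    unfold BB
    rw [← tt_symm h0 h1 7 3 (by norm_num), tt, ← pow_add]; field_simp
  have hp : tt Q 5 = th (Q^5) (Q^5) := rfl
  rw [← hp] at a1
  have hn : th (√(Q^5)) Q ≠ 0 := t1.ne'
  apply mul_left_cancel₀ hn
  rw [v2] at a1 a2 a3
  linear_combination tt Q 5 * a3 + tt Q 5 * Q^2 * a2 - 2 * Q^2 * BB (Q^5) Q * a1
    + (-2 * Q * KK (Q^5) (Q^2) * Vf V 1 + 2 * Q * th (√(Q^5)) Q * th (√(Q^5)) (Q^2) * GG (Q^5) 1 (Q^2)) * hb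
    - 2 * tt Q 3 * KK (Q^5) (Q^2) * v1

theorem S3_val {Q : ℝ} (h0 : 0 < Q) (h1 : Q < 1) :
    tt Q 5 * th (√(Q^5)) Q * (Q^5 * GG (Q^5) (Q^3) Q - Q^3 * GG (Q^5) (Q^2) Q)
     = 2 * tt Q 1 * (th (√(Q^5)) (Q^2) * KK (Q^5) Q - Q * th (√(Q^5)) Q * GG (Q^5) 1 Q) := by
  have q0 := pow_pos h0 5
  have q1 := Q5_lt h0 h1
  have r0 := Real.sqrt_pos.2 q0
  have r1 := sqrt_lt_one' q1
  have lt : ∀ a b : ℕ, a < b → Q^b < Q^a := fun a b h => pow_lt_pow_right_of_lt_one₀ h0 h1 h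
  have p2 := thr_symm h0 h1 3 2 (by norm_num)
  have t1 := thr_pos h0 h1 1 (by norm_num) (by norm_num)
  have t2 := thr_pos h0 h1 2 (by norm_num) (by norm_num)
  rw [pow_one] at t1
  have Q2 := pow_pos h0 2
  have Q3 := pow_pos h0 3
  set V := Vc (√(Q^5)) (Q^2) with hV
  have hr : ∀ j, V (j+2) = (Q^5)^j * V j := Vs_rec q0 (Q^2)
  have hs := Vs_sum q0 q1 Q2.ne'
  rw [← hV] at hs
  have vv : ∀ z : ℝ, z ≠ 0 → Vf V z = _ := fun z hz => Vf_val q0 q1 Q2.ne' hz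
  have v1 : Q^2 * Vf V 1 = - th (√(Q^5)) (Q^2)^2 := by
    rw [vv 1 one_ne_zero, one_mul, one_div, th_inv r0 r1 Q2.ne']; field_simp
  have v2 : Q * Vf V Q = - th (√(Q^5)) Q * th (√(Q^5)) (Q^2) := by
    rw [vv _ h0.ne', ← pow_succ', p2, show Q/Q^2 = Q⁻¹ by field_simp, th_inv r0 r1 h0.ne']
    field_simp
  have v3 : Vf V (Q^2)⁻¹ = 0 := by
    rw [vv _ (inv_pos.2 Q2).ne', inv_mul_cancel₀ Q2.ne', th_one r0 r1]; ring
  have v4 : Vf V (Q^3)⁻¹ = 0 := by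
    rw [vv _ (inv_pos.2 Q3).ne', show (Q^3)⁻¹/Q^2 = (Q^5)⁻¹ by field_simp, th_inv r0 r1 q0.ne']
    have := th_q r0 r1
    rw [Real.sq_sqrt q0.le] at this
    rw [this]; ring
  have e1 : Q * Q^2 = Q^3 := by ring
  have e2 : Q * Q^3 = Q^4 := by ring
  have a1 := fval q0 (by simpa using lt 1 5 (by norm_num)) h1 hr hs
  have a2 := single q0 Q2 h0 (by rw [e1]; exact lt 3 5 (by norm_num))
    (by rw [e1]; exact pw_lt h0 h1 (by norm_num)) hr hs
  have a3 := single q0 Q3 h0 (by rw [e2]; exact lt 4 5 (by norm_num))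
    (by rw [e2]; exact pw_lt h0 h1 (by norm_num)) hr hs
  rw [v4] at a3
  rw [v3] at a2
  have hb2 : Q^2 * BB (Q^5) (Q^2) = tt Q 1 := by
    unfold BB
    rw [← tt_symm h0 h1 9 1 (by norm_num), tt, ← pow_mul, ← pow_add]; field_simp
  have hb3 : Q^4 * BB (Q^5) (Q^3) = - tt Q 1 := by
    unfold BB
    have : Q^5*(Q^3)^2 = (Q^5)^2/(Q^1)⁻¹ := by field_simp
    rw [this, th_inv_symm q0 q1 (inv_pos.2 (pow_pos h0 1)).ne', th_inv q0 q1 (pow_pos h0 1).ne', tt]; field_simp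
  have ha : Q^2 * AA (Q^5) (Q^3) = AA (Q^5) (Q^2) := by
    unfold AA
    have : (Q^3)^2 = (Q^5)^2/((Q^2)^2) := by field_simp
    rw [this, th_inv_symm q0 q1 (by positivity)]; field_simp
  have hp : tt Q 5 = th (Q^5) (Q^5) := rfl
  rw [← hp] at a1
  apply mul_left_cancel₀ t2.ne'
  linear_combination
   -tt Q 5 * Q * (Q^5 * a3 - Q^3 * a2) + tt Q 5 * (Q^5*GG (Q^5) (Q^3) Q - Q^3*GG (Q^5) (Q^2) Q) * v2
   + tt Q 5 * Q * NN2 (Q^5) V Q * Q^3 * ha + tt Q 5 * Q * NN1 (Q^5) V Q * (Q * hb3 - Q * hb2)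
   - 2 * Q^2 * tt Q 1 * a1 - 2 * tt Q 1 * KK (Q^5) Q * v1 + 2 * Q * tt Q 1 * GG (Q^5) 1 Q * v2


noncomputable def cB (Q : ℝ) : ℝ := tt Q 5 * tt Q 4 * TT Q^3 / (tt Q 2 * tt Q 3)^2
noncomputable def cA3 (Q : ℝ) : ℝ := TT Q^3 / (tt Q 2 * tt Q 3)
noncomputable def cA1 (Q : ℝ) : ℝ := (2 * Q * GG (Q^5) 1 (Q^2) + tt Q 3 * cB Q) / tt Q 5
noncomputable def cA4 (Q : ℝ) : ℝ := (- GG (Q^5) 1 Q + 2 * tt Q 3 * cA3 Q - tt Q 1 * cB Q) / tt Q 5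

noncomputable def phi (v : ℝ) : ℝ := ∑' n : ℤ, (-1)^n * v^(n*n)
noncomputable def UU (v : ℝ) (b : ℤ) : ℝ := ∑' n : ℤ, (-1)^n * v^(n*n+b*n) * kc (v^5) 1 n

lemma KK2_val {Q : ℝ} (h0 : 0 < Q) (h1 : Q < 1) : 2 * KK (Q^5) (Q^2) = tt Q 5 * cB Q := by
  have := (KK_val h0 h1 2 (by norm_num) (by norm_num)).2
  norm_num at this
  have t2 := (tt_pos h0 h1 2 (by norm_num) (by norm_num)).ne'
  have t3 := (tt_pos h0 h1 3 (by norm_num) (by norm_num)).ne'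
  unfold cB
  field_simp
  linear_combination this

/-- class 2 -/
lemma cl2 {Q : ℝ} (h0 : 0 < Q) (h1 : Q < 1) :
    -2 * (GG (Q^5) Q⁻¹ (Q^2) + Q^2 * GG (Q^5) Q (Q^2)) = - 2 * tt Q 3 * cA1 Q + 2 * Q * tt Q 1 * cA3 Q := by
  have a := S2_val h0 h1
  have t1 := (tt_pos h0 h1 1 (by norm_num) (by norm_num)).ne'
  have t2 := (tt_pos h0 h1 2 (by norm_num) (by norm_num)).ne'
  have t3 := (tt_pos h0 h1 3 (by norm_num) (by norm_num)).ne'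
  have t4 := (tt_pos h0 h1 4 (by norm_num) (by norm_num)).ne'
  have t5 := (tt_pos h0 h1 5 (by norm_num) (by norm_num)).ne'
  have hT := (TT_pos h0 h1).ne'
  have hH := (hh_pos h0 h1).ne'
  have e1 := (KK_val h0 h1 1 (by norm_num) (by norm_num)).1
  have e2 := (KK_val h0 h1 2 (by norm_num) (by norm_num)).1
  norm_num at e1 e2
  rw [← eq_div_iff hT] at e1 e2
  have k2 := KK2_val h0 h1
  rw [e1, e2] at a
  have k2' : KK (Q^5) (Q^2) = tt Q 5 * cB Q / 2 := by linarith
  rw [k2'] at a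
  have w := tt_WA h0 h1
  have hA1 : cA1 Q = (2 * Q * GG (Q^5) 1 (Q^2) + tt Q 3 * cB Q) / tt Q 5 := rfl
  generalize GG (Q^5) 1 (Q^2) = f2 at *
  have a' : GG (Q^5) Q⁻¹ (Q^2) + Q^2 * GG (Q^5) Q (Q^2)
      = (2 * Q * tt Q 3 * f2 + tt Q 3 * tt Q 1 * tt Q 4 / (tt Q 2 * tt Q 3) * tt Q 5 * cB Q) / tt Q 5 := by
    rw [eq_div_iff t5]
    have hne : tt Q 2 * tt Q 3 * hh Q / TT Q ≠ 0 := by positivity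
    apply mul_left_cancel₀ hne
    rw [show tt Q 2 * tt Q 3 * hh Q / TT Q * ((GG (Q^5) Q⁻¹ (Q^2) + Q^2 * GG (Q^5) Q (Q^2)) * tt Q 5) =
      tt Q 5 * (tt Q 2 * tt Q 3 * hh Q / TT Q) * (GG (Q^5) Q⁻¹ (Q^2) + Q^2 * GG (Q^5) Q (Q^2)) by ring, a]
    field_simp
  rw [a', hA1]
  unfold cB cA3
  generalize tt Q 1 = x1 at *
  generalize tt Q 2 = x2 at *
  generalize tt Q 3 = x3 at *
  generalize tt Q 4 = x4 at *
  generalize tt Q 5 = x5 at *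
  field_simp
  linear_combination (-x5 * TT Q^3) * w

/-- class 3 -/
lemma cl3 {Q : ℝ} (h0 : 0 < Q) (h1 : Q < 1) :
    Q^5 * GG (Q^5) (Q^3) Q - Q^3 * GG (Q^5) (Q^2) Q = tt Q 5 * cA3 Q + 2 * Q * tt Q 1 * cA4 Q := by
  have a := S3_val h0 h1
  have t1 := (tt_pos h0 h1 1 (by norm_num) (by norm_num)).ne'
  have t2 := (tt_pos h0 h1 2 (by norm_num) (by norm_num)).ne'
  have t3 := (tt_pos h0 h1 3 (by norm_num) (by norm_num)).ne'
  have t4 := (tt_pos h0 h1 4 (by norm_num) (by norm_num)).ne'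
  have t5 := (tt_pos h0 h1 5 (by norm_num) (by norm_num)).ne'
  have hT := (TT_pos h0 h1).ne'
  have hH := (hh_pos h0 h1).ne'
  have e1 := (KK_val h0 h1 1 (by norm_num) (by norm_num)).1
  have e2 := (KK_val h0 h1 2 (by norm_num) (by norm_num)).1
  have k1 := (KK_val h0 h1 1 (by norm_num) (by norm_num)).2
  norm_num at e1 e2 k1
  rw [← eq_div_iff hT] at e1 e2
  have r1 := tt_r1 h0 h1
  have r2 := tt_r2 h0 h1
  have r3 := tt_r3 h0 h1
  have k1' : KK (Q^5) Q = tt Q 2 * tt Q 5^2 * TT Q^3 / (2 * (tt Q 1 * tt Q 4)^2) := by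
    rw [eq_div_iff (by positivity)]; linear_combination k1
  rw [e1, e2, k1'] at a
  have hA4 : cA4 Q = (- GG (Q^5) 1 Q + 2 * tt Q 3 * cA3 Q - tt Q 1 * cB Q) / tt Q 5 := rfl
  rw [hA4]
  clear hA4
  generalize GG (Q^5) 1 Q = f1 at *
  generalize (Q^5 * GG (Q^5) (Q^3) Q - Q^3 * GG (Q^5) (Q^2) Q) = L at *
  unfold cB cA3
  generalize tt Q 1 = x1 at *
  generalize tt Q 2 = x2 at *
  generalize tt Q 3 = x3 at *
  generalize tt Q 4 = x4 at *
  generalize tt Q 5 = x5 at *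
  generalize hh Q = H at *
  generalize TT Q = T at *
  have hL : L = 2 * x1 * (x2*x3/(x1*x4) * (x2*x5^2*T^3/(2*(x1*x4)^2)) - Q * f1) / x5 := by
    rw [eq_div_iff t5]
    have hne : x1*x4*H/T ≠ 0 := by positivity
    apply mul_left_cancel₀ hne
    rw [show x1*x4*H/T*(L*x5) = x5*(x1*x4*H/T)*L by ring, a]
    field_simp
  rw [hL]
  field_simp
  ring_nf
  linear_combination (-T^3) * ((-2*x1*x4^4+x2^2*x4^2*x5)*r1+(2*x1*x3^2*x4^2-x1*x2*x4*x5^2+x2^2*x3^2*x5)*r2+(2*x1*x2*x4^3-x2^3*x4*x5)*r3)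

/-- class 0 -/
lemma cl0 {Q : ℝ} (h0 : 0 < Q) (h1 : Q < 1) :
    (1 - tt Q 5)/2 + 2 * YY (Q^5) (Q^2) + YY (Q^5) Q
      = tt Q 5 * ((cB Q - 1)/2) + 2 * Q * tt Q 1 * cA1 Q - 2 * Q * tt Q 3 * cA4 Q := by
  have q0 := pow_pos h0 5
  have lt : ∀ a b : ℕ, a < b → Q^b < Q^a := fun a b h => pow_lt_pow_right_of_lt_one₀ h0 h1 h
  have t1 := (tt_pos h0 h1 1 (by norm_num) (by norm_num)).ne'
  have t2 := (tt_pos h0 h1 2 (by norm_num) (by norm_num)).ne'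
  have t3 := (tt_pos h0 h1 3 (by norm_num) (by norm_num)).ne'
  have t4 := (tt_pos h0 h1 4 (by norm_num) (by norm_num)).ne'
  have t5 := (tt_pos h0 h1 5 (by norm_num) (by norm_num)).ne'
  have hp : th (Q^5) (Q^5) ≠ 0 := t5
  have y1 := YY_val q0 (t := Q) (by simpa using lt 1 5 (by norm_num)) h1
    (by simpa [← pow_two] using lt 2 5 (by norm_num)) hp
    (by simpa using (thr_pos h0 h1 1 (by norm_num) (by norm_num)).ne')
  have y2 := YY_val q0 (t := Q^2) (lt 2 5 (by norm_num)) (pw_lt h0 h1 (by norm_num))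
    (by rw [← pow_add]; exact lt 4 5 (by norm_num)) hp
    (thr_pos h0 h1 2 (by norm_num) (by norm_num)).ne'
  have b1 : th (Q^5) (Q^5*Q^2) = tt Q 3 := by
    rw [← tt_symm h0 h1 7 3 (by norm_num), tt, ← pow_add]
  have b2 : th (Q^5) (Q^5*(Q^2)^2) = tt Q 1 := by
    rw [← tt_symm h0 h1 9 1 (by norm_num), tt, ← pow_mul, ← pow_add]
  have hp' : th (Q^5) (Q^5) = tt Q 5 := rfl
  have k4 : KK (Q^5) (Q^2*Q^2) = KK (Q^5) Q := by
    rw [← KK_symm q0 (z := Q)]; congr 1; field_simp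
  rw [b1, hp', show Q*Q = Q^2 by ring] at y1
  rw [b2, hp', k4] at y2
  have lam := lambert h0 h1
  have k2 := KK2_val h0 h1
  have w := tt_WA h0 h1
  have key : 4 * Q * tt Q 3 * (tt Q 1 * cB Q - tt Q 3 * cA3 Q) * tt Q 4 = -4 * Q^2 * tt Q 1 * TT Q^3 := by
    unfold cB cA3
    generalize tt Q 1 = x1 at *
    generalize tt Q 2 = x2 at *
    generalize tt Q 3 = x3 at *
    generalize tt Q 4 = x4 at *
    generalize tt Q 5 = x5 at *
    field_simp
    linear_combination TT Q^3 * w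
  have e1 : tt Q 5 * cA1 Q = 2 * Q * GG (Q^5) 1 (Q^2) + tt Q 3 * cB Q := by unfold cA1; field_simp
  have e4 : tt Q 5 * cA4 Q = - GG (Q^5) 1 Q + 2 * tt Q 3 * cA3 Q - tt Q 1 * cB Q := by
    unfold cA4; field_simp
  have l5 : (2 * KK (Q^5) Q - 1 - 2 * LL (Q^5) Q - 4 * LL (Q^5) (Q^2)) * tt Q 5
      = 4 * Q * tt Q 3 * (tt Q 1 * cB Q - tt Q 3 * cA3 Q) := by
    apply mul_left_cancel₀ t4
    linear_combination lam - key
  apply mul_left_cancel₀ t5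
  linear_combination 2 * y2 + y1 - 2*Q*tt Q 1*e1 + 2*Q*tt Q 3 * e4 + l5 + tt Q 5 / 2 * k2


lemma kc1_bd {q : ℝ} (q0 : 0 < q) (q1 : q < 1) (k : ℤ) : |kc q 1 k| ≤ (1-q)⁻¹ := by
  rcases le_or_gt 0 k with h | h
  · exact kc1_b1 q0 q1 k h
  · refine (kc1_b2 q0 q1 k h.le).trans ?_
    have : 0 < (1-q)⁻¹ := inv_pos.2 (by linarith)
    exact mul_le_of_le_one_right this.le (zpow_le_one₀ q0 q1.le (by omega))

lemma phi_sum {v : ℝ} (v0 : 0 < v) (v1 : v < 1) (b : ℤ) :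
    Summable fun n : ℤ => (-1:ℝ)^n * v^(n*n+b*n) := by
  refine (gsq v0 v1 (-1) (by norm_num) 1 b 0 one_pos).congr fun n => ?_
  rw [mul_comm]; congr 2; ring

lemma UU_sum {v : ℝ} (v0 : 0 < v) (v1 : v < 1) (b : ℤ) :
    Summable fun n : ℤ => (-1:ℝ)^n * v^(n*n+b*n) * kc (v^5) 1 n := by
  refine ((phi_sum v0 v1 b).norm.mul_right (1-v^5)⁻¹).of_norm_bounded fun n => ?_
  rw [norm_mul]
  exact mul_le_mul_of_nonneg_left (kc1_bd (pow_pos v0 5) (pw_lt v0 v1 (by norm_num)) n) (norm_nonneg _)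

lemma neg_one_5 (j i : ℤ) : (-1:ℝ)^(5*j+i) = (-1)^i * (-1)^j := by
  rw [zpow_add₀ (by norm_num), zpow_mul]; norm_num; ring

lemma UU_class {v : ℝ} (v0 : 0 < v) (b : ℤ) (i : ℕ) (c : ℤ) (z : ℝ)
    (hc : 2*c = 2*i+b-5) (hz : z * (v^5)^c = (v^5)^i) :
    ∑' j : ℤ, (-1:ℝ)^(((5:ℕ):ℤ)*j+(i:ℤ)) * v^((((5:ℕ):ℤ)*j+(i:ℤ))*(((5:ℕ):ℤ)*j+(i:ℤ))+b*(((5:ℕ):ℤ)*j+(i:ℤ))) * kc (v^5) 1 (((5:ℕ):ℤ)*j+(i:ℤ))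
      = (-1)^i * v^((i:ℤ)*i+b*i) * GG ((v^5)^5) ((v^5)^c) z := by
  unfold GG
  rw [← tsum_mul_left]
  congr 1; ext j
  push_cast
  have e1 : kc (v^5) 1 (5*j+i) = kc ((v^5)^5) (z*(v^5)^c) j := by
    unfold kc
    rw [hz, one_mul, zpow_add₀ (pow_pos v0 5).ne', zpow_mul, zpow_natCast]
    norm_cast
    rw [mul_comm]
  rw [e1, neg_one_5]
  unfold ga
  have e2 : v^((5*j+i)*(5*j+i)+b*(5*j+i)) = v^((i:ℤ)*i+b*i) * (((v^5)^5)^(j*j+j) * ((v^5)^c)^(2*j)) := by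
    rw [← pow_mul, ← zpow_natCast, ← zpow_natCast, ← zpow_mul, ← zpow_mul, ← zpow_mul,
      ← zpow_add₀ v0.ne', ← zpow_add₀ v0.ne']
    congr 1
    push_cast
    linear_combination (-5*j) * hc
  rw [e2, zpow_natCast]; ring

lemma UU1 {v : ℝ} (v0 : 0 < v) (v1 : v < 1) : UU v 1 =
    YY ((v^5)^5) ((v^5)^2) - v^2 * (GG ((v^5)^5) (v^5)⁻¹ ((v^5)^2) + (v^5)^2 * GG ((v^5)^5) (v^5) ((v^5)^2))
     + v * v^5 * GG ((v^5)^5) 1 ((v^5)^2) := by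
  have h := (tsum_mod 5 (UU_sum v0 v1 1)).2
  have Q0 := pow_pos v0 5
  unfold UU
  rw [h]
  have c0 := UU_class v0 1 0 (-2) ((v^5)^2) (by norm_num) (by norm_cast; rw [zpow_negSucc]; field_simp; ring)
  have c1 := UU_class v0 1 1 (-1) ((v^5)^2) (by norm_num) (by rw [zpow_neg_one]; field_simp)
  have c2 := UU_class v0 1 2 0 ((v^5)^2) (by norm_num) (by simp)
  have c3 := UU_class v0 1 3 1 ((v^5)^2) (by norm_num) (by rw [zpow_one]; ring)
  have c4 := UU_class v0 1 4 2 ((v^5)^2) (by norm_num) (by norm_cast; ring)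
  simp only [Fin.sum_univ_succ, Fin.sum_univ_zero, Fin.succ]
  norm_num at c0 c1 c2 c3 c4 ⊢
  rw [c0, c1, c2, c3, c4]
  unfold YY
  norm_cast
  ring

lemma UU3 {v : ℝ} (v0 : 0 < v) (v1 : v < 1) : UU v 3 =
    YY ((v^5)^5) (v^5) - v^4 * GG ((v^5)^5) 1 (v^5)
     + v^3 * ((v^5)^5 * GG ((v^5)^5) ((v^5)^3) (v^5) - (v^5)^3 * GG ((v^5)^5) ((v^5)^2) (v^5)) := by
  have h := (tsum_mod 5 (UU_sum v0 v1 3)).2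
  have Q0 := pow_pos v0 5
  unfold UU
  rw [h]
  have c0 := UU_class v0 3 0 (-1) (v^5) (by norm_num) (by rw [zpow_neg_one]; field_simp)
  have c1 := UU_class v0 3 1 0 (v^5) (by norm_num) (by simp)
  have c2 := UU_class v0 3 2 1 (v^5) (by norm_num) (by rw [zpow_one]; ring)
  have c3 := UU_class v0 3 3 2 (v^5) (by norm_num) (by norm_cast; ring)
  have c4 := UU_class v0 3 4 3 (v^5) (by norm_num) (by norm_cast; ring)
  simp only [Fin.sum_univ_succ, Fin.sum_univ_zero, Fin.succ]
  norm_num at c0 c1 c2 c3 c4 ⊢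
  rw [c0, c1, c2, c3, c4]
  unfold YY
  norm_cast
  ring

lemma phi_class {v : ℝ} (v0 : 0 < v) (i : ℕ) :
    ∑' j : ℤ, (-1:ℝ)^(((5:ℕ):ℤ)*j+(i:ℤ)) * v^((((5:ℕ):ℤ)*j+(i:ℤ))*(((5:ℕ):ℤ)*j+(i:ℤ)))
      = (-1)^i * v^(i*i) * tt (v^5) (5+2*i) := by
  unfold tt th
  rw [← tsum_mul_left]
  congr 1; ext j
  push_cast
  rw [neg_one_5]
  unfold thc
  have e2 : v^((5*j+i)*(5*j+i)) = v^(i*i) * (((v^5)^5)^(j*j-j) * ((v^5)^(5+2*i))^j) := by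
    rw [← pow_mul, ← pow_mul, ← zpow_natCast, ← zpow_natCast, ← zpow_natCast, ← zpow_mul, ← zpow_mul,
      ← zpow_add₀ v0.ne', ← zpow_add₀ v0.ne']
    congr 1
    push_cast
    ring
  rw [e2, zpow_natCast]; ring

lemma tt_over {Q : ℝ} (h0 : 0 < Q) (h1 : Q < 1) (k : ℕ) : Q^k * tt Q (10+k) = - tt Q k := by
  unfold tt
  have q0 := pow_pos h0 5
  have q1 := Q5_lt h0 h1
  have : Q^(10+k) = (Q^5)^2/(Q^k)⁻¹ := by field_simp; ring
  rw [this, th_inv_symm q0 q1 (inv_pos.2 (pow_pos h0 k)).ne', th_inv q0 q1 (pow_pos h0 k).ne']; field_simp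

lemma phi_dis {v : ℝ} (v0 : 0 < v) (v1 : v < 1) :
    phi v = tt (v^5) 5 - 2 * v * tt (v^5) 3 + 2 * v^4 * tt (v^5) 1 := by
  have Q0 := pow_pos v0 5
  have Q1 := pw_lt v0 v1 (n := 5) (by norm_num)
  have h := (tsum_mod 5 ((phi_sum v0 v1 0).congr (g := fun n : ℤ => (-1:ℝ)^n * v^(n*n)) (fun n => by ring_nf))).2
  unfold phi
  rw [h]
  have c0 := phi_class v0 0
  have c1 := phi_class v0 1
  have c2 := phi_class v0 2
  have c3 := phi_class v0 3
  have c4 := phi_class v0 4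
  simp only [Fin.sum_univ_succ, Fin.sum_univ_zero, Fin.succ]
  norm_num at c0 c1 c2 c3 c4 ⊢
  rw [c0, c1, c2, c3, c4]
  have s7 := tt_symm Q0 Q1 7 3 (by norm_num)
  have s9 := tt_symm Q0 Q1 9 1 (by norm_num)
  have o1 := tt_over Q0 Q1 1
  have o3 := tt_over Q0 Q1 3
  norm_num at o1 o3
  linear_combination (-v) * s7 + v^4 * s9 - v^4 * o1 + v * o3

/-- T2 -/
theorem T2 {v : ℝ} (v0 : 0 < v) (v1 : v < 1) :
    (cB (v^5) + 2 * v * cA1 (v^5) + 2 * v^3 * cA3 (v^5) + 2 * v^4 * cA4 (v^5)) * phi v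
      = 1 + 4 * UU v 1 + 2 * UU v 3 := by
  have Q0 := pow_pos v0 5
  have Q1 := pw_lt v0 v1 (n := 5) (by norm_num)
  have t5 := (tt_pos Q0 Q1 5 (by norm_num) (by norm_num)).ne'
  rw [UU1 v0 v1, UU3 v0 v1, phi_dis v0 v1]
  have a0 := cl0 Q0 Q1
  have a2 := cl2 Q0 Q1
  have a3 := cl3 Q0 Q1
  have e1 : tt (v^5) 5 * cA1 (v^5) = 2 * v^5 * GG ((v^5)^5) 1 ((v^5)^2) + tt (v^5) 3 * cB (v^5) := by unfold cA1; field_simp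
  have e4 : tt (v^5) 5 * cA4 (v^5) = - GG ((v^5)^5) 1 (v^5) + 2 * tt (v^5) 3 * cA3 (v^5) - tt (v^5) 1 * cB (v^5) := by
    unfold cA4; field_simp
  linear_combination (-2) * a0 - 2 * v^2 * a2 - 2 * v^3 * a3 + 2 * v * e1 + 2 * v^4 * e4


/-- F has a power series with nonnegative coefficients on (0,1). -/
def PN (F : ℝ → ℝ) : Prop :=
  ∃ c : ℕ → ℝ, (∀ n, 0 ≤ c n) ∧ ∀ Q : ℝ, 0 < Q → Q < 1 → HasSum (fun n => c n * Q^n) (F Q)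

/-- F has nonnegative coefficients, and a positive one at exponent m. -/
def At (F : ℝ → ℝ) (m : ℕ) : Prop := ∃ e : ℝ, 0 < e ∧ PN (fun Q => F Q - e * Q^m)

lemma PN.congr {F G : ℝ → ℝ} (h : PN F) (e : ∀ Q, 0 < Q → Q < 1 → G Q = F Q) : PN G := by
  obtain ⟨c, c0, hc⟩ := h
  exact ⟨c, c0, fun Q h0 h1 => by rw [e Q h0 h1]; exact hc Q h0 h1⟩

lemma PN.nonneg {F : ℝ → ℝ} (h : PN F) {Q : ℝ} (h0 : 0 < Q) (h1 : Q < 1) : 0 ≤ F Q := by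
  obtain ⟨c, c0, hc⟩ := h
  exact (hc Q h0 h1).nonneg fun n => mul_nonneg (c0 n) (pow_pos h0 n).le

lemma PN_mon {a : ℝ} (ha : 0 ≤ a) (m : ℕ) : PN (fun Q => a * Q^m) := by
  refine ⟨fun n => if n = m then a else 0, fun n => by dsimp only; split_ifs <;> simp [ha], fun Q h0 h1 => ?_⟩
  have := hasSum_ite_eq m (a * Q^m)
  refine this.cg (fun n => ?_) rfl
  by_cases h : n = m
  · simp [h]
  · simp [h]

lemma PN_const {a : ℝ} (ha : 0 ≤ a) : PN (fun _ => a) := (PN_mon ha 0).congr (by simp)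
lemma PN_pow (m : ℕ) : PN (fun Q => Q^m) := (PN_mon zero_le_one m).congr (by simp)

lemma PN.add {F G : ℝ → ℝ} (hF : PN F) (hG : PN G) : PN (fun Q => F Q + G Q) := by
  obtain ⟨c, c0, hc⟩ := hF
  obtain ⟨d, d0, hd⟩ := hG
  refine ⟨fun n => c n + d n, fun n => add_nonneg (c0 n) (d0 n), fun Q h0 h1 => ?_⟩
  exact ((hc Q h0 h1).add (hd Q h0 h1)).cg (fun n => by ring) rfl

lemma PN.mul {F G : ℝ → ℝ} (hF : PN F) (hG : PN G) : PN (fun Q => F Q * G Q) := by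
  obtain ⟨c, c0, hc⟩ := hF
  obtain ⟨d, d0, hd⟩ := hG
  refine ⟨fun n => ∑ kl ∈ Finset.HasAntidiagonal.antidiagonal n, c kl.1 * d kl.2,
    fun n => Finset.sum_nonneg fun kl _ => mul_nonneg (c0 _) (d0 _), fun Q h0 h1 => ?_⟩
  have hc := hc Q h0 h1
  have hd := hd Q h0 h1
  have sc : Summable fun n => ‖c n * Q^n‖ := hc.summable.norm
  have sd : Summable fun n => ‖d n * Q^n‖ := hd.summable.norm
  have e := tsum_mul_tsum_eq_tsum_sum_antidiagonal_of_summable_norm sc sd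
  have s := (summable_norm_sum_mul_antidiagonal_of_summable_norm sc sd).of_norm.hasSum
  rw [← e, hc.tsum_eq, hd.tsum_eq] at s
  refine s.cg (fun n => ?_) rfl
  rw [Finset.sum_mul]
  refine Finset.sum_congr rfl fun kl hkl => ?_
  rw [← Finset.HasAntidiagonal.mem_antidiagonal.1 hkl, pow_add]; ring

lemma PN_sum {ι : Type*} {f : ι → ℝ → ℝ} {F : ℝ → ℝ} (h : ∀ i, PN (f i))
    (hs : ∀ Q : ℝ, 0 < Q → Q < 1 → HasSum (fun i => f i Q) (F Q)) : PN F := by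
  choose c c0 hc using h
  refine ⟨fun n => ∑' i, c i n, fun n => tsum_nonneg fun i => c0 i n, fun Q h0 h1 => ?_⟩
  have nn : 0 ≤ fun p : ι × ℕ => c p.1 p.2 * Q^p.2 := fun p => mul_nonneg (c0 _ _) (pow_pos h0 _).le
  have S : Summable fun p : ι × ℕ => c p.1 p.2 * Q^p.2 := by
    rw [summable_prod_of_nonneg nn]
    refine ⟨fun i => (hc i Q h0 h1).summable, ?_⟩
    have : (fun i => ∑' n, c i n * Q^n) = fun i => f i Q := funext fun i => (hc i Q h0 h1).tsum_eq
    simp only [this]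
    exact (hs Q h0 h1).summable
  have e1 : ∑' p : ι × ℕ, c p.1 p.2 * Q^p.2 = F Q :=
    (S.hasSum.prod_fiberwise (fun i => hc i Q h0 h1)).unique (hs Q h0 h1)
  have S2 : HasSum (fun p : ℕ × ι => c p.2 p.1 * Q^p.1) (F Q) := by
    rw [← e1]
    exact (Equiv.prodComm ℕ ι).hasSum_iff (f := fun p : ι × ℕ => c p.1 p.2 * Q^p.2) |>.2 S.hasSum
  have := S2.prod_fiberwise (fun n => (S2.summable.prod_factor n).hasSum)
  refine this.cg (fun n => ?_) rfl
  dsimp only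
  rw [tsum_mul_right]

lemma PN.of_sub {F G : ℝ → ℝ} (h : PN (fun Q => F Q - G Q)) (hG : PN G) : PN F :=
  (h.add hG).congr fun Q _ _ => by ring

lemma At.nn {F : ℝ → ℝ} {m : ℕ} (h : At F m) : PN F := by
  obtain ⟨e, e0, h⟩ := h
  exact h.of_sub (PN_mon e0.le m)

lemma At.of_sub {F G : ℝ → ℝ} {m : ℕ} (h : PN (fun Q => F Q - G Q)) (hG : At G m) : At F m := by
  obtain ⟨e, e0, hG⟩ := hG
  exact ⟨e, e0, (h.add hG).congr fun Q _ _ => by ring⟩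

lemma At.congr {F G : ℝ → ℝ} {m : ℕ} (h : At F m) (e : ∀ Q, 0 < Q → Q < 1 → G Q = F Q) : At G m := by
  obtain ⟨d, d0, h⟩ := h
  exact ⟨d, d0, h.congr fun Q h0 h1 => by rw [e Q h0 h1]⟩

lemma At.add {F G : ℝ → ℝ} {m : ℕ} (h : At F m) (hG : PN G) : At (fun Q => F Q + G Q) m :=
  h.of_sub (hG.congr fun Q _ _ => by ring)

lemma At.mul {F G : ℝ → ℝ} {m k : ℕ} (h : At F m) (hG : At G k) : At (fun Q => F Q * G Q) (m+k) := by
  obtain ⟨d, d0, h⟩ := h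
  have gn := hG.nn
  obtain ⟨e, e0, hG⟩ := hG
  refine ⟨d*e, mul_pos d0 e0, ((h.mul gn).add ((PN_mon d0.le m).mul hG)).congr fun Q _ _ => ?_⟩
  ring

lemma At_mon {a : ℝ} (ha : 0 < a) (m : ℕ) : At (fun Q => a * Q^m) m :=
  ⟨a, ha, (PN_const le_rfl).congr (by simp)⟩

lemma At_pow (m : ℕ) : At (fun Q => Q^m) m := (At_mon one_pos m).congr (by simp)

lemma At_const {a : ℝ} (ha : 0 < a) : At (fun _ => a) 0 := (At_mon ha 0).congr (by simp)

lemma At_sum {ι : Type*} {f : ι → ℝ → ℝ} {F : ℝ → ℝ} {m : ℕ} (h : ∀ i, PN (f i))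
    (hs : ∀ Q : ℝ, 0 < Q → Q < 1 → HasSum (fun i => f i Q) (F Q)) (i : ι) (hi : At (f i) m) : At F m := by
  classical
  refine At.of_sub (PN_sum (f := fun j Q => if j = i then 0 else f j Q) (fun j => ?_) fun Q h0 h1 => ?_) hi
  · by_cases hj : j = i
    · simp only [hj, if_true]; exact PN_const le_rfl
    · simp only [hj, if_false]; exact h j
  · exact hasSum_ite_sub_hasSum (hs Q h0 h1) i

lemma PN_geo {n : ℕ} (hn : n ≠ 0) : PN (fun Q => (1 - Q^n)⁻¹) := by
  refine PN_sum (f := fun k Q => Q^(n*k)) (fun k => PN_pow _) fun Q h0 h1 => ?_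
  exact (hasSum_geometric_of_lt_one (pow_pos h0 n).le (pw_lt h0 h1 hn)).cg (fun k => by rw [pow_mul]) rfl

lemma At_geo {n : ℕ} (hn : n ≠ 0) (j : ℕ) : At (fun Q => (1 - Q^n)⁻¹) (n*j) := by
  refine At_sum (f := fun k Q => Q^(n*k)) (fun k => PN_pow _) (fun Q h0 h1 => ?_) j (At_pow _)
  exact (hasSum_geometric_of_lt_one (pow_pos h0 n).le (pw_lt h0 h1 hn)).cg (fun k => by rw [pow_mul]) rfl

lemma PN_fprod {g : ℕ → ℝ → ℝ} (hg : ∀ i, PN (g i)) (N : ℕ) : PN (fun Q => ∏ i ∈ Finset.range N, (1 + g i Q)) := by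
  induction N with
  | zero => simpa using PN_const zero_le_one
  | succ N ih =>
    refine (ih.mul ((PN_const zero_le_one).add (hg N))).congr fun Q _ _ => ?_
    rw [Finset.prod_range_succ]

/-- infinite products -/
lemma PN_prod {g : ℕ → ℝ → ℝ} {F : ℝ → ℝ} (hg : ∀ i, PN (g i))
    (ht : ∀ Q : ℝ, 0 < Q → Q < 1 → Tendsto (fun N => ∏ i ∈ Finset.range N, (1 + g i Q)) atTop (𝓝 (F Q))) :
    PN (fun Q => F Q - (1 + g 0 Q)) := by
  refine PN_sum (f := fun N Q => (∏ i ∈ Finset.range (N+1), (1 + g i Q)) * g (N+1) Q)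
    (fun N => (PN_fprod hg _).mul (hg _)) fun Q h0 h1 => ?_
  rw [hasSum_iff_tendsto_nat_of_nonneg (fun N => ((PN_fprod hg _).mul (hg _)).nonneg h0 h1)]
  have := ((ht Q h0 h1).comp (tendsto_add_atTop_nat 1)).sub_const (1 + g 0 Q)
  refine this.congr fun N => ?_
  induction N with
  | zero => simp
  | succ N ih =>
    rw [Finset.sum_range_succ, ← ih]
    simp only [Function.comp]
    rw [Finset.prod_range_succ _ (N+1)]
    ring


lemma one_sub_ne {Q : ℝ} (h0 : 0 < Q) (h1 : Q < 1) {n : ℕ} (hn : n ≠ 0) : 1 - Q^n ≠ 0 :=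
  (sub_pos.2 (pw_lt h0 h1 hn)).ne'

lemma Pinv_sub {a b : ℕ} (ha : a ≠ 0) (hb : b ≠ 0) :
    PN (fun Q => (Pq (Q^a) (Q^b))⁻¹ - (1 - Q^a)⁻¹) := by
  have hn : ∀ i : ℕ, a + b*i ≠ 0 := fun i => by omega
  have := PN_prod (g := fun i Q => Q^(a+b*i) * (1 - Q^(a+b*i))⁻¹)
    (F := fun Q => (Pq (Q^a) (Q^b))⁻¹) (fun i => (PN_pow _).mul (PN_geo (hn i))) (fun Q h0 h1 => ?_)
  · refine this.congr fun Q h0 h1 => ?_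
    have := one_sub_ne h0 h1 ha
    simp only [mul_zero, add_zero]
    congr 1
    field_simp
    ring
  · have q0 := pow_pos h0 b
    have q1 := pw_lt h0 h1 hb
    have := (Pq_tendsto q0 q1 (Q^a)).inv₀ (Pq_pos q0 q1 (pw_lt h0 h1 ha)).ne'
    refine this.congr fun N => ?_
    rw [← Finset.prod_inv_distrib]
    refine Finset.prod_congr rfl fun i _ => ?_
    have := one_sub_ne h0 h1 (hn i)
    rw [← pow_mul, ← pow_add]
    field_simp
    ring

lemma At_Pinv {a b : ℕ} (ha : a ≠ 0) (hb : b ≠ 0) (j : ℕ) : At (fun Q => (Pq (Q^a) (Q^b))⁻¹) (a*j) :=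
  (At_geo ha j).of_sub (Pinv_sub ha hb)

lemma At_Pinv0 {a b : ℕ} (ha : a ≠ 0) (hb : b ≠ 0) : At (fun Q => (Pq (Q^a) (Q^b))⁻¹) 0 :=
  At_Pinv ha hb 0

lemma Pm_sub (a : ℕ) {b : ℕ} (hb : b ≠ 0) :
    PN (fun Q => Pq (-Q^a) (Q^b) - (1 + Q^a)) := by
  have := PN_prod (g := fun i Q => Q^(a+b*i))
    (F := fun Q => Pq (-Q^a) (Q^b)) (fun i => PN_pow _) (fun Q h0 h1 => ?_)
  · exact this.congr fun Q h0 h1 => by simp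
  · have q0 := pow_pos h0 b
    have q1 := pw_lt h0 h1 hb
    refine (Pq_tendsto q0 q1 (-Q^a)).congr fun N => ?_
    refine Finset.prod_congr rfl fun i _ => ?_
    rw [pow_add, pow_mul]; ring

lemma At_Pm0 (a : ℕ) {b : ℕ} (hb : b ≠ 0) : At (fun Q => Pq (-Q^a) (Q^b)) 0 :=
  ((At_const one_pos).add (PN_pow a)).of_sub (Pm_sub a hb)

lemma At_Pm (a : ℕ) {b : ℕ} (hb : b ≠ 0) : At (fun Q => Pq (-Q^a) (Q^b)) a :=
  (((At_pow a).add (PN_const zero_le_one)).congr fun Q _ _ => by ring).of_sub (Pm_sub a hb)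

lemma At_R (d : ℕ) : ∀ a : ℕ, a ≠ 0 → At (fun Q => (1 - Q^(5*(a+d))) * (Pq (Q^(5*a)) (Q^5))⁻¹) 0 := by
  have key : ∀ (a : ℕ) (Q : ℝ), 0 < Q → Q < 1 →
      Pq (Q^(5*a)) (Q^5) = (1 - Q^(5*a)) * Pq (Q^(5*(a+1))) (Q^5) := fun a Q h0 h1 => by
    rw [Pq_succ (pow_pos h0 5) (Q5_lt h0 h1), ← pow_add]; rfl
  induction d with
  | zero =>
    intro a ha
    refine (At_Pinv0 (a := 5*(a+1)) (b := 5) (by omega) (by norm_num)).congr fun Q h0 h1 => ?_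
    rw [key a Q h0 h1, add_zero]
    have := one_sub_ne h0 h1 (n := 5*a) (by omega)
    rw [mul_inv, ← mul_assoc, mul_inv_cancel₀ this, one_mul]
  | succ d ih =>
    intro a ha
    refine ((At_geo (n := 5*a) (by omega) 0).mul (ih (a+1) (by omega))).congr fun Q h0 h1 => ?_
    rw [key a Q h0 h1, mul_inv, show a + 1 + d = a + (d+1) by ring]
    ring

lemma At_R' {n : ℕ} (hn : n ≠ 0) : At (fun Q => (1 - Q^(5*n)) * (Pq (Q^5) (Q^5))⁻¹) 0 := by
  have := At_R (n-1) 1 one_ne_zero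
  rwa [show 1 + (n-1) = n by omega] at this

lemma tt5inv {Q : ℝ} (h0 : 0 < Q) (h1 : Q < 1) :
    (tt Q 5)⁻¹ = Pq (-Q^5) (Q^5) * (Pq (Q^5) (Q^5))⁻¹ := by
  have := Pq_mq h0 h1
  rw [tt5_eq h0 h1, Pqq h0 h1]
  have hp := (hh_pos h0 h1).ne'
  have tp := (TT_pos h0 h1).ne'
  field_simp
  linarith

lemma At_c {n : ℕ} (hn : n ≠ 0) : At (fun Q => (tt Q 5)⁻¹ * (1 - Q^(5*n))) 0 :=
  ((At_Pm0 5 (b := 5) (by norm_num)).mul (At_R' hn)).congr fun Q h0 h1 => by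
    rw [tt5inv h0 h1]; ring

lemma At_c5 {n : ℕ} (hn : n ≠ 0) : At (fun Q => (tt Q 5)⁻¹ * (1 - Q^(5*n))) 5 :=
  ((At_Pm 5 (b := 5) (by norm_num)).mul (At_R' hn)).congr fun Q h0 h1 => by
    rw [tt5inv h0 h1]; ring

lemma At_d0 {n m : ℕ} (hn : n ≠ 0) (h : At (fun Q => (tt Q 5)⁻¹ * (1 - Q^(5*n))) m) :
    At (fun Q => (tt Q 5)⁻¹ * (1 + Q^(5*n))⁻¹) m := by
  refine (h.mul (At_geo (n := 2*(5*n)) (by omega) 0)).congr fun Q h0 h1 => ?_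
  have h2 := one_sub_ne h0 h1 (n := 5*n) (by omega)
  have h3 : 1 + Q^(5*n) ≠ 0 := (add_pos one_pos (pow_pos h0 _)).ne'
  have h4 : 1 - Q^(2*(5*n)) = (1 - Q^(5*n)) * (1 + Q^(5*n)) := by ring
  rw [h4]
  field_simp

lemma At_e0 : At (fun Q => (tt Q 5)⁻¹) 0 :=
  ((At_Pm0 5 (b := 5) (by norm_num)).mul (At_Pinv0 (a := 5) (b := 5) (by norm_num) (by norm_num))).congr
    fun Q h0 h1 => tt5inv h0 h1

lemma At_e5 : At (fun Q => (tt Q 5)⁻¹) 5 :=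
  ((At_Pm 5 (b := 5) (by norm_num)).mul (At_Pinv0 (a := 5) (b := 5) (by norm_num) (by norm_num))).congr
    fun Q h0 h1 => tt5inv h0 h1

/-- terms of cB -/
noncomputable def fB (k : ℤ) (Q : ℝ) : ℝ := 2 * (tt Q 5)⁻¹ * (kc (Q^5) (-1) k * (Q^2)^k)

lemma fB_pos (n : ℕ) {Q : ℝ} (_h0 : 0 < Q) :
    fB (n+1:ℕ) Q = 2 * Q^(2*(n+1)) * ((tt Q 5)⁻¹ * (1 + Q^(5*(n+1)))⁻¹) := by
  unfold fB kc
  rw [zpow_natCast, zpow_natCast, ← pow_mul, ← pow_mul, neg_one_mul, sub_neg_eq_add]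
  ring

lemma fB_neg (n : ℕ) {Q : ℝ} (h0 : 0 < Q) :
    fB (-(n+1:ℕ)) Q = 2 * Q^(3*(n+1)) * ((tt Q 5)⁻¹ * (1 + Q^(5*(n+1)))⁻¹) := by
  unfold fB kc
  rw [zpow_neg, zpow_neg, zpow_natCast, zpow_natCast, ← pow_mul, ← pow_mul, neg_one_mul, sub_neg_eq_add]
  have e : Q^(5*(n+1)) = Q^(2*(n+1)) * Q^(3*(n+1)) := by rw [← pow_add]; congr 1; ring
  rw [e]
  have hx := pow_pos h0 (2*(n+1))
  have hy := pow_pos h0 (3*(n+1))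
  generalize Q^(2*(n+1)) = x at *
  generalize Q^(3*(n+1)) = y at *
  have : 1 + x*y ≠ 0 := by positivity
  field_simp
  ring

lemma fB_zero {Q : ℝ} : fB 0 Q = (tt Q 5)⁻¹ := by
  unfold fB kc
  norm_num
  ring

lemma At_fB_pos (n : ℕ) {m : ℕ} (h : At (fun Q => (tt Q 5)⁻¹ * (1 - Q^(5*(n+1)))) m) :
    At (fB (n+1:ℕ)) (2*(n+1)+m) :=
  ((At_mon two_pos (2*(n+1))).mul (At_d0 (Nat.succ_ne_zero n) h)).congr fun _ h0 _ => fB_pos n h0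

lemma At_fB_neg (n : ℕ) {m : ℕ} (h : At (fun Q => (tt Q 5)⁻¹ * (1 - Q^(5*(n+1)))) m) :
    At (fB (-(n+1:ℕ))) (3*(n+1)+m) :=
  ((At_mon two_pos (3*(n+1))).mul (At_d0 (Nat.succ_ne_zero n) h)).congr fun _ h0 _ => fB_neg n h0

lemma fB_PN (k : ℤ) : PN (fB k) := by
  rcases lt_trichotomy k 0 with h | h | h
  · obtain ⟨n, rfl⟩ : ∃ n : ℕ, k = -(n+1:ℕ) := ⟨(-k-1).toNat, by omega⟩
    exact (At_fB_neg n (At_c (Nat.succ_ne_zero n))).nn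
  · subst h
    exact At_e0.nn.congr fun Q _ _ => fB_zero
  · obtain ⟨n, rfl⟩ : ∃ n : ℕ, k = (n+1:ℕ) := ⟨(k-1).toNat, by omega⟩
    exact (At_fB_pos n (At_c (Nat.succ_ne_zero n))).nn

lemma fB_hasSum {Q : ℝ} (h0 : 0 < Q) (h1 : Q < 1) : HasSum (fun k => fB k Q) (cB Q) := by
  have h := KK_hasSum (pow_pos h0 5) (z := Q^2) (pow_lt_pow_right_of_lt_one₀ h0 h1 (by norm_num))
    (pw_lt h0 h1 (by norm_num))
  refine (h.mul_left (2 * (tt Q 5)⁻¹)).cg (fun k => rfl) ?_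
  have t := (tt_pos h0 h1 5 (by norm_num) (by norm_num)).ne'
  have e := KK2_val h0 h1
  field_simp
  linarith

lemma At_cB {m : ℕ} (hm : m ≠ 1) : At cB m := by
  have F : ∀ i, At (fB i) m → At cB m := fun i hi => At_sum fB_PN (fun Q h0 h1 => fB_hasSum h0 h1) i hi
  by_cases m0 : m = 0
  · subst m0; exact F 0 (At_e0.congr fun Q _ _ => fB_zero)
  by_cases m3 : m = 3
  · subst m3; exact F _ (At_fB_neg 0 (At_c one_ne_zero))
  by_cases m5 : m = 5
  · subst m5; exact F 0 (At_e5.congr fun Q _ _ => fB_zero)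
  rcases Nat.even_or_odd' m with ⟨k, rfl | rfl⟩
  · obtain ⟨n, rfl⟩ : ∃ n, k = n + 1 := ⟨k-1, by omega⟩
    exact F _ (At_fB_pos n (At_c (Nat.succ_ne_zero n)))
  · obtain ⟨n, rfl⟩ : ∃ n, k = n + 3 := ⟨k-3, by omega⟩
    have := F _ (by
      have := At_fB_pos n (At_c5 (Nat.succ_ne_zero n))
      rwa [show 2*(n+1)+5 = 2*(n+3)+1 by ring] at this)
    exact this


lemma pair_sum {f : ℕ → ℝ} {a : ℝ} (h : HasSum f a) (hn : ∀ j, 0 ≤ f (2*j) + f (2*j+1)) :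
    HasSum (fun j => f (2*j) + f (2*j+1)) a := by
  rw [hasSum_iff_tendsto_nat_of_nonneg hn]
  have := h.tendsto_sum_nat.comp (tendsto_id.const_mul_atTop' (show 0 < 2 by norm_num))
  refine this.congr fun N => ?_
  simp only [Function.comp, id]
  induction N with
  | zero => simp
  | succ N ih => rw [Finset.sum_range_succ, ← ih, Nat.mul_succ, Finset.sum_range_succ, Finset.sum_range_succ]; ring

lemma gam_pos {q : ℝ} (q0 : 0 < q) (q1 : q < 1) (k : ℕ) :
    HasSum (fun j : ℕ => q^(4*j*j+2*j+2*j*k) * (1 - q^(4*j+2+k))) (gam q 1 k) := by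
  have h := (sgsn_sum q0 q1 one_pos (k:ℤ)).hasSum
  have h2 : HasSum (fun n : ℕ => (-1:ℝ)^n * q^(n*n+n+n*k)) (gam q 1 k) := by
    unfold gam
    rw [← (Nat.cast_injective (R := ℤ)).hasSum_iff] at h
    · refine h.cg (fun n => ?_) rfl
      simp only [Function.comp, sg, sn]
      rw [if_pos (by omega), if_neg (by omega), one_zpow, zpow_natCast]
      norm_cast
      simp
    · intro n hn
      have : ¬ (0 ≤ n) := fun h => hn ⟨n.toNat, by simp [h]⟩
      simp [sg, this]
  have key : ∀ j : ℕ, q^(4*j*j+2*j+2*j*k) * (1 - q^(4*j+2+k)) =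
      (-1:ℝ)^(2*j) * q^((2*j)*(2*j)+2*j+2*j*k) + (-1:ℝ)^(2*j+1) * q^((2*j+1)*(2*j+1)+(2*j+1)+(2*j+1)*k) := by
    intro j
    rw [pow_succ, pow_mul]
    norm_num
    ring
  refine (pair_sum h2 fun j => ?_).cg key rfl
  rw [← key]
  exact mul_nonneg (pow_pos q0 _).le (sub_pos.2 (pow_lt_one₀ q0.le q1 (by omega))).le

lemma gam_neg {q : ℝ} (q0 : 0 < q) (q1 : q < 1) (l : ℕ) :
    HasSum (fun j : ℕ => q^(4*j*j+2*j+(2*j+1)*(l+1)) * (1 - q^(4*j+2+(l+1)))) (gam q 1 (-(l+1:ℕ))) := by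
  have h := (sgsn_sum q0 q1 one_pos (-(l+1:ℕ))).hasSum
  have h2 : HasSum (fun n : ℕ => (-1:ℝ)^n * q^(n*n+n+(n+1)*(l+1))) (gam q 1 (-(l+1:ℕ))) := by
    unfold gam
    have inj : Function.Injective (fun m : ℕ => -((m+1:ℕ):ℤ)) := fun a b h => by
      simp only at h; omega
    rw [← inj.hasSum_iff] at h
    · refine h.cg (fun n => ?_) rfl
      simp only [Function.comp, sg, sn]
      rw [if_neg (by omega), if_pos (by omega), one_zpow]
      have e1 : -((n+1:ℕ):ℤ) * -((n+1:ℕ):ℤ) + -((n+1:ℕ):ℤ) + -((n+1:ℕ):ℤ) * -((l+1:ℕ):ℤ) =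
        ((n*n+n+(n+1)*(l+1) : ℕ) : ℤ) := by push_cast; ring
      rw [e1, zpow_natCast, zpow_neg, zpow_natCast, pow_succ]
      rcases neg_one_pow_eq_or ℝ n with h | h <;> rw [h] <;> norm_num
    · intro n hn
      have : (0 ≤ n) := by
        by_contra h
        exact hn ⟨(-n-1).toNat, by simp only; omega⟩
      have h3 : -((l+1:ℕ):ℤ) < 0 := by omega
      simp only [sg, this, h3, if_true]; simp
  have key : ∀ j : ℕ, q^(4*j*j+2*j+(2*j+1)*(l+1)) * (1 - q^(4*j+2+(l+1))) =
      (-1:ℝ)^(2*j) * q^((2*j)*(2*j)+2*j+(2*j+1)*(l+1)) +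
      (-1:ℝ)^(2*j+1) * q^((2*j+1)*(2*j+1)+(2*j+1)+((2*j+1)+1)*(l+1)) := by
    intro j
    rw [pow_succ, pow_mul]
    norm_num
    ring
  refine (pair_sum h2 fun j => ?_).cg key rfl
  rw [← key]
  exact mul_nonneg (pow_pos q0 _).le (sub_pos.2 (pow_lt_one₀ q0.le q1 (by omega))).le

/-- terms of GG/tt5 -/
noncomputable def fG (b : ℕ) (k : ℤ) (Q : ℝ) : ℝ := (tt Q 5)⁻¹ * (gam (Q^5) 1 k * (Q^b)^k)

lemma fG_pos (b k : ℕ) {Q : ℝ} (h0 : 0 < Q) (h1 : Q < 1) :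
    HasSum (fun j : ℕ => Q^(5*(4*j*j+2*j+2*j*k)+b*k) * ((tt Q 5)⁻¹ * (1 - Q^(5*(4*j+2+k))))) (fG b k Q) := by
  have h := gam_pos (pow_pos h0 5) (Q5_lt h0 h1) k
  refine (((h.mul_right ((Q^b)^k)).mul_left (tt Q 5)⁻¹)).cg (fun j => ?_) ?_
  · rw [← pow_mul, ← pow_mul, ← pow_mul, pow_add]; ring
  · unfold fG; rw [zpow_natCast]

lemma fG_neg (b l : ℕ) (hb : b ≤ 5) {Q : ℝ} (h0 : 0 < Q) (h1 : Q < 1) :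
    HasSum (fun j : ℕ => Q^(5*(4*j*j+2*j+2*j*(l+1))+(5-b)*(l+1)) * ((tt Q 5)⁻¹ * (1 - Q^(5*(4*j+2+(l+1))))))
      (fG b (-(l+1:ℕ)) Q) := by
  have h := gam_neg (pow_pos h0 5) (Q5_lt h0 h1) l
  refine (((h.mul_right (((Q^b)^(l+1))⁻¹)).mul_left (tt Q 5)⁻¹)).cg (fun j => ?_) ?_
  · have t : 5*(l+1) = (5-b)*(l+1)+b*(l+1) := by rw [← add_mul]; congr 1; omega
    have e : (Q^5)^(4*j*j+2*j+(2*j+1)*(l+1)) =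
        Q^(5*(4*j*j+2*j+2*j*(l+1))+(5-b)*(l+1)) * (Q^b)^(l+1) := by
      rw [← pow_mul, ← pow_mul, ← pow_add]
      congr 1
      have t2 : 5*(4*j*j+2*j+(2*j+1)*(l+1)) = 5*(4*j*j+2*j+2*j*(l+1)) + 5*(l+1) := by ring
      rw [t2, t]; simp only [add_assoc]
    rw [e, ← pow_mul Q 5]
    have hx := (pow_pos (pow_pos h0 b) (l+1)).ne'
    field_simp
  · unfold fG; rw [zpow_neg, zpow_natCast]

lemma fG_PN (b : ℕ) (hb : b ≤ 5) (k : ℤ) : PN (fG b k) := by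
  rcases lt_or_ge k 0 with h | h
  · obtain ⟨n, rfl⟩ : ∃ n : ℕ, k = -(n+1:ℕ) := ⟨(-k-1).toNat, by omega⟩
    exact PN_sum (fun j => (PN_pow _).mul (At_c (by omega)).nn) fun Q h0 h1 => fG_neg b n hb h0 h1
  · obtain ⟨n, rfl⟩ : ∃ n : ℕ, k = n := ⟨k.toNat, by omega⟩
    exact PN_sum (fun j => (PN_pow _).mul (At_c (by omega)).nn) fun Q h0 h1 => fG_pos b n h0 h1

lemma fG_At0 (b : ℕ) : At (fG b 0) 0 := by
  refine At_sum (f := fun (j:ℕ) Q => Q^(5*(4*j*j+2*j+2*j*0)+b*0) * ((tt Q 5)⁻¹ * (1 - Q^(5*(4*j+2+0)))))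
    (fun j => (PN_pow _).mul (At_c (by omega)).nn) (fun Q h0 h1 => ?_) 0 ?_
  · exact_mod_cast fG_pos b 0 h0 h1
  · refine (At_c (n := 2) (by norm_num)).congr fun Q _ _ => by simp

lemma fG_hasSum (b : ℕ) (b0 : b ≠ 0) (b5 : b < 5) {Q : ℝ} (h0 : 0 < Q) (h1 : Q < 1) :
    HasSum (fun k => fG b k Q) (GG (Q^5) 1 (Q^b) / tt Q 5) := by
  have h := gam_hasSum (pow_pos h0 5) one_pos (pow_pos h0 b)
    (by rw [mul_one]; exact pow_lt_pow_right_of_lt_one₀ h0 h1 b5)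
    (by rw [mul_one]; exact pw_lt h0 h1 b0)
  exact (h.mul_left (tt Q 5)⁻¹).cg (fun k => rfl) (by rw [div_eq_inv_mul])

lemma At_GG (b : ℕ) (b0 : b ≠ 0) (b5 : b < 5) : At (fun Q => GG (Q^5) 1 (Q^b) / tt Q 5) 0 :=
  At_sum (fG_PN b b5.le) (fun Q h0 h1 => fG_hasSum b b0 b5 h0 h1) 0 (fG_At0 b)

/-! q-binomial theorem -/
noncomputable def pf (c q : ℝ) (n : ℕ) : ℝ := ∏ k ∈ Finset.range n, (1 - c * q^k)

lemma pf_succ (c q : ℝ) (n : ℕ) : pf c q (n+1) = pf c q n * (1 - c*q^n) := by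
  unfold pf; rw [Finset.prod_range_succ]

lemma pf_Pq {c q : ℝ} (q0 : 0 < q) (q1 : q < 1) (n : ℕ) : Pq c q = pf c q n * Pq (c*q^n) q := by
  induction n with
  | zero => simp [pf]
  | succ n ih =>
    rw [ih, Pq_succ q0 q1 (c*q^n), pf_succ, pow_succ]; ring_nf

lemma pf_pos {c q : ℝ} (c0 : 0 < c) (c1 : c < 1) (q0 : 0 < q) (q1 : q < 1) (n : ℕ) : 0 < pf c q n :=
  Finset.prod_pos fun k _ => by
    have := pow_le_one₀ (n := k) q0.le q1.le
    nlinarith [pow_pos q0 k]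

lemma pf_le {c q : ℝ} (c0 : 0 < c) (c1 : c < 1) (q0 : 0 < q) (q1 : q < 1) (n : ℕ) : pf c q n ≤ 1 :=
  Finset.prod_le_one (fun k _ => by
    have := pow_le_one₀ (n := k) q0.le q1.le
    nlinarith [pow_pos q0 k]) fun k _ => by
    have := mul_pos c0 (pow_pos q0 k)
    linarith

lemma pf_q_ge {q : ℝ} (q0 : 0 < q) (q1 : q < 1) (n : ℕ) : Pq q q ≤ pf q q n := by
  have hp := pf_pos q0 q1 q0 q1
  have an : Antitone (pf q q) := antitone_nat_of_succ_le fun m => by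
    rw [pf_succ]
    have := mul_pos q0 (pow_pos q0 m)
    nlinarith [hp m]
  exact an.le_of_tendsto (Pq_tendsto q0 q1 q) n

lemma qbin {c q : ℝ} (c0 : 0 < c) (c1 : c < 1) (q0 : 0 < q) (q1 : q < 1) {z : ℝ} (z0 : 0 < z) (z1 : z < 1) :
    HasSum (fun n => pf c q n / pf q q n * z^n) (Pq (c*z) q / Pq z q) := by
  set a : ℕ → ℝ := fun n => pf c q n / pf q q n with ha
  have P0 : 0 < Pq q q := Pq_pos q0 q1 q1
  have hp := pf_pos q0 q1 q0 q1
  have hc := pf_pos c0 c1 q0 q1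
  have apos : ∀ n, 0 ≤ a n := fun n => (div_pos (hc n) (hp n)).le
  have ale : ∀ n, a n ≤ (Pq q q)⁻¹ := fun n => by
    rw [ha, ← one_div]
    exact div_le_div₀ zero_le_one (pf_le c0 c1 q0 q1 n) P0 (pf_q_ge q0 q1 n)
  have S : ∀ w : ℝ, 0 < w → w < 1 → Summable fun n => a n * w^n := fun w w0 w1 =>
    Summable.of_nonneg_of_le (fun n => mul_nonneg (apos n) (pow_pos w0 n).le)
      (fun n => mul_le_mul_of_nonneg_right (ale n) (pow_pos w0 n).le)
      ((summable_geometric_of_lt_one w0.le w1).mul_left _)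
  set f : ℝ → ℝ := fun w => ∑' n, a n * w^n with hf
  have arec : ∀ n, a (n+1) * (1 - q^(n+1)) = a n * (1 - c*q^n) := fun n => by
    simp only [ha, pf_succ]
    have h1 := (hp n).ne'
    have h2 : 1 - q*q^n ≠ 0 := by
      have := hp (n+1); rw [pf_succ] at this; exact right_ne_zero_of_mul this.ne'
    rw [show q^(n+1) = q*q^n by ring]
    generalize q^n = x at *
    generalize pf q q n = y at *
    have h3 : 1 - x*q ≠ 0 := by rwa [mul_comm]
    field_simp
  have a0 : a 0 = 1 := by simp [ha, pf]
  have fe : ∀ w : ℝ, 0 < w → w < 1 → f w = (1 - c*w)/(1-w) * f (q*w) := fun w w0 w1 => by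
    have hw := S w w0 w1
    have hqw := S (q*w) (mul_pos q0 w0) (by nlinarith)
    have e1 : f w - f (q*w) = ∑' n, a (n+1) * (1 - q^(n+1)) * w^(n+1) := by
      simp only [hf]
      rw [← hw.tsum_sub hqw, (hw.sub hqw).tsum_eq_zero_add]
      simp only [pow_zero, sub_self, zero_add]
      exact tsum_congr fun n => by rw [mul_pow]; ring
    have e2 : ∑' n, a (n+1) * (1 - q^(n+1)) * w^(n+1) = w * f w - c * w * f (q*w) := by
      simp only [hf]
      rw [← tsum_mul_left, ← tsum_mul_left, ← (hw.mul_left w).tsum_sub (hqw.mul_left (c*w))]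
      exact tsum_congr fun n => by rw [arec, mul_pow]; ring
    rw [e2] at e1
    have : 1 - w ≠ 0 := by linarith
    rw [div_mul_eq_mul_div, eq_div_iff this]
    linarith
  have it : ∀ N : ℕ, f z * Pq z q * Pq (c*z*q^N) q = Pq (c*z) q * (f (z*q^N) * Pq (z*q^N) q) := by
    intro N
    induction N with
    | zero => simp; ring
    | succ N ih =>
      have w0 : 0 < z*q^N := mul_pos z0 (pow_pos q0 N)
      have w1 : z*q^N < 1 := by
        have := pow_le_one₀ (n := N) q0.le q1.le
        nlinarith
      rw [fe _ w0 w1, Pq_succ q0 q1 (z*q^N), Pq_succ q0 q1 (c*z*q^N)] at ih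
      have h1 : 1 - z*q^N ≠ 0 := by linarith
      have h2 : 1 - c*z*q^N ≠ 0 := by nlinarith
      have e3 : q*(z*q^N) = z*q^(N+1) := by ring
      have e4 : c*z*q^N*q = c*z*q^(N+1) := by ring
      have e5 : z*q^N*q = z*q^(N+1) := by ring
      rw [e3, e4, e5] at ih
      apply mul_left_cancel₀ h2
      have e6 : (1 - c*(z*q^N))/(1 - z*q^N) * f (z*q^(N+1)) * ((1-z*q^N) * Pq (z*q^(N+1)) q)
        = (1 - c*z*q^N) * (f (z*q^(N+1)) * Pq (z*q^(N+1)) q) := by field_simp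
      rw [e6] at ih
      linarith
  have tz : ∀ y : ℝ, Tendsto (fun N => y*q^N) atTop (𝓝 0) := fun y => by
    simpa using (tendsto_pow_atTop_nhds_zero_of_lt_one q0.le q1).const_mul y
  have P00 : Pq 0 q = 1 := by simp [Pq]
  have l1 : Tendsto (fun N => Pq (c*z*q^N) q) atTop (𝓝 1) := by
    rw [← P00]; exact Pq_cont q0 q1 0 (tz _)
  have l2 : Tendsto (fun N => Pq (z*q^N) q) atTop (𝓝 1) := by
    rw [← P00]; exact Pq_cont q0 q1 0 (tz _)
  have l3 : Tendsto (fun N => f (z*q^N)) atTop (𝓝 1) := by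
    have up : Tendsto (fun N => 1 + (Pq q q)⁻¹ * (z*q^N) * (1-z)⁻¹) atTop (𝓝 1) := by
      have := (((tz z).const_mul (Pq q q)⁻¹).mul_const (1-z)⁻¹).const_add 1
      simpa using this
    refine tendsto_of_tendsto_of_tendsto_of_le_of_le tendsto_const_nhds up (fun N => ?_) (fun N => ?_)
    all_goals
      have w0 : 0 < z*q^N := mul_pos z0 (pow_pos q0 N)
      have wz : z*q^N ≤ z := by
        have := pow_le_one₀ (n := N) q0.le q1.le
        nlinarith
      have hS := S _ w0 (wz.trans_lt z1)
      have e : f (z*q^N) = 1 + ∑' n, a (n+1) * (z*q^N)^(n+1) := by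
        simp only [hf]; rw [hS.tsum_eq_zero_add, a0]; simp
      simp only [e]
    · have : 0 ≤ ∑' n, a (n+1) * (z*q^N)^(n+1) := tsum_nonneg fun n => mul_nonneg (apos _) (pow_pos w0 _).le
      linarith
    · have g := (hasSum_geometric_of_lt_one z0.le z1).mul_left ((Pq q q)⁻¹ * (z*q^N))
      have : ∑' n, a (n+1) * (z*q^N)^(n+1) ≤ (Pq q q)⁻¹ * (z*q^N) * (1-z)⁻¹ := by
        rw [← g.tsum_eq]
        refine Summable.tsum_le_tsum (fun n => ?_) ((summable_nat_add_iff 1).2 hS) g.summable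
        rw [pow_succ]
        have h1 : (z*q^N)^n ≤ z^n := pow_le_pow_left₀ w0.le wz n
        have h2 := mul_le_mul (ale (n+1)) h1 (pow_pos w0 n).le (inv_pos.2 P0).le
        nlinarith
      linarith
  have L1 := (l1.const_mul (f z * Pq z q))
  have L2 := (l3.mul l2).const_mul (Pq (c*z) q)
  have := tendsto_nhds_unique (L1.congr it) L2
  refine (S z z0 z1).hasSum.cg (fun n => rfl) ?_
  have hz := (Pq_pos q0 q1 z1).ne'
  change _ = f z
  field_simp
  linarith


lemma PN_pfinv (n : ℕ) : At (fun Q => (pf (Q^10) (Q^10) n)⁻¹) 0 := by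
  induction n with
  | zero => exact (At_const one_pos).congr fun Q _ _ => by simp [pf]
  | succ n ih =>
    refine (ih.mul (At_geo (n := 10 + 10*n) (by omega) 0)).congr fun Q h0 h1 => ?_
    rw [pf_succ, mul_inv, ← pow_mul, ← pow_add]

/-- the quotient T/[2] -/
lemma At_T2 (n : ℕ) : At (fun Q => TT Q / (Pq (Q^2) (Q^10) * Pq (Q^8) (Q^10))) (2*n) := by
  have hA : ∀ n : ℕ, At (fun Q => Q^(2*n) * ((pf (Q^10) (Q^10) n)⁻¹ * (Pq (Q^(8+10*n)) (Q^10))⁻¹)) (2*n) :=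
    fun n => (At_pow (2*n)).mul ((PN_pfinv n).mul (At_Pinv0 (a := 8+10*n) (b := 10) (by omega) (by norm_num)))
  refine At_sum (fun i => (hA i).nn) (fun Q h0 h1 => ?_) n (hA n)
  have q0 := pow_pos h0 10
  have q1 := pw_lt h0 h1 (n := 10) (by norm_num)
  have h := qbin (c := Q^8) (q := Q^10) (z := Q^2) (pow_pos h0 8) (pw_lt h0 h1 (by norm_num)) q0 q1
    (pow_pos h0 2) (pw_lt h0 h1 (by norm_num))
  refine (h.mul_right (Pq (Q^8) (Q^10))⁻¹).cg (fun i => ?_) ?_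
  · rw [pf_Pq (c := Q^8) q0 q1 i]
    have := (pf_pos (pow_pos h0 8) (pw_lt h0 h1 (n := 8) (by norm_num)) q0 q1 i).ne'
    rw [← pow_mul, ← pow_mul, ← pow_add, mul_inv]
    field_simp
  · unfold TT
    rw [← pow_add]
    norm_num
    rw [div_mul_eq_div_div]
    rfl

lemma br_split {Q : ℝ} (h0 : 0 < Q) (h1 : Q < 1) :
    Pq (Q^2) (Q^5) = Pq (Q^2) (Q^10) * Pq (Q^7) (Q^10) ∧ Pq (Q^3) (Q^5) = Pq (Q^3) (Q^10) * Pq (Q^8) (Q^10) := by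
  constructor
  all_goals
    rw [Pq_split (pow_pos h0 5) (Q5_lt h0 h1), ← pow_mul, ← pow_add]

lemma br4 {Q : ℝ} (h0 : 0 < Q) (h1 : Q < 1) :
    Pq (Q^4) (Q^10) * Pq (Q^6) (Q^10) = Pq (-Q^2) (Q^5) * Pq (-Q^3) (Q^5) *
     (Pq (Q^2) (Q^10) * Pq (Q^8) (Q^10)) * (Pq (Q^3) (Q^10) * Pq (Q^7) (Q^10)) := by
  have e1 := Pq_neg_mul (pow_pos h0 5) (Q5_lt h0 h1) (Q^2)
  have e2 := Pq_neg_mul (pow_pos h0 5) (Q5_lt h0 h1) (Q^3)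
  rw [← pow_mul, ← pow_mul] at e1 e2
  norm_num at e1 e2
  obtain ⟨s1, s2⟩ := br_split h0 h1
  rw [← e1, ← e2, s1, s2]
  ring

lemma Pb {Q : ℝ} (h0 : 0 < Q) (h1 : Q < 1) (k : ℕ) (hk : k ≠ 0) : Pq (Q^k) (Q^10) ≠ 0 :=
  (Pq_pos (pow_pos h0 10) (pw_lt h0 h1 (n := 10) (by norm_num)) (pw_lt h0 h1 hk)).ne'

lemma cA1_eq {Q : ℝ} (h0 : 0 < Q) (h1 : Q < 1) : cA1 Q = 2 * Q^1 * (GG (Q^5) 1 (Q^2) / tt Q 5) +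
    Pq (-Q^2) (Q^5) * Pq (-Q^3) (Q^5) * (TT Q / (Pq (Q^2) (Q^10) * Pq (Q^8) (Q^10))) := by
  have t5 := (tt_pos h0 h1 5 (by norm_num) (by norm_num)).ne'
  have t2 := tt_prod h0 h1 2 (by norm_num)
  have t3 := tt_prod h0 h1 3 (by norm_num)
  have t4 := tt_prod h0 h1 4 (by norm_num)
  norm_num at t2 t3 t4
  rw [br4 h0 h1] at t4
  have b2 := Pb h0 h1 2 (by norm_num)
  have b3 := Pb h0 h1 3 (by norm_num)
  have b7 := Pb h0 h1 7 (by norm_num)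
  have b8 := Pb h0 h1 8 (by norm_num)
  have tp := (TT_pos h0 h1).ne'
  unfold cA1 cB
  rw [t2, t3, t4]
  generalize Pq (Q^2) (Q^10) = x2 at *
  generalize Pq (Q^3) (Q^10) = x3 at *
  generalize Pq (Q^7) (Q^10) = x7 at *
  generalize Pq (Q^8) (Q^10) = x8 at *
  generalize TT Q = T at *
  generalize tt Q 5 = T5 at *
  generalize GG (Q^5) 1 (Q^2) = G at *
  field_simp

lemma At_cA1 (m : ℕ) : At cA1 m := by
  have C2 := fun n => ((At_Pm0 2 (b := 5) (by norm_num)).mul (At_Pm0 3 (b := 5) (by norm_num))).mul (At_T2 n)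
  have C3 := fun n => ((At_Pm0 2 (b := 5) (by norm_num)).mul (At_Pm 3 (b := 5) (by norm_num))).mul (At_T2 n)
  have G := (At_mon two_pos 1).mul (At_GG 2 (by norm_num) (by norm_num))
  rcases Nat.even_or_odd' m with ⟨k, rfl | rfl⟩
  · have := (C2 k).add G.nn
    rw [show 0 + 0 + 2*k = 2*k by ring] at this
    exact this.congr fun Q h0 h1 => by rw [cA1_eq h0 h1]; ring
  · by_cases hk : k = 0
    · subst hk
      have := G.add (C2 0).nn
      exact this.congr fun Q h0 h1 => by rw [cA1_eq h0 h1]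
    · have := (C3 (k-1)).add G.nn
      rw [show 0 + 3 + 2*(k-1) = 2*k+1 by omega] at this
      exact this.congr fun Q h0 h1 => by rw [cA1_eq h0 h1]; ring

lemma F3_sub : PN (fun Q => TT Q / (Pq (Q^7) (Q^5) * Pq (Q^3) (Q^5)) -
    (1 + (Q^(3+5*0) * (1 - Q^(3+5*0))⁻¹ + Q^(7+5*0) * (1 - Q^(7+5*0))⁻¹))) := by
  refine PN_prod (g := fun i Q => Q^(3+5*i) * (1 - Q^(3+5*i))⁻¹ + Q^(7+5*i) * (1 - Q^(7+5*i))⁻¹)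
    (F := fun Q => TT Q / (Pq (Q^7) (Q^5) * Pq (Q^3) (Q^5)))
    (fun i => ((PN_pow _).mul (PN_geo (by omega))).add ((PN_pow _).mul (PN_geo (by omega)))) fun Q h0 h1 => ?_
  have q0 := pow_pos h0 5
  have q1 := Q5_lt h0 h1
  have l1 := Pq_tendsto (pow_pos h0 10) (pw_lt h0 h1 (n := 10) (by norm_num)) (Q^10)
  have l2 := (Pq_tendsto q0 q1 (Q^7)).mul (Pq_tendsto q0 q1 (Q^3))
  have l := l1.div l2 (mul_pos (Pq_pos q0 q1 (pw_lt h0 h1 (n := 7) (by norm_num)))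
    (Pq_pos q0 q1 (pw_lt h0 h1 (n := 3) (by norm_num)))).ne'
  refine l.congr fun N => ?_
  rw [Pi.div_apply, ← Finset.prod_mul_distrib, ← Finset.prod_div_distrib]
  refine Finset.prod_congr rfl fun i _ => ?_
  have n1 := one_sub_ne h0 h1 (n := 3+5*i) (by omega)
  have n2 := one_sub_ne h0 h1 (n := 7+5*i) (by omega)
  have e1 : Q^10 * (Q^10)^i = Q^(3+5*i) * Q^(7+5*i) := by ring
  have e2 : Q^7 * (Q^5)^i = Q^(7+5*i) := by ring
  have e3 : Q^3 * (Q^5)^i = Q^(3+5*i) := by ring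
  rw [e1, e2, e3]
  generalize Q^(3+5*i) = x at *
  generalize Q^(7+5*i) = y at *
  field_simp
  ring

lemma cA3_eq {Q : ℝ} (h0 : 0 < Q) (h1 : Q < 1) : cA3 Q = (1 - Q^2)⁻¹ *
    (TT Q / (Pq (Q^7) (Q^5) * Pq (Q^3) (Q^5))) := by
  have t2 := tt_prod h0 h1 2 (by norm_num)
  have t3 := tt_prod h0 h1 3 (by norm_num)
  norm_num at t2 t3
  have b2 := Pb h0 h1 2 (by norm_num)
  have b3 := Pb h0 h1 3 (by norm_num)
  have b7 := Pb h0 h1 7 (by norm_num)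
  have b8 := Pb h0 h1 8 (by norm_num)
  have tp := (TT_pos h0 h1).ne'
  obtain ⟨s1, s2⟩ := br_split h0 h1
  have s3 := Pq_succ (pow_pos h0 5) (Q5_lt h0 h1) (Q^2)
  rw [← pow_add] at s3
  norm_num at s3
  have n2 := one_sub_ne h0 h1 (n := 2) (by norm_num)
  have s4 : Pq (Q^7) (Q^5) = Pq (Q^2) (Q^10) * Pq (Q^7) (Q^10) / (1 - Q^2) := by
    rw [← s1, s3]; field_simp
  unfold cA3
  rw [t2, t3, s4, s2]
  generalize Pq (Q^2) (Q^10) = x2 at *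
  generalize Pq (Q^3) (Q^10) = x3 at *
  generalize Pq (Q^7) (Q^10) = x7 at *
  generalize Pq (Q^8) (Q^10) = x8 at *
  generalize TT Q = T at *
  field_simp

lemma At_cA3 {m : ℕ} (hm : m ≠ 1) : At cA3 m := by
  have n3 := ((PN_pow (3+5*0)).mul (PN_geo (n := 3+5*0) (by omega)))
  have n7 := ((PN_pow (7+5*0)).mul (PN_geo (n := 7+5*0) (by omega)))
  have a0 := ((At_const one_pos).add (n3.add n7)).of_sub F3_sub
  have a3 := ((((At_pow (3+5*0)).mul (At_geo (n := 3+5*0) (by omega) 0)).add n7).add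
    (PN_const zero_le_one)).congr (G := fun Q => 1 + (Q^(3+5*0) * (1 - Q^(3+5*0))⁻¹ + Q^(7+5*0) * (1 - Q^(7+5*0))⁻¹))
    (fun Q _ _ => by ring)
  have a3 := a3.of_sub F3_sub
  rcases Nat.even_or_odd' m with ⟨k, rfl | rfl⟩
  · exact ((At_geo (n := 2) (by norm_num) k).mul a0).congr fun Q h0 h1 => cA3_eq h0 h1
  · have := ((At_geo (n := 2) (by norm_num) (k-1)).mul a3).congr (G := cA3) fun Q h0 h1 => cA3_eq h0 h1
    rwa [show 2*(k-1) + (3+5*0+(3+5*0)*0) = 2*k+1 by omega] at this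

/-- signed power series -/
def PS (F : ℝ → ℝ) : Prop := ∃ G H, PN G ∧ PN H ∧ ∀ Q, 0 < Q → Q < 1 → F Q = G Q - H Q

lemma PN.ps {F : ℝ → ℝ} (h : PN F) : PS F := ⟨F, fun _ => 0, h, PN_const le_rfl, by simp⟩
lemma PS.neg {F : ℝ → ℝ} : PS F → PS (fun Q => - F Q) := by
  rintro ⟨G, H, hG, hH, e⟩
  exact ⟨H, G, hH, hG, fun Q h0 h1 => by dsimp only; rw [e Q h0 h1]; ring⟩
lemma PS.add {F F' : ℝ → ℝ} : PS F → PS F' → PS (fun Q => F Q + F' Q) := by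
  rintro ⟨G, H, hG, hH, e⟩ ⟨G', H', hG', hH', e'⟩
  exact ⟨_, _, hG.add hG', hH.add hH', fun Q h0 h1 => by dsimp only; rw [e Q h0 h1, e' Q h0 h1]; ring⟩
lemma PS.mul {F F' : ℝ → ℝ} : PS F → PS F' → PS (fun Q => F Q * F' Q) := by
  rintro ⟨G, H, hG, hH, e⟩ ⟨G', H', hG', hH', e'⟩
  exact ⟨_, _, (hG.mul hG').add (hH.mul hH'), (hG.mul hH').add (hH.mul hG'),
    fun Q h0 h1 => by dsimp only; rw [e Q h0 h1, e' Q h0 h1]; ring⟩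
lemma PS.congr {F G : ℝ → ℝ} (h : PS F) (e : ∀ Q, 0 < Q → Q < 1 → G Q = F Q) : PS G := by
  obtain ⟨A, B, hA, hB, h⟩ := h
  exact ⟨A, B, hA, hB, fun Q h0 h1 => by rw [e Q h0 h1, h Q h0 h1]⟩

lemma tt_PS (k : ℕ) (hk : k ≤ 10) : PS (fun Q => tt Q k) := by
  classical
  set e : ℤ → ℕ := fun n => (5*(n*n-n)+k*n).toNat with he
  have he2 : ∀ n : ℤ, (e n : ℤ) = 5*(n*n-n)+k*n := fun n => by
    apply Int.toNat_of_nonneg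
    have hk' : (k:ℤ) ≤ 10 := by exact_mod_cast hk
    have k0 : (0:ℤ) ≤ k := by positivity
    rcases lt_or_ge n 0 with h | h
    · nlinarith
    · rcases eq_or_lt_of_le h with h | h
      · simp [← h]
      · nlinarith
  have term : ∀ (Q : ℝ) (n : ℤ), 0 < Q → thc (Q^5) n * (Q^k)^n = (-1)^n * Q^(e n) := fun Q n h0 => by
    unfold thc
    rw [← zpow_natCast Q 5, ← zpow_natCast Q k, ← zpow_natCast Q (e n), he2, ← zpow_mul, ← zpow_mul, mul_assoc,
      ← zpow_add₀ h0.ne']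
    rfl
  have S : ∀ Q : ℝ, 0 < Q → Q < 1 → Summable fun n : ℤ => Q^(e n) := fun Q h0 h1 => by
    have := (th_hasSum (pow_pos h0 5) (Q5_lt h0 h1) (pow_pos h0 k).ne').summable.norm
    refine this.congr fun n => ?_
    rw [term Q n h0, norm_mul, norm_zpow]
    simp [abs_of_pos h0]
  have S1 : ∀ (p : ℤ → Prop) (Q : ℝ), 0 < Q → Q < 1 → Summable fun n : ℤ => if p n then Q^(e n) else 0 :=
    fun p Q h0 h1 => (S Q h0 h1).of_nonneg_of_le (fun n => by split_ifs; exacts [(pow_pos h0 _).le, le_rfl])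
      (fun n => by split_ifs; exacts [le_rfl, (pow_pos h0 _).le])
  have P1 : ∀ (p : ℤ → Prop), PN (fun Q => ∑' n : ℤ, if p n then Q^(e n) else 0) := fun p => by
    refine PN_sum (f := fun n Q => if p n then Q^(e n) else 0) (fun n => ?_) fun Q h0 h1 => (S1 p Q h0 h1).hasSum
    by_cases h : p n
    · simp only [h, if_true]; exact PN_pow _
    · simp only [h, if_false]; exact PN_const le_rfl
  refine ⟨_, _, P1 Even, P1 Odd, fun Q h0 h1 => ?_⟩
  rw [← (S1 Even Q h0 h1).tsum_sub (S1 Odd Q h0 h1)]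
  unfold tt th
  refine tsum_congr fun n => ?_
  rw [term Q n h0]
  rcases Int.even_or_odd n with h | h
  · rw [h.neg_one_zpow, if_pos h, if_neg (by simpa using h)]; ring
  · rw [h.neg_one_zpow, if_pos h, if_neg (by simpa using h)]; ring

lemma PS_cA4 : PS cA4 := by
  have G := (At_GG 1 (by norm_num) (by norm_num)).nn.ps.neg
  have i5 := At_e0.nn.ps
  have a := (((PN_const (show (0:ℝ) ≤ 2 by norm_num)).ps.mul (tt_PS 3 (by norm_num))).mul
    (At_cA3 (m := 0) (by norm_num)).nn.ps).mul i5
  have b := (((tt_PS 1 (by norm_num)).mul (At_cB (m := 0) (by norm_num)).nn.ps).mul i5).neg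
  refine ((G.add a).add b).congr fun Q h0 h1 => ?_
  unfold cA4
  rw [pow_one]
  ring


/-- rank of a multiset -/
def rk (s : Multiset ℕ) : ℤ := (s.sup : ℤ) - (s.card : ℤ)

open Classical in
/-- weight of a partition -/
noncomputable def wt (v : ℝ) (s : Multiset ℕ) : ℝ := if 0 ∈ s then 0 else 2^(s.toFinset.card) * v^(s.sum)

def e1 (p : Multiset ℕ × ℕ) : Multiset ℕ := p.1.map Nat.succ + Multiset.replicate p.2 1

/-- the new part -/
def tp (s : ℤ) (p : Multiset ℕ × ℕ) : ℤ := (p.1.card : ℤ) + p.2 + s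

def e2 (s : ℤ) (p : Multiset ℕ × ℕ) : Multiset ℕ := if tp s p = 0 then p.1 else (tp s p).toNat ::ₘ p.1

/-- indicator -/
noncomputable def ind (p : Prop) [Decidable p] : ℝ := if p then 1 else 0

lemma sup_mem {x : Multiset ℕ} (h0 : 0 ∉ x) (hx : x ≠ 0) : x.sup ∈ x := by
  by_contra h
  have h1 : x.sup ≤ x.sup - 1 := Multiset.sup_le.2 fun b hb => by
    have h2 := Multiset.le_sup hb
    have : b ≠ x.sup := fun e => h (e ▸ hb)
    omega
  obtain ⟨b, hb⟩ := Multiset.exists_mem_of_ne_zero hx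
  have h2 := Multiset.le_sup hb
  have : b ≠ 0 := fun e => h0 (e ▸ hb)
  omega

lemma sup_eq_zero' {x : Multiset ℕ} (h0 : 0 ∉ x) (hx : x.sup = 0) : x = 0 := by
  by_contra h
  exact h0 (hx ▸ sup_mem h0 h)

lemma e1_card (p) : (e1 p).card = p.1.card + p.2 := by simp [e1]
lemma e1_sum (p) : (e1 p).sum = p.1.sum + p.1.card + p.2 := by
  have : ∀ r : Multiset ℕ, (r.map Nat.succ).sum = r.sum + r.card := fun r => by
    induction r using Multiset.induction_on with
    | empty => simp
    | cons a r ih => simp only [Multiset.map_cons, Multiset.sum_cons, ih, Multiset.card_cons]; omega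
  simp [e1, this]
lemma e1_zero (p) : 0 ∉ e1 p := by
  simp [e1, Multiset.mem_replicate]
lemma e1_sup (p : Multiset ℕ × ℕ) : (e1 p).sup = if p.1 = 0 then (if p.2 = 0 then 0 else 1) else p.1.sup + 1 := by
  have h1 : ∀ r : Multiset ℕ, r ≠ 0 → (r.map Nat.succ).sup = r.sup + 1 := fun r => by
    induction r using Multiset.induction_on with
    | empty => simp
    | cons a r ih =>
      intro _
      by_cases hr : r = 0
      · subst hr; simp
      · rw [Multiset.map_cons, Multiset.sup_cons, ih hr, Multiset.sup_cons]
        simp only [Nat.succ_eq_add_one]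
        omega
  have h2 : ∀ c : ℕ, (Multiset.replicate c 1).sup = if c = 0 then 0 else 1 := fun c => by
    induction c with
    | zero => simp
    | succ c ih =>
      rw [Multiset.replicate_succ, Multiset.sup_cons, ih, if_neg (Nat.succ_ne_zero c)]
      split_ifs <;> simp
  unfold e1
  rw [Multiset.sup_add, h2]
  by_cases h : p.1 = 0
  · simp [h]
  · rw [h1 _ h, if_neg h]
    split_ifs <;> simp

lemma e1_dist (p : Multiset ℕ × ℕ) (h0 : 0 ∉ p.1) :
    (e1 p).toFinset.card = p.1.toFinset.card + if p.2 = 0 then 0 else 1 := by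
  unfold e1
  rw [Multiset.toFinset_add]
  have h1 : (p.1.map Nat.succ).toFinset = p.1.toFinset.image Nat.succ := by
    ext; simp
  have c1 : (p.1.map Nat.succ).toFinset.card = p.1.toFinset.card := by
    rw [h1, Finset.card_image_of_injective _ Nat.succ_injective]
  by_cases h : p.2 = 0
  · simp [h, c1]
  · rw [Finset.card_union_of_disjoint, c1, if_neg h, Multiset.toFinset_replicate, if_neg h, Finset.card_singleton]
    rw [Multiset.toFinset_replicate, if_neg h, Finset.disjoint_singleton_right]
    simpa using h0

lemma e1_inj {p p' : Multiset ℕ × ℕ} (h0 : 0 ∉ p.1) (h0' : 0 ∉ p'.1) (h : e1 p = e1 p') : p = p' := by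
  have cc : ∀ p : Multiset ℕ × ℕ, 0 ∉ p.1 → (e1 p).count 1 = p.2 := fun p h0 => by
    unfold e1
    rw [Multiset.count_add, Multiset.count_replicate_self, Multiset.count_eq_zero_of_notMem, zero_add]
    simpa using h0
  have h2 : p.2 = p'.2 := by rw [← cc p h0, h, cc p' h0']
  unfold e1 at h
  rw [h2] at h
  have h3 := Multiset.map_injective Nat.succ_injective (add_right_cancel h)
  exact Prod.ext h3 h2

lemma e1_surj {x : Multiset ℕ} (h0 : 0 ∉ x) : ∃ p : Multiset ℕ × ℕ, 0 ∉ p.1 ∧ e1 p = x := by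
  refine ⟨((x.filter (fun a => ¬ a = 1)).map Nat.pred, x.count 1), ?_, ?_⟩
  · simp only [Multiset.mem_map, Multiset.mem_filter, not_exists, not_and]
    rintro a ⟨h1, h2⟩ h3
    have : a ≠ 0 := fun e => h0 (e ▸ h1)
    rw [Nat.pred_eq_sub_one] at h3
    omega
  · unfold e1
    simp only
    rw [Multiset.map_map]
    have : (x.filter (fun a => ¬ a = 1)).map (Nat.succ ∘ Nat.pred) = x.filter (fun a => ¬ a = 1) := by
      conv_rhs => rw [← Multiset.map_id (x.filter (fun a => ¬ a = 1))]
      refine Multiset.map_congr rfl fun a ha => ?_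
      have h1 := Multiset.mem_of_mem_filter ha
      have : a ≠ 0 := fun e => h0 (e ▸ h1)
      simp only [Function.comp, id]
      exact Nat.succ_pred this
    rw [this, ← Multiset.filter_eq', add_comm]
    exact Multiset.filter_add_not _ _

lemma e2_inj (s : ℤ) {p p' : Multiset ℕ × ℕ} (h0 : 0 ∉ p.1) (h0' : 0 ∉ p'.1)
    (hs : (p.1.sup : ℤ) ≤ tp s p) (hs' : (p'.1.sup : ℤ) ≤ tp s p') (h : e2 s p = e2 s p') : p = p' := by
  have key : ∀ p : Multiset ℕ × ℕ, 0 ∉ p.1 → (p.1.sup : ℤ) ≤ tp s p → ((e2 s p).sup : ℤ) = tp s p := by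
    intro p h0 hs
    unfold e2
    split_ifs with h
    · omega
    · rw [Multiset.sup_cons]
      simp only [Nat.cast_max]
      omega
  have ht : tp s p = tp s p' := by rw [← key p h0 hs, h, key p' h0' hs']
  have h1 : p.1 = p'.1 := by
    unfold e2 at h
    rw [← ht] at h
    split_ifs at h with h3
    · exact h
    · exact (Multiset.cons_inj_right _).1 h
  refine Prod.ext h1 ?_
  unfold tp at ht
  rw [h1] at ht
  omega

lemma e2_surj (s : ℤ) {x : Multiset ℕ} (h0 : 0 ∉ x) (hr : s - 1 ≤ rk x) (hx : x = 0 → s ≤ 0) :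
    ∃ p : Multiset ℕ × ℕ, 0 ∉ p.1 ∧ (p.1.sup : ℤ) ≤ tp s p ∧ e2 s p = x := by
  by_cases h : x = 0
  · refine ⟨(0, (-s).toNat), by simp, ?_, ?_⟩
    · simp [tp]; have := hx h; omega
    · have : tp s (0, (-s).toNat) = 0 := by simp [tp]; have := hx h; omega
      rw [e2, if_pos this, h]
  · have hm := sup_mem h0 h
    have hc := Multiset.card_erase_of_mem hm
    have hc2 := Multiset.card_pos.2 h
    have hsup : x.sup ≠ 0 := fun e => h0 (e ▸ hm)
    unfold rk at hr
    have ht : tp s (x.erase x.sup, (x.sup - s - (x.erase x.sup).card : ℤ).toNat) = x.sup := by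
      unfold tp
      simp only
      rw [hc, Nat.pred_eq_sub_one]
      omega
    refine ⟨(x.erase x.sup, (x.sup - s - (x.erase x.sup).card : ℤ).toNat), ?_, ?_, ?_⟩
    · exact fun h => h0 (Multiset.mem_of_mem_erase h)
    · rw [ht]
      have : (x.erase x.sup).sup ≤ x.sup := Multiset.sup_mono (Multiset.erase_subset _ _)
      exact_mod_cast this
    · unfold e2
      rw [ht, if_neg (by exact_mod_cast hsup), Int.toNat_natCast]
      exact Multiset.cons_erase hm

noncomputable def gs (v : ℝ) (s : ℤ) (x : Multiset ℕ) : ℝ :=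
  ind (0 ≤ (x.card : ℤ) + s) * (wt v x * (ind (rk x ≤ s) + ind (rk x ≤ s+1)) * v^s)
noncomputable def fs (v : ℝ) (s : ℤ) (x : Multiset ℕ) : ℝ :=
  ind (x = 0 → s ≤ 0) * (wt v x * (ind (s ≤ rk x) + ind (s - 1 ≤ rk x)))

lemma fg {v : ℝ} (v0 : 0 < v) (s : ℤ) (p : Multiset ℕ × ℕ) (h0 : 0 ∉ p.1)
    (hs : (p.1.sup : ℤ) ≤ tp s p) : fs v s (e2 s p) = gs v s (e1 p) := by
  unfold fs gs wt rk
  rw [if_neg (e1_zero p), e1_dist p h0, e1_card, e1_sum, e1_sup]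
  by_cases ht : tp s p = 0
  · have hp : p.1 = 0 := sup_eq_zero' h0 (by omega)
    have hs0 : s = -(p.2:ℤ) := by
      unfold tp at ht; rw [hp] at ht; simp at ht; omega
    unfold e2
    rw [if_pos ht, hp, hs0]
    by_cases hc : p.2 = 0
    · simp [ind, hc]
    · have h1 : (-(p.2:ℤ) - 1 ≤ 0) := by omega
      have h2 : ¬ (1 - (p.2:ℤ) ≤ -p.2) := by omega
      have h3 : (1 - (p.2:ℤ) ≤ -p.2 + 1) := by omega
      simp [ind, hc, h1, h3]
      field_simp
      norm_num
  · have ht1 : 1 ≤ tp s p := by omega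
    have hz : (0:ℕ) ∉ (tp s p).toNat ::ₘ p.1 := by
      rw [Multiset.mem_cons, not_or]; exact ⟨by omega, h0⟩
    unfold e2
    rw [if_neg ht, if_neg hz, Multiset.sup_cons, Multiset.card_cons, Multiset.sum_cons, Multiset.toFinset_cons]
    have hsm : (tp s p).toNat ⊔ p.1.sup = (tp s p).toNat := by
      rw [sup_eq_left]; omega
    rw [hsm]
    have hv : v^((tp s p).toNat + p.1.sum) = v^(p.1.sum + p.1.card + p.2) * v^s := by
      rw [← zpow_natCast, ← zpow_natCast, ← zpow_add₀ v0.ne']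
      congr 1
      push_cast
      rw [Int.toNat_of_nonneg (by omega)]
      unfold tp; ring
    have hmem : (tp s p).toNat ∈ p.1 ↔ ¬ (p.1.sup : ℤ) < tp s p := by
      constructor
      · intro h
        have := Multiset.le_sup h
        omega
      · intro h
        have : p.1.sup = (tp s p).toNat := by omega
        rw [← this]
        refine sup_mem h0 fun e => ?_
        rw [e] at this
        simp at this
        omega
    have htn : ((tp s p).toNat : ℤ) = tp s p := by omega
    have hd : (insert (tp s p).toNat p.1.toFinset).card = p.1.toFinset.card + if (p.1.sup : ℤ) < tp s p then 1 else 0 := by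
      split_ifs with h
      · rw [Finset.card_insert_of_notMem]
        rw [Multiset.mem_toFinset, hmem]; simpa using h
      · rw [Finset.insert_eq_of_mem]; · simp
        rw [Multiset.mem_toFinset, hmem]; exact h
    have hr1 : (((if p.1 = 0 then (if p.2 = 0 then 0 else 1) else p.1.sup + 1 : ℕ) : ℤ)
       - ((p.1.card + p.2 : ℕ):ℤ) ≤ s) ↔ (p.1.sup : ℤ) < tp s p := by
      unfold tp at *
      by_cases hp : p.1 = 0
      · rw [if_pos hp]; simp only [hp, Multiset.sup_zero, Multiset.card_zero] at *
        simp at *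
        split_ifs <;> push_cast <;> omega
      · rw [if_neg hp]; push_cast; omega
    have hr2 : (((if p.1 = 0 then (if p.2 = 0 then 0 else 1) else p.1.sup + 1 : ℕ) : ℤ)
       - ((p.1.card + p.2 : ℕ):ℤ) ≤ s + 1) := by
      unfold tp at *
      by_cases hp : p.1 = 0
      · rw [if_pos hp]; simp only [hp, Multiset.sup_zero, Multiset.card_zero] at *
        simp at *
        split_ifs <;> push_cast <;> omega
      · rw [if_neg hp]; push_cast; omega
    have hr3 : (s ≤ ((tp s p).toNat : ℤ) - ((p.1.card + 1 : ℕ) : ℤ)) ↔ ¬ p.2 = 0 := by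
      rw [htn]; unfold tp; push_cast; omega
    have hr4 : (s - 1 ≤ ((tp s p).toNat : ℤ) - ((p.1.card + 1 : ℕ) : ℤ)) := by
      rw [htn]; unfold tp; push_cast; omega
    have hk : 0 ≤ ((p.1.card + p.2 : ℕ) : ℤ) + s := by unfold tp at ht1; push_cast; omega
    have hne : ((tp s p).toNat ::ₘ p.1 = 0 → s ≤ 0) := fun h => absurd h (Multiset.cons_ne_zero)
    rw [hv, hd]
    unfold ind
    simp only [hr1, hr2, hr3, hr4, hk, hne, if_true]
    split_ifs <;> simp [pow_add] <;> ring

lemma fs_gs {v : ℝ} (v0 : 0 < v) (s : ℤ) (a : ℝ) : HasSum (fs v s) a ↔ HasSum (gs v s) a := by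
  classical
  set G : Multiset ℕ × ℕ → ℝ := fun p => if 0 ∉ p.1 ∧ (p.1.sup : ℤ) ≤ tp s p then gs v s (e1 p) else 0 with hG
  have sup : ∀ p, p ∈ Function.support G → 0 ∉ p.1 ∧ (p.1.sup : ℤ) ≤ tp s p := fun p hp => by
    by_contra h
    exact hp (by simp only [hG]; rw [if_neg h])
  have A : HasSum (gs v s) a ↔ HasSum G a := by
    refine hasSum_iff_hasSum_of_ne_zero_bij (fun p => e1 p.1) ?_ ?_ ?_
    · intro p p' h
      exact Subtype.ext (e1_inj (sup _ p.2).1 (sup _ p'.2).1 h)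
    · intro x hx
      have h0 : 0 ∉ x := fun h => hx (by simp [gs, wt, h])
      obtain ⟨p, hp, rfl⟩ := e1_surj h0
      have hc : 0 ≤ ((e1 p).card : ℤ) + s := by
        by_contra h
        exact hx (by simp only [gs, ind, if_neg h]; simp)
      have hr : rk (e1 p) ≤ s + 1 := by
        by_contra h
        have h' : ¬ rk (e1 p) ≤ s := by omega
        exact hx (by simp only [gs, ind, if_neg h, if_neg h']; simp)
      have ht : (p.1.sup : ℤ) ≤ tp s p := by
        unfold rk at hr
        rw [e1_sup] at hr
        rw [e1_card] at hr hc
        unfold tp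
        push_cast at hc
        by_cases hp : p.1 = 0
        · simp [hp] at *; omega
        · rw [if_neg hp] at hr; push_cast at hr; omega
      refine ⟨⟨p, ?_⟩, rfl⟩
      rw [Function.mem_support]
      simp only [hG]
      rw [if_pos ⟨hp, ht⟩]
      exact hx
    · intro p
      simp only [hG]
      rw [if_pos (sup _ p.2)]
  have B : HasSum (fs v s) a ↔ HasSum G a := by
    refine hasSum_iff_hasSum_of_ne_zero_bij (fun p => e2 s p.1) ?_ ?_ ?_
    · intro p p' h
      exact Subtype.ext (e2_inj s (sup _ p.2).1 (sup _ p'.2).1 (sup _ p.2).2 (sup _ p'.2).2 h)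
    · intro x hx
      have h0 : 0 ∉ x := fun h => hx (by simp [fs, wt, h])
      have hc : x = 0 → s ≤ 0 := by
        by_contra h
        exact hx (by simp only [fs, ind, if_neg h]; simp)
      have hr : s - 1 ≤ rk x := by
        by_contra h
        have h' : ¬ s ≤ rk x := by omega
        exact hx (by simp only [fs, ind, if_neg h, if_neg h']; simp)
      obtain ⟨p, hp, ht, rfl⟩ := e2_surj s h0 hr hc
      refine ⟨⟨p, ?_⟩, rfl⟩
      rw [Function.mem_support]
      simp only [hG]
      rw [if_pos ⟨hp, ht⟩, ← fg v0 s p hp ht]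
      exact hx
    · intro p
      simp only [hG]
      rw [if_pos (sup _ p.2), fg v0 s p.1 (sup _ p.2).1 (sup _ p.2).2]
  rw [A, B]


noncomputable def Hh (v : ℝ) (m : ℤ) : ℝ := ∑' x, ind (m ≤ rk x) * wt v x
noncomputable def PP (v : ℝ) : ℝ := ∑' x, wt v x
noncomputable def Kh (v : ℝ) (m : ℤ) : ℝ := Hh v m + Hh v (m+1)

lemma wt_nn {v : ℝ} (v0 : 0 < v) (x) : 0 ≤ wt v x := by
  unfold wt; split_ifs
  · exact le_rfl
  · positivity

lemma ind_nn (p : Prop) [Decidable p] : 0 ≤ ind p := by unfold ind; split_ifs <;> norm_num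
lemma ind_le (p : Prop) [Decidable p] : ind p ≤ 1 := by unfold ind; split_ifs <;> norm_num

lemma sm_ind {v : ℝ} (v0 : 0 < v) (W : Summable (wt v)) (p : Multiset ℕ → Prop) [∀ x, Decidable (p x)] :
    Summable (fun x => ind (p x) * wt v x) :=
  W.of_nonneg_of_le (fun x => mul_nonneg (ind_nn _) (wt_nn v0 x))
    (fun x => mul_le_of_le_one_left (wt_nn v0 x) (ind_le _))

lemma Hh_sum {v : ℝ} (v0 : 0 < v) (W : Summable (wt v)) (m : ℤ) :
    HasSum (fun x => ind (m ≤ rk x) * wt v x) (Hh v m) := (sm_ind v0 W _).hasSum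

lemma Hh_nn {v : ℝ} (v0 : 0 < v) (m : ℤ) : 0 ≤ Hh v m :=
  tsum_nonneg fun x => mul_nonneg (ind_nn _) (wt_nn v0 x)
lemma Hh_le {v : ℝ} (v0 : 0 < v) (W : Summable (wt v)) (m : ℤ) : Hh v m ≤ PP v :=
  hasSum_le (fun x => mul_le_of_le_one_left (wt_nn v0 x) (ind_le _)) (Hh_sum v0 W m) W.hasSum

lemma rk_zero : rk 0 = 0 := by simp [rk]
lemma wt_zero (v : ℝ) : wt v 0 = 1 := by simp [wt]

lemma Kh_rec {v : ℝ} (v0 : 0 < v) (W : Summable (wt v)) (s : ℤ) :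
    Kh v (s-1) - (if s = 1 then 1 else 0) = v^s * (2 * PP v - Kh v (s+1)) - (if s = -1 then v^(-1:ℤ) else 0) := by
  classical
  have e0 : ∀ c : ℝ, HasSum (fun x : Multiset ℕ => if x = 0 then c else 0) c := fun c => by
    have := hasSum_single (f := fun x : Multiset ℕ => if x = 0 then c else 0) 0 (fun b hb => if_neg hb)
    simpa using this
  have h1 : HasSum (fs v s) (Kh v (s-1) - (if s = 1 then 1 else 0)) := by
    refine HasSum.cg (((Hh_sum v0 W (s-1)).add (Hh_sum v0 W (s-1+1))).sub (e0 (if s = 1 then 1 else 0))) (fun x => ?_) rfl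
    unfold fs
    rw [sub_add_cancel]
    by_cases hx : x = 0
    · subst hx
      simp only [rk_zero, wt_zero, ind, if_true, forall_const]
      split_ifs <;> first | (exfalso; omega) | norm_num
    · rw [if_neg hx]
      have : ind (x = 0 → s ≤ 0) = 1 := if_pos fun h => absurd h hx
      rw [this]; ring
  have h2 : HasSum (gs v s) (v^s * (2 * PP v - Kh v (s+1)) - (if s = -1 then v^(-1:ℤ) else 0)) := by
    refine HasSum.cg ((((W.hasSum.mul_left 2).sub ((Hh_sum v0 W (s+1)).add (Hh_sum v0 W (s+1+1)))).mul_left (v^s)).sub (e0 (if s = -1 then v^(-1:ℤ) else 0))) (fun x => ?_) rfl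
    unfold gs
    by_cases hx : x = 0
    · subst hx
      simp only [rk_zero, wt_zero, ind, if_true, Multiset.card_zero, Nat.cast_zero]
      by_cases hs : s = -1
      · subst hs; norm_num
      · split_ifs <;> first | (exfalso; omega) | ring
    · rw [if_neg hx]
      by_cases h0 : 0 ∈ x
      · have : wt v x = 0 := if_pos h0
        rw [this]; ring
      · have hs : x.sup ≠ 0 := fun e => hx (sup_eq_zero' h0 e)
        have hc : rk x = (x.sup : ℤ) - x.card := rfl
        generalize rk x = r at *
        unfold ind
        split_ifs <;> first | (exfalso; omega) | ring
  exact h1.unique ((fs_gs v0 s _).2 h2)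

lemma dec_zero {v C : ℝ} (k0 : ℕ) (v0 : 0 < v) (v1 : v < 1) (f : ℕ → ℝ) (hC : ∀ m, |f m| ≤ C)
    (h : ∀ m, f m = - v^(m+1+k0) * f (m+2)) (m : ℕ) : f m = 0 := by
  have h1 : ∀ k m, |f m| ≤ v^k * C := fun k => by
    induction k with
    | zero => simpa using hC
    | succ k ih =>
      intro m
      rw [h, abs_mul, abs_neg, abs_of_pos (pow_pos v0 _)]
      have h2 : v^(m+1+k0) ≤ v := pow_le_of_le_one v0.le v1.le (by omega)
      calc v^(m+1+k0) * |f (m+2)| ≤ v * (v^k * C) := mul_le_mul h2 (ih _) (abs_nonneg _) v0.le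
        _ = _ := by ring
  have h3 : Tendsto (fun k : ℕ => v^k * C) atTop (𝓝 0) := by
    simpa using (tendsto_pow_atTop_nhds_zero_of_lt_one v0.le v1).mul_const C
  have := ge_of_tendsto' h3 (fun k => h1 k m)
  exact abs_eq_zero.1 (le_antisymm this (abs_nonneg _))

lemma Kh_nn {v : ℝ} (v0 : 0 < v) (m : ℤ) : 0 ≤ Kh v m := add_nonneg (Hh_nn v0 _) (Hh_nn v0 _)
lemma Kh_le {v : ℝ} (v0 : 0 < v) (W : Summable (wt v)) (m : ℤ) : Kh v m ≤ 2 * PP v := by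
  have := Hh_le v0 W m; have := Hh_le v0 W (m+1); unfold Kh; linarith

lemma Kh_refl' {v : ℝ} (v0 : 0 < v) (v1 : v < 1) (W : Summable (wt v)) (m : ℕ) :
    2 * PP v - Kh v (m+1) - Kh v (-(m+1)) = 0 := by
  refine dec_zero (C := 2 * PP v) 1 v0 v1 (fun m : ℕ => 2 * PP v - Kh v (m+1) - Kh v (-(m+1))) (fun m => ?_) (fun m => ?_) m
  · have := Kh_nn v0 (m+1); have := Kh_nn v0 (-(m+1)); have := Kh_le v0 W (m+1); have := Kh_le v0 W (-(m+1))
    rw [abs_le]; constructor <;> linarith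
  · try dsimp only
    have a1 := Kh_rec v0 W ((m:ℤ)+2)
    have a2 := Kh_rec v0 W (-((m:ℤ)+2))
    rw [if_neg (by omega), if_neg (by omega)] at a1 a2
    rw [zpow_neg] at a2
    have e1 : (v:ℝ)^((m:ℤ)+2) = v^(m+2) := by
      rw [← zpow_natCast]; push_cast; rfl
    rw [e1] at a1 a2
    have hv := pow_pos v0 (m+2)
    push_cast
    have i1 : (m:ℤ)+2-1 = m+1 := by ring
    have i2 : (m:ℤ)+2+1 = m+3 := by ring
    have i3 : -((m:ℤ)+2)-1 = -(m+3) := by ring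
    have i4 : -((m:ℤ)+2)+1 = -(m+1) := by ring
    have i5 : (m:ℤ)+2+1 = m+3 := by ring
    rw [i1, i2] at a1
    rw [i3, i4] at a2
    rw [i5, show m+1+1 = m+2 from rfl]
    field_simp at a2
    linear_combination - a1 - a2

lemma PK {v : ℝ} (v0 : 0 < v) (v1 : v < 1) (W : Summable (wt v)) : PP v = Kh v 0 := by
  have a1 := Kh_rec v0 W 1
  have a2 := Kh_rec v0 W (-1)
  have a3 := Kh_refl' v0 v1 W 1
  norm_num at a1 a2 a3
  field_simp at a2
  linear_combination (1/2) * (- v * a3 - a1 - a2)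

lemma Kh_refl {v : ℝ} (v0 : 0 < v) (v1 : v < 1) (W : Summable (wt v)) (m : ℕ) :
    Kh v (-m) = 2 * PP v - Kh v m := by
  rcases m with _ | m
  · have := PK v0 v1 W; simp; linarith
  · have := Kh_refl' v0 v1 W m; push_cast; linarith

/-- partial theta -/
noncomputable def Th (v : ℝ) (m : ℕ) : ℝ := ∑' n : ℕ, (-1)^n * v^((n+1)^2 + m*(n+1))

lemma Th_bd {v : ℝ} (v0 : 0 < v) (v1 : v < 1) (m n : ℕ) :
    ‖(-1:ℝ)^n * v^((n+1)^2 + m*(n+1))‖ ≤ v^n := by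
  rw [norm_mul, norm_pow, norm_neg, norm_one, one_pow, one_mul, Real.norm_of_nonneg (by positivity)]
  exact pow_le_pow_of_le_one v0.le v1.le (by nlinarith [Nat.zero_le (m*(n+1))])

lemma Th_sum {v : ℝ} (v0 : 0 < v) (v1 : v < 1) (m : ℕ) :
    HasSum (fun n : ℕ => (-1:ℝ)^n * v^((n+1)^2 + m*(n+1))) (Th v m) :=
  (Summable.of_norm_bounded (summable_geometric_of_lt_one v0.le v1) (Th_bd v0 v1 m)).hasSum

lemma Th_rec {v : ℝ} (v0 : 0 < v) (v1 : v < 1) (m : ℕ) : Th v m = v^(m+1) * (1 - Th v (m+2)) := by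
  have h1 := (hasSum_nat_add_iff' (f := fun n : ℕ => (-1:ℝ)^n * v^((n+1)^2 + m*(n+1))) 1).2 (Th_sum v0 v1 m)
  have h2 := h1.unique (HasSum.cg ((Th_sum v0 v1 (m+2)).mul_left (-v^(m+1))) (fun n => ?_) rfl)
  · simp at h2
    rw [sub_eq_iff_eq_add] at h2
    rw [h2]; ring
  · try dsimp only
    rw [show (n+1+1)^2 + m*(n+1+1) = (m+1) + ((n+1)^2+(m+2)*(n+1)) by ring]
    ring

lemma Kh_Th {v : ℝ} (v0 : 0 < v) (v1 : v < 1) (W : Summable (wt v)) (m : ℕ) :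
    Kh v m = 2 * PP v * Th v m + if m = 0 then 1 else 0 := by
  have hb : ∀ m, |Th v m| ≤ (1-v)⁻¹ := fun m => by
    rw [← tsum_geometric_of_lt_one v0.le v1]
    exact tsum_of_norm_bounded (summable_geometric_of_lt_one v0.le v1).hasSum (Th_bd v0 v1 m)
  have := dec_zero (C := 2 * PP v + 2 * PP v * (1-v)⁻¹ + 1) 0 v0 v1
    (fun m : ℕ => Kh v m - 2 * PP v * Th v m - if m = 0 then 1 else 0) (fun m => ?_) (fun m => ?_) m
  · linarith
  · have p0 : 0 ≤ PP v := tsum_nonneg (wt_nn v0)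
    have a1 : |Kh v m| ≤ 2 * PP v := by rw [abs_of_nonneg (Kh_nn v0 m)]; exact Kh_le v0 W m
    have a2 : |2 * PP v * Th v m| ≤ 2 * PP v * (1-v)⁻¹ := by
      rw [abs_mul, abs_of_nonneg (by positivity)]; exact mul_le_mul_of_nonneg_left (hb m) (by positivity)
    have a3 : |if m = 0 then (1:ℝ) else 0| ≤ 1 := by split_ifs <;> simp
    exact (abs_sub _ _).trans (add_le_add ((abs_sub _ _).trans (add_le_add a1 a2)) a3)
  · try dsimp only
    have a1 := Kh_rec v0 W ((m:ℤ)+1)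
    rw [if_neg (by omega : ¬ (m:ℤ)+1 = -1), sub_zero, add_sub_cancel_right] at a1
    have e1 : (v:ℝ)^((m:ℤ)+1) = v^(m+1) := by
      rw [← zpow_natCast]; push_cast; rfl
    rw [e1] at a1
    rw [add_zero, Th_rec v0 v1 m, if_neg (by omega : ¬ m+2 = 0)]
    have i1 : ((m+2:ℕ):ℤ) = m+1+1 := by push_cast; ring
    rw [i1]
    have : (if (m:ℤ)+1 = 1 then (1:ℝ) else 0) = if m = 0 then 1 else 0 := by
      split_ifs <;> first | rfl | omega
    rw [this] at a1
    linear_combination a1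

lemma phi_Th {v : ℝ} (v0 : 0 < v) (v1 : v < 1) : phi v = 1 - 2 * Th v 0 := by
  have h : HasSum (fun n : ℤ => (-1:ℝ)^n * v^(n*n)) (phi v) := by
    have := (phi_sum v0 v1 0).hasSum
    simpa [phi] using this
  have h1 := (hasSum_nat_add_iff' 1).2 h.nat_add_neg
  have h2 := h1.unique (HasSum.cg ((Th_sum v0 v1 0).mul_left (-2)) (fun n => ?_) rfl)
  · simp at h2; linarith
  · try dsimp only
    rw [neg_mul_neg, zpow_neg, ← inv_zpow, show ((-1:ℝ))⁻¹ = -1 by norm_num]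
    rw [← Nat.cast_mul, zpow_natCast, zpow_natCast]
    rw [show (n+1)*(n+1) = (n+1)^2+0*(n+1) by ring]; ring

lemma P_phi {v : ℝ} (v0 : 0 < v) (v1 : v < 1) (W : Summable (wt v)) : PP v * phi v = 1 := by
  have h := Kh_Th v0 v1 W 0
  have := PK v0 v1 W
  rw [phi_Th v0 v1]
  simp at h
  linear_combination this + h


noncomputable def RR (v : ℝ) (a : ℤ) : ℝ := ∑' x, ind (rk x % 5 = a) * wt v x

lemma ind_split {A B C : Prop} [Decidable A] [Decidable B] [Decidable C] (h : C ↔ A ∧ ¬ B) (h2 : B → A) :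
    ind C = ind A - ind B := by
  unfold ind
  by_cases hA : A <;> by_cases hB : B <;> simp [h, hA, hB]
  exact hA (h2 hB)

lemma Lsum {v : ℝ} (v0 : 0 < v) (W : Summable (wt v)) (a : ℤ) :
    HasSum (fun j : ℤ => Kh v (5*j+a) - Kh v (5*j+a+1))
      (∑' x, ind ((rk x - a) % 5 = 0 ∨ (rk x - a) % 5 = 1) * wt v x) := by
  have hx : ∀ x, HasSum (fun j : ℤ => ind (5*j+a ≤ rk x ∧ rk x < 5*j+a+2) * wt v x)
      (ind ((rk x - a) % 5 = 0 ∨ (rk x - a) % 5 = 1) * wt v x) := fun x => by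
    refine HasSum.cg (hasSum_single (f := fun j : ℤ => ind (5*j+a ≤ rk x ∧ rk x < 5*j+a+2) * wt v x) ((rk x - a)/5) (fun b hb => ?_)) (fun _ => rfl) ?_
    · have : ¬ (5*b+a ≤ rk x ∧ rk x < 5*b+a+2) := by omega
      simp only [ind, if_neg this, zero_mul]
    · try dsimp only
      congr 1
      unfold ind
      split_ifs <;> first | rfl | (exfalso; omega)
  have hs : Summable (fun p : Multiset ℕ × ℤ => ind (5*p.2+a ≤ rk p.1 ∧ rk p.1 < 5*p.2+a+2) * wt v p.1) := by
    rw [summable_prod_of_nonneg (fun p => mul_nonneg (ind_nn _) (wt_nn v0 _))]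
    refine ⟨fun x => (hx x).summable, ?_⟩
    exact (sm_ind v0 W (fun x => (rk x - a) % 5 = 0 ∨ (rk x - a) % 5 = 1)).congr fun x => (hx x).tsum_eq.symm
  have h1 := hs.hasSum.prod_fiberwise hx
  have h2 := ((Equiv.prodComm ℤ (Multiset ℕ)).hasSum_iff.2 hs.hasSum)
  rw [h1.tsum_eq]
  refine h2.prod_fiberwise fun j => ?_
  refine HasSum.cg ((Hh_sum v0 W (5*j+a)).sub (Hh_sum v0 W (5*j+a+1+1))) (fun x => ?_) ?_
  · simp only [Function.comp, Equiv.prodComm_apply, Prod.swap]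
    rw [← sub_mul]; congr 1
    exact ind_split (by omega) (by omega)
  · unfold Kh; ring

lemma Kh_neg {v : ℝ} (v0 : 0 < v) (v1 : v < 1) (W : Summable (wt v)) (m : ℕ) :
    Kh v (-(m+1)) - Kh v (-m) = Kh v m - Kh v (m+1) := by
  have h1 := Kh_refl v0 v1 W m
  have h2 := Kh_refl v0 v1 W (m+1)
  push_cast at h2
  rw [h1, h2]; ring

lemma Dsum {v : ℝ} (v0 : 0 < v) (v1 : v < 1) (W : Summable (wt v)) :
    HasSum (fun j : ℕ => 2 * PP v * (Th v (5*j) - 2 * Th v (5*j+1) + Th v (5*j+2) - Th v (5*j+3) + 2 * Th v (5*j+4) - Th v (5*j+5))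
      + if j = 0 then 1 else 0) (RR v 0 - RR v 2) := by
  have h0 := (Lsum v0 W 0).nat_add_neg_add_one
  have h1 := (Lsum v0 W 1).nat_add_neg_add_one
  refine HasSum.cg (h0.sub h1) (fun j => ?_) ?_
  · have a0 := Kh_neg v0 v1 W (5*j+4)
    have a1 := Kh_neg v0 v1 W (5*j+3)
    have k0 := Kh_Th v0 v1 W (5*j)
    have k1 := Kh_Th v0 v1 W (5*j+1)
    have k2 := Kh_Th v0 v1 W (5*j+2)
    have k3 := Kh_Th v0 v1 W (5*j+3)
    have k4 := Kh_Th v0 v1 W (5*j+4)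
    have k5 := Kh_Th v0 v1 W (5*j+5)
    rw [if_neg (by omega)] at k1 k2 k3 k4 k5
    have hj : (if 5 * j = 0 then (1:ℝ) else 0) = if j = 0 then 1 else 0 := by
      split_ifs <;> first | rfl | omega
    rw [hj] at k0
    push_cast at a0 a1 k0 k1 k2 k3 k4 k5
    ring_nf at a0 a1 k0 k1 k2 k3 k4 k5 ⊢
    linear_combination - a0 + a1 - k0 + 2 * k1 - k2 + k3 - 2 * k4 + k5
  · rw [← (sm_ind v0 W _).tsum_sub (sm_ind v0 W _)]
    unfold RR
    rw [← (sm_ind v0 W _).tsum_sub (sm_ind v0 W _)]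
    refine tsum_congr fun x => ?_
    rw [← sub_mul, ← sub_mul]; congr 1
    unfold ind
    split_ifs <;> first | (exfalso; omega) | norm_num

lemma Xsum {v : ℝ} (v0 : 0 < v) (v1 : v < 1) : ∃ S,
    HasSum (fun j : ℕ => Th v (5*j) - 2 * Th v (5*j+1) + Th v (5*j+2) - Th v (5*j+3) + 2 * Th v (5*j+4) - Th v (5*j+5)) S ∧
    HasSum (fun n : ℕ => (-1)^n * v^((n+1)^2) * (1 - 2*v^(n+1) + (v^(n+1))^2 - (v^(n+1))^3 + 2*(v^(n+1))^4 - (v^(n+1))^5) / (1 - (v^(n+1))^5)) S := by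
  have hs : Summable (fun p : ℕ × ℕ => (-1:ℝ)^p.1 * v^((p.1+1)^2) * (1 - 2*v^(p.1+1) + (v^(p.1+1))^2 - (v^(p.1+1))^3 + 2*(v^(p.1+1))^4 - (v^(p.1+1))^5) * ((v^(p.1+1))^5)^p.2) := by
    have g := summable_geometric_of_lt_one v0.le v1
    refine Summable.of_norm_bounded ((g.mul_of_nonneg g (fun n => by dsimp; positivity) (fun n => by dsimp; positivity)).mul_left 8) fun p => ?_
    have x0 := pow_pos v0 (p.1+1)
    have x1 := pow_le_one₀ v0.le v1.le (n := p.1+1)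
    have b1 : v^((p.1+1)^2) ≤ v^p.1 := pow_le_pow_of_le_one v0.le v1.le (by nlinarith)
    have b2 : ((v^(p.1+1))^5)^p.2 ≤ v^p.2 := by
      rw [← pow_mul, ← pow_mul]
      exact pow_le_pow_of_le_one v0.le v1.le (by nlinarith [Nat.zero_le (p.1*p.2)])
    have b3 : |1 - 2*v^(p.1+1) + (v^(p.1+1))^2 - (v^(p.1+1))^3 + 2*(v^(p.1+1))^4 - (v^(p.1+1))^5| ≤ 8 := by
      generalize v^(p.1+1) = x at *
      have y2 := pow_le_one₀ x0.le x1 (n := 2)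
      have y3 := pow_le_one₀ x0.le x1 (n := 3)
      have y4 := pow_le_one₀ x0.le x1 (n := 4)
      have y5 := pow_le_one₀ x0.le x1 (n := 5)
      have z2 := pow_pos x0 2
      have z3 := pow_pos x0 3
      have z4 := pow_pos x0 4
      have z5 := pow_pos x0 5
      rw [abs_le]; constructor <;> linarith
    rw [norm_mul, norm_mul, norm_mul, norm_pow, norm_neg, norm_one, one_pow, one_mul, Real.norm_of_nonneg (by positivity : 0 ≤ v^((p.1+1)^2)),
      Real.norm_of_nonneg (by positivity : 0 ≤ ((v^(p.1+1))^5)^p.2), Real.norm_eq_abs]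
    calc _ ≤ v^p.1 * 8 * v^p.2 := by gcongr
      _ = _ := by ring
  refine ⟨_, ?_, hs.hasSum.prod_fiberwise fun n => ?_⟩
  · refine ((Equiv.prodComm ℕ ℕ).hasSum_iff.2 hs.hasSum).prod_fiberwise fun j => ?_
    refine HasSum.cg ((((((Th_sum v0 v1 (5*j)).sub ((Th_sum v0 v1 (5*j+1)).mul_left 2)).add (Th_sum v0 v1 (5*j+2))).sub (Th_sum v0 v1 (5*j+3))).add ((Th_sum v0 v1 (5*j+4)).mul_left 2)).sub (Th_sum v0 v1 (5*j+5))) (fun n => ?_) rfl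
    simp only [Function.comp, Equiv.prodComm_apply, Prod.swap, pow_add, add_mul, mul_add]
    ring
  · have x0 := pow_pos v0 (n+1)
    have x1 := pow_lt_one₀ v0.le v1 (n := n+1) (by omega)
    exact HasSum.cg ((hasSum_geometric_of_lt_one (pow_nonneg x0.le 5) (pow_lt_one₀ x0.le x1 (by norm_num))).mul_left _) (fun j => rfl) (by rw [div_eq_mul_inv])

lemma UU_nat {v : ℝ} (v0 : 0 < v) (v1 : v < 1) (b c : ℕ) (hbc : b + c = 5) :
    HasSum (fun n : ℕ => (-1)^(n+1) * v^((n+1)^2) * ((v^(n+1))^b - (v^(n+1))^c) / (1 - (v^(n+1))^5)) (UU v b) := by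
  have h1 := (hasSum_nat_add_iff' 1).2 (UU_sum v0 v1 b).hasSum.nat_add_neg
  refine HasSum.cg h1 (fun n => ?_) ?_
  · have x0 := pow_pos v0 (n+1)
    have x1 := pow_lt_one₀ v0.le v1 (n := n+1) (by omega)
    have x5 := pow_lt_one₀ x0.le x1 (n := 5) (by norm_num)
    try dsimp only
    unfold kc
    rw [neg_mul_neg, mul_neg, zpow_neg, ← inv_zpow, show ((-1:ℝ))⁻¹ = -1 by norm_num]
    have e1 : (v^5)^((n+1:ℕ):ℤ) = (v^(n+1))^5 := by rw [zpow_natCast]; ring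
    have e2 : (v^5)^(-((n+1:ℕ):ℤ)) = ((v^(n+1))^5)⁻¹ := by rw [zpow_neg, e1]
    have e3 : v^(((n+1:ℕ):ℤ)*((n+1:ℕ):ℤ) + b * ((n+1:ℕ):ℤ)) = v^((n+1)^2) * (v^(n+1))^b := by
      rw [zpow_add₀ v0.ne', ← Nat.cast_mul, ← Nat.cast_mul, zpow_natCast, zpow_natCast, mul_comm b, pow_mul]; ring
    have e4 : v^(((n+1:ℕ):ℤ)*((n+1:ℕ):ℤ) + -(b * ((n+1:ℕ):ℤ))) = v^((n+1)^2) / (v^(n+1))^b := by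
      rw [zpow_add₀ v0.ne', zpow_neg, ← Nat.cast_mul, ← Nat.cast_mul, zpow_natCast, zpow_natCast, mul_comm b, pow_mul, div_eq_mul_inv]; ring
    rw [e1, e2, e3, e4, zpow_natCast]
    have hh : (v^(n+1))^5 = (v^(n+1))^b * (v^(n+1))^c := by rw [← pow_add, hbc]
    have xb := pow_pos x0 b
    have xc := pow_pos x0 c
    rw [hh] at x5 ⊢
    generalize (v^(n+1))^b = B at *
    generalize (v^(n+1))^c = C at *
    have h3 : 1 - B*C ≠ 0 := by linarith
    have h4 : 1 - 1 * (B*C)⁻¹ = - (1 - B*C) / (B*C) := by field_simp; ring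
    rw [h4, one_mul]
    field_simp
    ring
  · simp [UU, kc]

theorem T1 {v : ℝ} (v0 : 0 < v) (v1 : v < 1) (W : Summable (wt v)) :
    (RR v 0 - RR v 2) * phi v = 1 + 4 * UU v 1 + 2 * UU v 3 := by
  obtain ⟨S, h1, h2⟩ := Xsum v0 v1
  have e0 : HasSum (fun j : ℕ => if j = 0 then (1:ℝ) else 0) 1 := by
    have := hasSum_single (f := fun x : ℕ => if x = 0 then (1:ℝ) else 0) 0 (fun b hb => if_neg hb)
    simpa using this
  have h3 := (Dsum v0 v1 W).unique ((h1.mul_left (2 * PP v)).add e0)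
  have h4 := P_phi v0 v1 W
  have h5 := phi_Th v0 v1
  have u1 := UU_nat v0 v1 1 4 rfl
  have u3 := UU_nat v0 v1 3 2 rfl
  have h6 : 4 * UU v (1:ℕ) + 2 * UU v (3:ℕ) = 2 * S - 2 * Th v 0 := by
    refine ((u1.mul_left 4).add (u3.mul_left 2)).unique (HasSum.cg ((h2.mul_left 2).sub ((Th_sum v0 v1 0).mul_left 2)) (fun n => ?_) rfl)
    have x0 := pow_pos v0 (n+1)
    have x1 := pow_lt_one₀ v0.le v1 (n := n+1) (by omega)
    have x5 := pow_lt_one₀ x0.le x1 (n := 5) (by norm_num)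
    try dsimp only
    rw [zero_mul, add_zero, pow_succ (-1:ℝ) n]
    generalize v^(n+1) = x at *
    have : 1 - x^5 ≠ 0 := by linarith
    field_simp
    ring
  push_cast at h6
  rw [h3]
  linear_combination 2 * S * h4 + h5 - h6


lemma nbar_eq (a : ℤ) (n : ℕ) : nbar a 5 n = ∑ p : n.Partition, if rk p.parts ≡ a [ZMOD 5] then 2^(p.parts.toFinset.card) else 0 := by
  let e : {P : Overpartition n // P.rank ≡ a [ZMOD ((5:ℕ) : ℤ)]} ≃
      Σ p : n.Partition, {A : Finset ℕ // A ⊆ p.parts.toFinset ∧ rk p.parts ≡ a [ZMOD 5]} :=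
    { toFun := fun P => ⟨P.1.1.1, P.1.1.2, P.1.2, P.2⟩
      invFun := fun P => ⟨⟨(P.1, P.2.1), P.2.2.1⟩, P.2.2.2⟩
      left_inv := fun _ => rfl
      right_inv := fun _ => rfl }
  have hf : ∀ p : n.Partition, Finite {A : Finset ℕ // A ⊆ p.parts.toFinset ∧ rk p.parts ≡ a [ZMOD 5]} := fun p =>
    Set.Finite.subset (p.parts.toFinset.powerset.finite_toSet) (fun A hA => by simpa using hA.1)
  unfold nbar
  rw [Nat.card_congr e, Nat.card_sigma]
  refine Finset.sum_congr rfl fun p _ => ?_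
  split_ifs with h
  · rw [← Finset.card_powerset, ← Nat.card_eq_finsetCard]
    refine Nat.card_congr (Equiv.subtypeEquivRight fun A => ?_)
    rw [Finset.mem_powerset]; simp [h]
  · have : IsEmpty {A : Finset ℕ // A ⊆ p.parts.toFinset ∧ rk p.parts ≡ a [ZMOD 5]} := ⟨fun A => h A.2.2⟩
    exact Nat.card_of_isEmpty

def pin (p : Σ n : ℕ, n.Partition) : Multiset ℕ := p.2.parts

lemma pin_inj : Function.Injective pin := by
  rintro ⟨n, p⟩ ⟨m, q⟩ h
  have h' : p.parts = q.parts := h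
  have : n = m := by rw [← p.parts_sum, h', q.parts_sum]
  subst this
  have : p = q := Nat.Partition.ext h'
  rw [this]

lemma pin_range {x : Multiset ℕ} (h : x ∉ Set.range pin) : 0 ∈ x := by
  by_contra h0
  exact h ⟨⟨x.sum, ⟨x, fun {i} hi => Nat.pos_of_ne_zero fun e => h0 (e ▸ hi), rfl⟩⟩, rfl⟩

lemma wt_part (v : ℝ) (p : Σ n : ℕ, n.Partition) : wt v (pin p) = 2^(p.2.parts.toFinset.card) * v^p.1 := by
  have : 0 ∉ pin p := fun h => (lt_irrefl 0 (p.2.parts_pos h))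
  unfold wt
  rw [if_neg this]
  unfold pin
  rw [p.2.parts_sum]

lemma wt_summable {v : ℝ} (v0 : 0 < v) (v1 : v < 1/4) : Summable (wt v) := by
  rw [← pin_inj.summable_iff (f := wt v) (fun x hx => if_pos (pin_range hx))]
  rw [summable_sigma_of_nonneg (f := wt v ∘ pin) (fun p => wt_nn v0 _)]
  refine ⟨fun n => (hasSum_fintype _).summable, ?_⟩
  refine Summable.of_nonneg_of_le (fun n => tsum_nonneg fun p => wt_nn v0 _) (fun n => ?_)
    (summable_geometric_of_lt_one (by positivity : 0 ≤ 4 * v) (by linarith))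
  rw [tsum_fintype]
  have hc : Fintype.card n.Partition ≤ 2^n := by
    refine (Fintype.card_le_of_surjective _ Nat.Partition.ofComposition_surj).trans ?_
    rw [composition_card]
    exact Nat.pow_le_pow_right (by norm_num) (by omega)
  have hb : ∀ p : n.Partition, (wt v ∘ pin) ⟨n, p⟩ ≤ (2 * v)^n := fun p => by
    rw [Function.comp, wt_part, mul_pow]
    have : p.parts.toFinset.card ≤ n := by
      refine (Multiset.toFinset_card_le _).trans ?_
      have h1 := Multiset.card_nsmul_le_sum (s := p.parts) (a := 1) (fun x hx => p.parts_pos hx)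
      rw [p.parts_sum] at h1
      simpa using h1
    have : (2:ℝ)^p.parts.toFinset.card ≤ 2^n := pow_le_pow_right₀ (by norm_num) this
    exact mul_le_mul_of_nonneg_right this (by positivity)
  calc _ ≤ ∑ p : n.Partition, (2*v)^n := Finset.sum_le_sum fun p _ => hb p
    _ = (Fintype.card n.Partition : ℝ) * (2*v)^n := by simp
    _ ≤ 2^n * (2*v)^n := mul_le_mul_of_nonneg_right (by exact_mod_cast hc) (by positivity)
    _ = (4*v)^n := by rw [← mul_pow]; ring

lemma nbar_sum {v : ℝ} (v0 : 0 < v) (W : Summable (wt v)) (a : ℤ) (ha : a % 5 = a) :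
    HasSum (fun n => (nbar a 5 n : ℝ) * v^n) (RR v a) := by
  have h := (sm_ind v0 W (fun x => rk x % 5 = a)).hasSum
  rw [← pin_inj.hasSum_iff (fun x hx => by
    have : wt v x = 0 := if_pos (pin_range hx)
    rw [this, mul_zero])] at h
  refine h.sigma fun n => ?_
  refine HasSum.cg (hasSum_fintype _) (fun p => rfl) ?_
  rw [nbar_eq]
  push_cast
  rw [Finset.sum_mul]
  refine Finset.sum_congr rfl fun p _ => ?_
  rw [Function.comp, wt_part]
  have : (rk (pin ⟨n, p⟩) % 5 = a) ↔ rk p.parts ≡ a [ZMOD 5] := by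
    unfold Int.ModEq pin; rw [ha]
  unfold ind
  by_cases h : rk p.parts ≡ a [ZMOD 5]
  · rw [if_pos h, if_pos (this.2 h), one_mul]
  · rw [if_neg h, if_neg (fun e => h (this.1 e)), zero_mul, zero_mul]

lemma psum_unique {f : ℕ → ℝ} {r : ℝ} (r0 : 0 < r) (h : ∀ v, 0 < v → v < r → HasSum (fun n => f n * v^n) 0) :
    ∀ n, f n = 0 := by
  intro n
  induction n using Nat.strong_induction_on with
  | _ n ih =>
    have h1 : ∀ v, 0 < v → v < r → HasSum (fun k => f (k+n) * v^k) 0 := fun v v0 v1 => by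
      have h2 := (hasSum_nat_add_iff' n).2 (h v v0 v1)
      have h3 : ∑ i ∈ Finset.range n, f i * v^i = 0 := Finset.sum_eq_zero fun i hi => by
        rw [ih i (Finset.mem_range.1 hi), zero_mul]
      rw [h3, sub_zero] at h2
      refine HasSum.cg (h2.mul_left (v^n)⁻¹) (fun k => ?_) (by ring)
      have := pow_pos v0 n
      rw [pow_add]; field_simp
    have hs := (h1 (r/2) (by positivity) (by linarith)).summable.norm
    have hb : ∀ v, 0 < v → v < r/2 → |f n| ≤ v * ((r/2)⁻¹ * ∑' k, ‖f (k+n) * (r/2)^k‖) := fun v v0 v1 => by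
      have h2 := (hasSum_nat_add_iff' 1).2 (h1 v v0 (by linarith))
      simp only [Finset.range_one, Finset.sum_singleton, pow_zero, mul_one, zero_add, zero_sub] at h2
      have h3 : ‖∑' k, f (k+1+n) * v^(k+1)‖ ≤ v * (r/2)⁻¹ * ∑' k, ‖f (k+1+n) * (r/2)^(k+1)‖ := by
        refine tsum_of_norm_bounded (((summable_nat_add_iff 1).2 hs).hasSum.mul_left _) fun k => ?_
        rw [norm_mul, norm_mul, norm_pow, norm_pow, Real.norm_of_nonneg v0.le, Real.norm_of_nonneg (by positivity : 0 ≤ r/2)]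
        have h4 : v^k ≤ (r/2)^k := pow_le_pow_left₀ v0.le v1.le k
        calc ‖f (k+1+n)‖ * v^(k+1) = ‖f (k+1+n)‖ * v * v^k := by ring
          _ ≤ ‖f (k+1+n)‖ * v * (r/2)^k := by gcongr
          _ = _ := by rw [pow_succ]; field_simp
      rw [h2.tsum_eq, norm_neg, Real.norm_eq_abs] at h3
      refine h3.trans ?_
      rw [mul_assoc]
      have h5 : ∑' k, ‖f (k+1+n) * (r/2)^(k+1)‖ ≤ ∑' k, ‖f (k+n) * (r/2)^k‖ := by
        rw [hs.tsum_eq_zero_add]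
        exact le_add_of_nonneg_left (norm_nonneg _)
      gcongr
    have ht : Tendsto (fun v : ℝ => v * ((r/2)⁻¹ * ∑' k, ‖f (k+n) * (r/2)^k‖)) (𝓝[>] 0) (𝓝 0) := by
      have : Tendsto (fun v : ℝ => v * ((r/2)⁻¹ * ∑' k, ‖f (k+n) * (r/2)^k‖)) (𝓝 0) (𝓝 (0 * ((r/2)⁻¹ * ∑' k, ‖f (k+n) * (r/2)^k‖))) :=
        (continuous_id.mul continuous_const).tendsto 0
      rw [zero_mul] at this
      exact this.mono_left nhdsWithin_le_nhds
    have := ge_of_tendsto ht (show ∀ᶠ v in 𝓝[>] (0:ℝ), |f n| ≤ _ by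
      filter_upwards [Ioo_mem_nhdsGT (by positivity : (0:ℝ) < r/2)] with v hv
      exact hb v hv.1 hv.2)
    exact abs_eq_zero.1 (le_antisymm this (abs_nonneg _))

/-- spread -/
lemma spread {c : ℕ → ℝ} {F v : ℝ} (a : ℝ) (r : ℕ) (hr : r < 5) (h : HasSum (fun n => c n * (v^5)^n) F) :
    HasSum (fun n => (if n % 5 = r then a * c (n/5) else 0) * v^n) (a * v^r * F) := by
  have hi : Function.Injective (fun m : ℕ => 5*m+r) := fun x y h => by simp at h; exact h
  rw [← hi.hasSum_iff (fun x hx => ?_)]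
  · refine HasSum.cg (h.mul_left (a * v^r)) (fun m => ?_) rfl
    simp only [Function.comp]
    rw [if_pos (by omega), show (5*m+r)/5 = m by omega, pow_add, pow_mul]; ring
  · rw [if_neg, zero_mul]
    intro e
    exact hx ⟨x/5, by dsimp; omega⟩

lemma At_coeff {F : ℝ → ℝ} (hF : ∀ m, m ≠ 1 → At F m) : ∃ c : ℕ → ℝ, (∀ m, m ≠ 1 → 0 < c m) ∧
    ∀ Q, 0 < Q → Q < 1 → HasSum (fun n => c n * Q^n) (F Q) := by
  have hs : ∀ m, At F m → ∃ c : ℕ → ℝ, 0 < c m ∧ ∀ Q, 0 < Q → Q < 1 → HasSum (fun n => c n * Q^n) (F Q) := by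
    rintro m ⟨e, e0, c, hc, hc2⟩
    refine ⟨fun n => c n + if n = m then e else 0, by simpa using add_pos_of_nonneg_of_pos (hc m) e0, fun Q q0 q1 => ?_⟩
    have h1 := hasSum_single (f := fun n : ℕ => (if n = m then e else 0) * Q^n) m (fun b hb => by rw [if_neg hb, zero_mul])
    refine HasSum.cg ((hc2 Q q0 q1).add h1) (fun n => by ring) (by simp)
  obtain ⟨c, _, hc⟩ := hs 0 (hF 0 (by norm_num))
  refine ⟨c, fun m hm => ?_, hc⟩
  obtain ⟨c', h1, h2⟩ := hs m (hF m hm)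
  have := psum_unique (f := fun n => c n - c' n) one_pos (fun v v0 v1 =>
    HasSum.cg ((hc v v0 v1).sub (h2 v v0 v1)) (fun n => by ring) (by ring)) m
  linarith

lemma At_coeff' {F : ℝ → ℝ} (hF : ∀ m, At F m) : ∃ c : ℕ → ℝ, (∀ m, 0 < c m) ∧
    ∀ Q, 0 < Q → Q < 1 → HasSum (fun n => c n * Q^n) (F Q) := by
  obtain ⟨c, h1, h2⟩ := At_coeff (F := F) (fun m _ => hF m)
  refine ⟨c, fun m => ?_, h2⟩
  by_cases hm : m = 1
  · obtain ⟨e, e0, c', hc, hc2⟩ := hF 1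
    have := psum_unique (f := fun n => c n - (c' n + if n = 1 then e else 0)) one_pos (fun v v0 v1 => by
      have h3 := hasSum_single (f := fun n : ℕ => (if n = 1 then e else 0) * v^n) 1 (fun b hb => by rw [if_neg hb, zero_mul])
      refine HasSum.cg ((h2 v v0 v1).sub ((hc2 v v0 v1).add h3)) (fun n => by ring) (by simp)) 1
    simp at this
    have := hc 1
    subst hm; linarith
  · exact h1 m hm

theorem final (n : ℕ) (h5 : n % 5 = 0 ∨ n % 5 = 1 ∨ n % 5 = 3) (hex : n ∉ ({5, 8} : Set ℕ)) :
    nbar 2 5 n < nbar 0 5 n := by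
  obtain ⟨b, pb, hb⟩ := At_coeff (F := cB) (fun m hm => At_cB hm)
  obtain ⟨c1, pc1, hc1⟩ := At_coeff' (F := cA1) (fun m => At_cA1 m)
  obtain ⟨c3, pc3, hc3⟩ := At_coeff (F := cA3) (fun m hm => At_cA3 hm)
  obtain ⟨G, H, ⟨g, _, hg⟩, ⟨h, _, hh⟩, hGH⟩ := PS_cA4
  have key := psum_unique (f := fun n => ((nbar 0 5 n : ℝ) - nbar 2 5 n) -
    ((if n % 5 = 0 then 1 * b (n/5) else 0) + (if n % 5 = 1 then 2 * c1 (n/5) else 0)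
      + (if n % 5 = 3 then 2 * c3 (n/5) else 0) + (if n % 5 = 4 then 2 * (g (n/5) - h (n/5)) else 0)))
    (r := 1/4) (by norm_num) (fun v v0 v1 => by
      have W := wt_summable v0 v1
      have v1' : v < 1 := by linarith
      have Q0 : 0 < v^5 := by positivity
      have Q1 : v^5 < 1 := pow_lt_one₀ v0.le v1' (by norm_num)
      have h4 : HasSum (fun n => (g n - h n) * (v^5)^n) (cA4 (v^5)) :=
        HasSum.cg ((hg _ Q0 Q1).sub (hh _ Q0 Q1)) (fun n => by ring) (hGH _ Q0 Q1)
      have hp : phi v ≠ 0 := fun e => by have := P_phi v0 v1' W; rw [e] at this; simp at this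
      have hD : RR v 0 - RR v 2 = cB (v^5) + 2 * v * cA1 (v^5) + 2 * v^3 * cA3 (v^5) + 2 * v^4 * cA4 (v^5) :=
        mul_right_cancel₀ hp ((T1 v0 v1' W).trans (T2 v0 v1').symm)
      refine HasSum.cg (((nbar_sum v0 W 0 rfl).sub (nbar_sum v0 W 2 rfl)).sub
        ((((spread 1 0 (by norm_num) (hb _ Q0 Q1)).add (spread 2 1 (by norm_num) (hc1 _ Q0 Q1))).add
          (spread 2 3 (by norm_num) (hc3 _ Q0 Q1))).add (spread 2 4 (by norm_num) h4))) (fun n => ?_) ?_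
      · ring
      · rw [hD]; ring) n
  simp only [Set.mem_insert_iff, Set.mem_singleton_iff, not_or] at hex
  have : (0:ℝ) < (nbar 0 5 n : ℝ) - nbar 2 5 n := by
    rcases h5 with e | e | e
    · have := pb (n/5) (by omega)
      rw [e] at key; norm_num at key; linarith
    · have := pc1 (n/5)
      rw [e] at key; norm_num at key; linarith
    · have := pc3 (n/5) (by omega)
      rw [e] at key; norm_num at key; linarith
  have h6 : (nbar 2 5 n : ℝ) < nbar 0 5 n := by linarith
  exact_mod_cast h6


theorem stmt5 (n : ℕ) (hn : 0 < n) (h5 : n % 5 = 0 ∨ n % 5 = 1 ∨ n % 5 = 3)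
    (hex : n ∉ ({5, 8} : Set ℕ)) :
    nbar 2 5 n < nbar 0 5 n := by
  exact final n h5 hex
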